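/- Fix α ∈ [0,κ] and T > 0. Let ρ ∈ L¹(ℝ,ℂ) ∩ L^∞(ℝ,ℂ) with ρ(−ξ) = conj(ρ(ξ)) for a.e. ξ, and let μ̂₀ : ℝ → ℂ be measurable with ∫_ℝ (1+|ξ|^κ)|μ̂₀(ξ)| dξ < ∞. Assume: there exist σ > 0 and L₀ ≥ 1 such that for all L ≥ L₀, ∫_{|ξ|≥L}|ρ(ξ)|dξ ≤ L^{−σ} and ∫_{|ξ|≥L}|ξ|^κ|μ̂₀(ξ)|dξ ≤ L^{−σ}, and ess sup_ξ |ξ|^κ|μ̂₀(ξ)| < ∞; and if α < 2κ/(κ+2), assume additionally ∫_ℝ |ξ|^{2κ−1}|μ̂₀(ξ)| dξ < ∞. Then there exist τ₀ > 0, ε₀ ∈ (0,1) and C > 0 such that for every 0 < τ < τ₀, every 0 < ε < ε₀, every solution ψ̂ of the twisted Duhamel equation on [0,T], and every integer n ≥ 0 with nτ ≤ T, the exponential-integrator iterates ψ̂ⁿ satisfy ∫_ℝ |ψ̂(nτ,ξ) − ψ̂ⁿ(ξ)| dξ ≤ C τ ε^{1 + (κ−1)α/κ} (1 + τ^{1−1/κ}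 log(1/ε)) + C τ ε^{2 − 2α/κ} log(1/ε) · B_κ(ε,τ), where B_κ(ε,τ) := 1 if κ ≥ 3 and B₂(ε,τ) := (log(1/ε) + log(1/τ))² if κ = 2. In particular the error of the exponential integrator satisfies ‖μ(nτ) − μⁿ‖ ≤ the same bound, uniformly with no coupling condition between τ and ε. -/

import Mathlib

open MeasureTheory Real
open scoped ENNReal NNReal

/-- The dispersion symbol `P(y) = Σ_{0 ≤ 2j < κ} d_{κ−2j} y^{κ−2j}`. -/
noncomputable def P (κ : ℕ) (d : ℕ → ℝ) (y : ℝ) : ℝ :=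
  ∑ j ∈ Finset.range ((κ + 1) / 2), d (κ - 2 * j) * y ^ (κ - 2 * j)

/-- A solution on `[0,T]` of the twisted Duhamel equation
`ψ̂(z,ξ) = μ̂₀(ξ) + ∫₀^z ∫ e^{isε^α(P(ξ) − P(ξ−ξ₁/ε))} ρ(ξ₁) ψ̂(s,ξ−ξ₁/ε) dξ₁ ds`:
a measurable `ψ̂` with `sup_{0≤z≤T} ∫(1+|ξ|^κ)|ψ̂(z,ξ)|dξ < ∞` satisfying the
identity for every `z ∈ [0,T]` and almost every `ξ`. -/
def IsDuhamelSolution (κ : ℕ) (d : ℕ → ℝ) (ε α T : ℝ) (ρ μ₀ : ℝ → ℂ)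
    (ψ : ℝ → ℝ → ℂ) : Prop :=
  Measurable (Function.uncurry ψ) ∧
  (∃ M : ℝ, ∀ z ∈ Set.Icc (0:ℝ) T,
      (∫⁻ ξ : ℝ, ENNReal.ofReal ((1 + |ξ| ^ κ) * ‖ψ z ξ‖)) ≤ ENNReal.ofReal M) ∧
  ∀ z ∈ Set.Icc (0:ℝ) T, ∀ᵐ ξ : ℝ, ψ z ξ = μ₀ ξ +
    ∫ s in (0:ℝ)..z, ∫ ξ₁ : ℝ,
      Complex.exp (Complex.I *
          Complex.ofReal (s * ε ^ α * (P κ d ξ - P κ d (ξ - ξ₁ / ε)))) *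
        ρ ξ₁ * ψ s (ξ - ξ₁ / ε)

/-- The first-order exponential integrator in twisted Fourier variables:
`ψ̂⁰ = μ̂₀`,
`ψ̂^{n+1}(ξ) = ψ̂ⁿ(ξ) + (∫_{nτ}^{(n+1)τ} e^{isε^αP(ξ)} ds) ⋅
  ∫ ρ(ξ₁) e^{−inτε^αP(ξ−ξ₁/ε)} ψ̂ⁿ(ξ−ξ₁/ε) dξ₁`. -/
noncomputable def psiIter (κ : ℕ) (d : ℕ → ℝ) (ρ μ₀ : ℝ → ℂ) (ε α τ : ℝ) :
    ℕ → ℝ → ℂ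
  | 0 => μ₀
  | n + 1 => fun ξ =>
      psiIter κ d ρ μ₀ ε α τ n ξ +
        (∫ s in ((n : ℝ) * τ)..(((n : ℝ) + 1) * τ),
            Complex.exp (Complex.I * Complex.ofReal (s * ε ^ α * P κ d ξ))) *
          ∫ ξ₁ : ℝ, ρ ξ₁ *
            Complex.exp (-Complex.I *
              Complex.ofReal ((n : ℝ) * τ * ε ^ α * P κ d (ξ - ξ₁ / ε))) *
            psiIter κ d ρ μ₀ ε α τ n (ξ - ξ₁ / ε)

/-- The unimodular phase `e^{ix}`. -/
noncomputable def osc (x : ℝ) : ℂ := Complex.exp (Complex.I * Complex.ofReal x)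

lemma norm_osc (x : ℝ) : ‖osc x‖ = 1 := Complex.norm_exp_I_mul_ofReal x

lemma enorm_osc (x : ℝ) : ‖osc x‖ₑ = 1 := by
  rw [← ofReal_norm, norm_osc, ENNReal.ofReal_one]

lemma osc_add (x y : ℝ) : osc (x + y) = osc x * osc y := by
  simp only [osc, ← Complex.exp_add, Complex.ofReal_add, mul_add]

lemma osc_zero : osc 0 = 1 := by simp [osc]

lemma osc_neg_mul_self (x : ℝ) : osc (-x) * osc x = 1 := by
  rw [← osc_add, neg_add_cancel, osc_zero]

lemma continuous_osc : Continuous osc := by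
  unfold osc; fun_prop

lemma measurable_osc : Measurable osc := continuous_osc.measurable

lemma hasDerivAt_osc_mul (c x : ℝ) :
    HasDerivAt (fun r : ℝ => osc (r * c)) (Complex.I * c * osc (x * c)) x := by
  have h : HasDerivAt (fun r : ℝ => Complex.I * Complex.ofReal (r * c)) (Complex.I * c) x := by
    have h1 : HasDerivAt (fun r : ℝ => ((r * c : ℝ) : ℂ)) ((1 * c : ℝ) : ℂ) x :=
      ((hasDerivAt_id x).mul_const c).ofReal_comp
    simpa using h1.const_mul Complex.I
  simpa [osc, mul_comm] using h.cexp

lemma integral_osc {c : ℝ} (hc : c ≠ 0) (s t : ℝ) :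
    ∫ r in s..t, osc (r * c) = (osc (t * c) - osc (s * c)) / (Complex.I * c) := by
  have h0 : Complex.I * c ≠ 0 := by simp [hc]
  have := integral_exp_mul_complex (a := s) (b := t) h0
  simp only [osc, Complex.ofReal_mul]
  rw [← mul_comm (c : ℂ) t, ← mul_comm (c : ℂ) s, ← mul_assoc, ← mul_assoc, ← this]
  congr 1
  ext r
  ring_nf

lemma intervalIntegrable_osc (c s t : ℝ) :
    IntervalIntegrable (fun r => osc (r * c)) volume s t :=
  (continuous_osc.comp (continuous_id.mul continuous_const)).intervalIntegrable s t

lemma norm_integral_osc_le (c s t : ℝ) : ‖∫ r in s..t, osc (r * c)‖ ≤ |t - s| := by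
  simpa using intervalIntegral.norm_integral_le_of_norm_le_const
    (a := s) (b := t) (f := fun r => osc (r * c)) (C := 1) fun x _ => (norm_osc _).le

lemma norm_integral_osc_mul_le {k : ℝ} (hk : 0 ≤ k) (c s t : ℝ) :
    ‖∫ r in s..t, osc (r * c)‖ * (1 + k * |c|) ≤ |t - s| + 2 * k := by
  have h1 := norm_integral_osc_le c s t
  rcases eq_or_ne c 0 with rfl | hc
  · simp only [abs_zero, mul_zero, add_zero, mul_one] at *
    linarith
  have h2 : ‖∫ r in s..t, osc (r * c)‖ * |c| ≤ 2 := by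
    rw [integral_osc hc, norm_div, norm_mul, Complex.norm_I, one_mul, Complex.norm_real,
      Real.norm_eq_abs, div_mul_cancel₀ _ (abs_pos.2 hc).ne']
    calc _ ≤ ‖osc (t * c)‖ + ‖osc (s * c)‖ := norm_sub_le _ _
      _ = 2 := by rw [norm_osc, norm_osc]; norm_num
  nlinarith

/-- The first point of the grid `τℤ` strictly after `r`. -/
noncomputable def nextGrid (τ r : ℝ) : ℝ := (⌊r / τ⌋ + 1) * τ

/-- The phase accumulated between `r` and the next grid point. -/
noncomputable def stepPhase (τ r a : ℝ) : ℂ := ∫ σ in r..nextGrid τ r, osc (σ * a)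

/-- The oscillatory kernel through which the local errors enter the global error. -/
noncomputable def errKernel (τ s t a b : ℝ) : ℂ :=
  ∫ r in s..t, stepPhase τ r a * osc (-(r * b))

lemma nextGrid_add {τ : ℝ} (hτ : 0 < τ) (r : ℝ) : nextGrid τ (r + τ) = nextGrid τ r + τ := by
  unfold nextGrid
  rw [add_div, div_self hτ.ne', Int.floor_add_one]
  push_cast; ring

lemma nextGrid_of_mem {τ : ℝ} (hτ : 0 < τ) (n : ℕ) {r : ℝ} (h0 : n * τ ≤ r)
    (h1 : r < (n + 1) * τ) : nextGrid τ r = (n + 1) * τ := by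
  unfold nextGrid
  have : ⌊r / τ⌋ = n := by
    rw [Int.floor_eq_iff]
    constructor
    · rw [le_div_iff₀ hτ]; exact_mod_cast h0
    · rw [div_lt_iff₀ hτ]; exact_mod_cast h1
  rw [this]; norm_cast

lemma lt_nextGrid {τ : ℝ} (hτ : 0 < τ) (r : ℝ) : r < nextGrid τ r := by
  unfold nextGrid
  exact (div_lt_iff₀ hτ).1 (Int.lt_floor_add_one _)

lemma nextGrid_le {τ : ℝ} (hτ : 0 < τ) (r : ℝ) : nextGrid τ r ≤ r + τ := by
  unfold nextGrid
  have := (le_div_iff₀ hτ).1 (Int.floor_le (r / τ))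
  linarith

lemma measurable_nextGrid (τ : ℝ) : Measurable (nextGrid τ) := by
  unfold nextGrid
  have : Measurable fun r : ℝ => (⌊r / τ⌋ : ℝ) :=
    measurable_from_top.comp (Int.measurable_floor.comp (measurable_id.div_const τ))
  exact (this.add_const 1).mul_const τ

lemma stepPhase_add {τ : ℝ} (hτ : 0 < τ) (r a : ℝ) :
    stepPhase τ (r + τ) a = osc (τ * a) * stepPhase τ r a := by
  unfold stepPhase
  rw [nextGrid_add hτ, ← intervalIntegral.integral_comp_add_right,
    ← intervalIntegral.integral_const_mul]
  simp_rw [add_mul, osc_add, mul_comm]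

lemma norm_stepPhase_le {τ : ℝ} (hτ : 0 < τ) (r a : ℝ) : ‖stepPhase τ r a‖ ≤ τ := by
  refine (norm_integral_osc_le a _ _).trans ?_
  rw [abs_of_pos (sub_pos.2 (lt_nextGrid hτ r))]
  linarith [nextGrid_le hτ r]

lemma measurable_stepPhase (τ : ℝ) : Measurable fun p : ℝ × ℝ => stepPhase τ p.1 p.2 := by
  have hc : Continuous fun q : (ℝ × ℝ) × ℝ => osc (q.2 * q.1.2) :=
    continuous_osc.comp (continuous_snd.mul (continuous_snd.comp continuous_fst))
  have key : Continuous fun q : ℝ × ℝ => ∫ σ in (0:ℝ)..q.1, osc (σ * q.2) := by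
    refine intervalIntegral.continuous_parametric_intervalIntegral_of_continuous
      (f := fun q : ℝ × ℝ => fun σ => osc (σ * q.2)) ?_ continuous_fst
    exact hc
  have : (fun p : ℝ × ℝ => stepPhase τ p.1 p.2) = fun p =>
      (∫ σ in (0:ℝ)..(nextGrid τ p.1), osc (σ * p.2)) - ∫ σ in (0:ℝ)..p.1, osc (σ * p.2) := by
    ext p
    exact (intervalIntegral.integral_interval_sub_left (intervalIntegrable_osc _ _ _)
      (intervalIntegrable_osc _ _ _)).symm
  rw [this]
  refine Measurable.sub ?_ key.measurable
  exact key.measurable.comp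
    (((measurable_nextGrid τ).comp measurable_fst).prodMk measurable_snd)

lemma intervalIntegrable_of_bounded {f : ℝ → ℂ} (hf : Measurable f) {C : ℝ}
    (hC : ∀ x, ‖f x‖ ≤ C) (s t : ℝ) : IntervalIntegrable f volume s t :=
  (intervalIntegrable_const (c := C)).mono_fun hf.aestronglyMeasurable
    (Filter.Eventually.of_forall fun x => by
      rw [Real.norm_eq_abs]; exact (hC x).trans (le_abs_self C))

/-- Integrals of quasi-periodic functions: `f (r + τ) = ω f(r)`. -/
lemma integral_quasiperiodic {f : ℝ → ℂ} {τ : ℝ} {ω : ℂ}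
    (hf : ∀ s t, IntervalIntegrable f volume s t) (hq : ∀ r, f (r + τ) = ω * f r)
    (n : ℕ) (t : ℝ) :
    ∫ r in (0:ℝ)..(n * τ + t), f r =
      (∑ j ∈ Finset.range n, ω ^ j) * (∫ r in (0:ℝ)..τ, f r) + ω ^ n * ∫ r in (0:ℝ)..t, f r := by
  induction n with
  | zero => simp
  | succ n ih =>
    have h1 : ∫ r in τ..((n + 1 : ℕ) * τ + t), f r = ω * ∫ r in (0:ℝ)..(n * τ + t), f r := by
      rw [← intervalIntegral.integral_const_mul]
      simp_rw [← hq]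
      rw [intervalIntegral.integral_comp_add_right]
      congr 1 <;> push_cast <;> ring
    rw [← intervalIntegral.integral_add_adjacent_intervals (hf 0 τ) (hf τ _), h1, ih,
      Finset.sum_range_succ', pow_succ']
    simp_rw [pow_succ', ← Finset.mul_sum]
    ring

lemma norm_integral_quasiperiodic_le {f : ℝ → ℂ} {τ B : ℝ} {ω : ℂ} (hτ : 0 < τ)
    (hf : ∀ s t, IntervalIntegrable f volume s t) (hq : ∀ r, f (r + τ) = ω * f r)
    (hω : ‖ω‖ = 1) (hB : ∀ t, 0 ≤ t → t ≤ τ → ‖∫ r in (0:ℝ)..t, f r‖ ≤ B)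
    {s : ℝ} (hs : 0 ≤ s) :
    ‖∫ r in (0:ℝ)..s, f r‖ ≤ B * (1 + ‖∑ j ∈ Finset.range ⌊s / τ⌋₊, ω ^ j‖) := by
  set n := ⌊s / τ⌋₊
  have h0 : n * τ ≤ s := (le_div_iff₀ hτ).1 (Nat.floor_le (by positivity))
  have h1 : s < (n + 1) * τ := (div_lt_iff₀ hτ).1 (Nat.lt_floor_add_one _)
  have := integral_quasiperiodic hf hq n (s - n * τ)
  rw [add_sub_cancel] at this
  rw [this]
  calc _ ≤ ‖∑ j ∈ Finset.range n, ω ^ j‖ * B + 1 * B := by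
        refine (norm_add_le _ _).trans ?_
        rw [norm_mul, norm_mul, norm_pow, hω, one_pow]
        have e1 := hB τ hτ.le le_rfl
        have e2 := hB (s - n * τ) (by linarith) (by linarith)
        gcongr
    _ = _ := by ring

/-- Decay away from the aliasing lattice `(2π/τ)ℤ`. -/
noncomputable def gridDecay (τ x : ℝ) : ℝ := (1 + ‖(x : AddCircle (2 * π / τ))‖)⁻¹

lemma gridDecay_pos (τ x : ℝ) : 0 < gridDecay τ x := by unfold gridDecay; positivity

lemma norm_addCircle_le_abs (p x : ℝ) : ‖(x : AddCircle p)‖ ≤ |x| := by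
  simpa using QuotientAddGroup.norm_mk_le_norm (S := AddSubgroup.zmultiples p) (m := x)

lemma norm_addCircle_le_half {p : ℝ} (hp : 0 < p) (x : ℝ) : ‖(x : AddCircle p)‖ ≤ p / 2 := by
  simpa [abs_of_pos hp] using AddCircle.norm_le_half_period p hp.ne' (x := (x : AddCircle p))

lemma inv_one_add_abs_le_gridDecay (τ x : ℝ) : (1 + |x|)⁻¹ ≤ gridDecay τ x := by
  unfold gridDecay
  gcongr
  exact norm_addCircle_le_abs _ _

lemma norm_geom_osc_le {τ T : ℝ} (hτ : 0 < τ) (hτ1 : τ ≤ 1) (x : ℝ) {n : ℕ} (hn : n * τ ≤ T) :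
    τ * (1 + ‖∑ j ∈ Finset.range n, osc (τ * x) ^ j‖) ≤ (T + 8) * gridDecay τ x := by
  set S := ∑ j ∈ Finset.range n, osc (τ * x) ^ j with hS
  set δ := ‖(x : AddCircle (2 * π / τ))‖ with hδ
  have hδ0 : 0 ≤ δ := norm_nonneg _
  have hpi := Real.pi_pos
  have hpi4 := Real.pi_lt_d2
  have hT : 0 ≤ T := le_trans (by positivity) hn
  have hhalf : τ * δ ≤ π := by
    have := norm_addCircle_le_half (p := 2 * π / τ) (by positivity) x
    calc τ * δ ≤ τ * (2 * π / τ / 2) := by gcongr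
      _ = π := by field_simp
  have hS1 : ‖S‖ ≤ n := by
    refine (norm_sum_le _ _).trans ?_
    simp [norm_pow, norm_osc]
  have hS2 : ‖S‖ * (τ * δ) ≤ π := by
    have hgeom : ‖osc (τ * x) - 1‖ * ‖S‖ ≤ 2 := by
      rw [← norm_mul, hS, mul_geom_sum]
      refine (norm_sub_le _ _).trans ?_
      rw [norm_pow, norm_osc]; norm_num
    have hlow : 2 / π * (τ * δ) ≤ ‖osc (τ * x) - 1‖ := by
      set k := round ((2 * π / τ)⁻¹ * x) with hk
      have hδ' : δ = |x - k * (2 * π / τ)| := AddCircle.norm_eq _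
      have hper : osc (τ * x) = osc (τ * (x - k * (2 * π / τ))) := by
        unfold osc
        rw [Complex.exp_eq_exp_iff_exists_int]
        refine ⟨k, ?_⟩
        have : τ * (x - k * (2 * π / τ)) = τ * x - k * (2 * π) := by field_simp
        rw [this]; push_cast; ring
      rw [hper, osc, Complex.norm_exp_I_mul_ofReal_sub_one, Real.norm_eq_abs, abs_mul]
      have habs : |τ * (x - k * (2 * π / τ)) / 2| = τ * δ / 2 := by
        rw [hδ', abs_div, abs_mul, abs_of_pos hτ]; norm_num
      have := Real.mul_abs_le_abs_sin (x := τ * (x - k * (2 * π / τ)) / 2)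
        (by rw [habs]; linarith)
      rw [habs] at this
      calc _ = 2 * (2 / π * (τ * δ / 2)) := by ring
        _ ≤ _ := by rw [abs_two]; gcongr
    have h3 : 2 / π * (τ * δ) * ‖S‖ ≤ 2 :=
      (mul_le_mul_of_nonneg_right hlow (norm_nonneg _)).trans hgeom
    have h4 : ‖S‖ * (τ * δ) = π / 2 * (2 / π * (τ * δ) * ‖S‖) := by field_simp
    rw [h4]; nlinarith
  unfold gridDecay
  rw [← hδ, ← div_eq_mul_inv, le_div_iff₀ (by positivity)]
  have hS3 : τ * ‖S‖ ≤ T := le_trans (by rw [mul_comm]; gcongr) hn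
  nlinarith

lemma norm_integral_stepPhase_mul_osc_le {τ : ℝ} (hτ : 0 < τ) (a b : ℝ) {t : ℝ} (ht0 : 0 ≤ t)
    (ht : t ≤ τ) :
    ‖∫ r in (0:ℝ)..t, stepPhase τ r a * osc (-(r * b))‖ ≤ 9 * τ ^ 2 * (1 + τ * |b|)⁻¹ := by
  have hosc : ∀ r, osc (-(r * b)) = osc (r * -b) := fun r => by rw [mul_neg]
  set A : ℝ → ℂ := fun r => ∫ σ in (0:ℝ)..r, osc (σ * a) with hA
  set Q : ℝ → ℂ := fun r => ∫ σ in (0:ℝ)..r, osc (σ * -b) with hQ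
  have hcont : ∀ c : ℝ, Continuous fun r : ℝ => osc (r * c) := fun c =>
    continuous_osc.comp (continuous_id.mul continuous_const)
  have hAd : ∀ r, HasDerivAt A (osc (r * a)) r := fun r =>
    intervalIntegral.integral_hasDerivAt_right (intervalIntegrable_osc _ _ _)
      ((hcont a).stronglyMeasurableAtFilter _ _) (hcont a).continuousAt
  have hQd : ∀ r, HasDerivAt Q (osc (r * -b)) r := fun r =>
    intervalIntegral.integral_hasDerivAt_right (intervalIntegrable_osc _ _ _)
      ((hcont (-b)).stronglyMeasurableAtFilter _ _) (hcont (-b)).continuousAt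
  have hAc : Continuous A := continuous_iff_continuousAt.2 fun r => (hAd r).continuousAt
  have hQb : ∀ r, 0 ≤ r → r ≤ τ → ‖Q r‖ ≤ 3 * τ * (1 + τ * |b|)⁻¹ := by
    intro r h0 h1
    have := norm_integral_osc_mul_le hτ.le (-b) 0 r
    rw [← div_eq_mul_inv, le_div_iff₀ (by positivity)]
    rw [abs_neg, sub_zero, abs_of_nonneg h0] at this
    linarith
  have hAb : ∀ r, 0 ≤ r → r ≤ τ → ‖A r‖ ≤ τ := by
    intro r h0 h1
    refine (norm_integral_osc_le a 0 r).trans ?_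
    rwa [sub_zero, abs_of_nonneg h0]
  have h1 : ∫ r in (0:ℝ)..t, stepPhase τ r a * osc (-(r * b)) =
      ∫ r in (0:ℝ)..t, (A τ - A r) * osc (r * -b) := by
    refine intervalIntegral.integral_congr_ae ?_
    have hne : ∀ᵐ r : ℝ, r ≠ τ := by simp [ae_iff, measure_singleton]
    filter_upwards [hne] with r hr hmem
    rw [Set.uIoc_of_le ht0] at hmem
    have hnext : nextGrid τ r = τ := by
      have := nextGrid_of_mem hτ 0 (r := r) (by simpa using hmem.1.le)
        (by simpa using lt_of_le_of_ne (hmem.2.trans ht) hr)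
      simpa using this
    rw [hosc, stepPhase, hnext, hA]
    congr 1
    exact (intervalIntegral.integral_interval_sub_left (intervalIntegrable_osc _ _ _)
      (intervalIntegrable_osc _ _ _)).symm
  have h2 : ∫ r in (0:ℝ)..t, (A τ - A r) * osc (r * -b) =
      A τ * Q t - (A t * Q t - ∫ r in (0:ℝ)..t, osc (r * a) * Q r) := by
    have h3 := intervalIntegral.integral_mul_deriv_eq_deriv_mul (a := 0) (b := t)
      (u := A) (v := Q) (u' := fun r => osc (r * a)) (v' := fun r => osc (r * -b))
      (fun r _ => hAd r) (fun r _ => hQd r) (intervalIntegrable_osc _ _ _)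
      (intervalIntegrable_osc _ _ _)
    simp_rw [sub_mul]
    rw [intervalIntegral.integral_sub, intervalIntegral.integral_const_mul, h3]
    · simp [hQ, hA]
    · exact (intervalIntegrable_osc _ _ _).const_mul _
    · exact (hAc.mul (hcont _)).intervalIntegrable _ _
  rw [h1, h2]
  set W := 3 * τ * (1 + τ * |b|)⁻¹ with hW
  have hW0 : 0 ≤ W := by positivity
  have h4 : ‖∫ r in (0:ℝ)..t, osc (r * a) * Q r‖ ≤ W * τ := by
    refine (intervalIntegral.norm_integral_le_of_norm_le_const (C := W) ?_).trans ?_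
    · intro r hr
      rw [Set.uIoc_of_le ht0] at hr
      rw [norm_mul, norm_osc, one_mul]
      exact hQb r hr.1.le (hr.2.trans ht)
    · rw [sub_zero, abs_of_nonneg ht0]; gcongr
  calc _ ≤ ‖A τ * Q t‖ + (‖A t * Q t‖ + ‖∫ r in (0:ℝ)..t, osc (r * a) * Q r‖) :=
        (norm_sub_le _ _).trans (by gcongr; exact norm_sub_le _ _)
    _ ≤ τ * W + (τ * W + W * τ) := by
        rw [norm_mul, norm_mul]
        have e1 := hAb τ hτ.le le_rfl
        have e2 := hAb t ht0 ht
        have e3 := hQb t ht0 ht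
        gcongr
    _ = _ := by rw [hW]; ring

lemma norm_errKernel_zero_le {τ T : ℝ} (hτ : 0 < τ) (hτ1 : τ ≤ 1) {s : ℝ} (hs : 0 ≤ s)
    (hsT : s ≤ T) (a b : ℝ) :
    ‖errKernel τ 0 s a b‖ ≤ 18 * (T + 8) * τ * ((1 + τ * |a|)⁻¹ *
      ((1 + τ * |b|)⁻¹ * gridDecay τ (a - b) + (1 + |a - b|)⁻¹)) := by
  have hT : 0 ≤ T := hs.trans hsT
  have hfloor : (⌊s / τ⌋₊ : ℝ) * τ ≤ T :=
    ((le_div_iff₀ hτ).1 (Nat.floor_le (by positivity))).trans hsT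
  have hgeom := norm_geom_osc_le hτ hτ1 (a - b) hfloor
  have hω : ‖osc (τ * (a - b))‖ = 1 := norm_osc _
  have hsplit : ∀ r, osc (-((r + τ) * b)) = osc (-(τ * b)) * osc (-(r * b)) := fun r => by
    rw [← osc_add]; ring_nf
  have hωe : osc (τ * (a - b)) = osc (τ * a) * osc (-(τ * b)) := by
    rw [← osc_add]; ring_nf
  have hmosc : ∀ b : ℝ, Measurable fun r : ℝ => osc (-(r * b)) := fun b =>
    measurable_osc.comp (measurable_id.mul_const b).neg
  set S := ‖∑ j ∈ Finset.range ⌊s / τ⌋₊, osc (τ * (a - b)) ^ j‖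
  have hD := gridDecay_pos τ (a - b)
  set D := gridDecay τ (a - b)
  set w := (1 + τ * |b|)⁻¹ with hw
  have hw0 : 0 < w := by positivity
  set g := (1 + |a - b|)⁻¹ with hg
  have hg0 : 0 < g := by positivity
  rcases le_or_gt (τ * |a|) 1 with ha | ha
  · have hmeas : Measurable fun r => stepPhase τ r a * osc (-(r * b)) :=
      ((measurable_stepPhase τ).comp (measurable_id.prodMk measurable_const)).mul (hmosc b)
    have h1 := norm_integral_quasiperiodic_le (f := fun r => stepPhase τ r a * osc (-(r * b)))
      (ω := osc (τ * (a - b))) hτ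
      (intervalIntegrable_of_bounded hmeas (C := τ) fun r => by
        rw [norm_mul, norm_osc, mul_one]; exact norm_stepPhase_le hτ r a)
      (fun r => by simp only [stepPhase_add hτ, hsplit, hωe]; ring) hω
      (fun t h0 h1 => norm_integral_stepPhase_mul_osc_le hτ a b h0 h1) hs
    have ha2 : 1 / 2 ≤ (1 + τ * |a|)⁻¹ := by
      rw [one_div]; gcongr; linarith
    calc _ ≤ 9 * τ ^ 2 * w * (1 + S) := h1
      _ = 9 * τ * w * (τ * (1 + S)) := by ring
      _ ≤ 9 * τ * w * ((T + 8) * D) := by gcongr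
      _ = 18 * (T + 8) * τ * (1 / 2 * (w * D)) := by ring
      _ ≤ _ := by gcongr; linarith
  · have ha0 : a ≠ 0 := by rintro rfl; simp at ha; linarith
    have hapos : 0 < |a| := abs_pos.2 ha0
    set f2 : ℝ → ℂ := fun r => osc (nextGrid τ r * a) * osc (-(r * b)) with hf2
    have hf2m : Measurable f2 :=
      (measurable_osc.comp ((measurable_nextGrid τ).mul_const a)).mul (hmosc b)
    have hf2i := intervalIntegrable_of_bounded hf2m (C := 1) fun r => by
      rw [hf2, norm_mul, norm_osc, norm_osc, one_mul]
    have h1 := norm_integral_quasiperiodic_le (f := f2) (B := 3 * τ * w)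
      (ω := osc (τ * (a - b))) hτ hf2i
      (fun r => by
        simp only [hf2, nextGrid_add hτ, hsplit, hωe]
        rw [add_mul, osc_add]; ring) hω
      (by
        intro t ht0 ht
        have : ∫ r in (0:ℝ)..t, f2 r = ∫ r in (0:ℝ)..t, osc (τ * a) * osc (r * -b) := by
          refine intervalIntegral.integral_congr_ae ?_
          have hne : ∀ᵐ r : ℝ, r ≠ τ := by simp [ae_iff, measure_singleton]
          filter_upwards [hne] with r hr hmem
          rw [Set.uIoc_of_le ht0] at hmem
          have hnext : nextGrid τ r = τ := by
            have := nextGrid_of_mem hτ 0 (r := r) (by simpa using hmem.1.le)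
              (by simpa using lt_of_le_of_ne (hmem.2.trans ht) hr)
            simpa using this
          simp only [hf2, hnext, mul_neg]
        rw [this, intervalIntegral.integral_const_mul, norm_mul, norm_osc, one_mul, hw,
          ← div_eq_mul_inv, le_div_iff₀ (by positivity)]
        have := norm_integral_osc_mul_le hτ.le (-b) 0 t
        rw [abs_neg, sub_zero, abs_of_nonneg ht0] at this
        linarith) hs
    have h2 : ‖∫ r in (0:ℝ)..s, osc (r * (a - b))‖ ≤ (T + 2) * g := by
      have := norm_integral_osc_mul_le zero_le_one (a - b) 0 s
      rw [sub_zero, abs_of_nonneg hs, one_mul] at this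
      rw [hg, ← div_eq_mul_inv, le_div_iff₀ (by positivity)]
      linarith
    have h3 : errKernel τ 0 s a b =
        (Complex.I * a)⁻¹ * ((∫ r in (0:ℝ)..s, f2 r) - ∫ r in (0:ℝ)..s, osc (r * (a - b))) := by
      rw [← intervalIntegral.integral_sub (hf2i _ _) (intervalIntegrable_osc _ _ _),
        ← intervalIntegral.integral_const_mul, errKernel]
      congr 1
      ext r
      rw [stepPhase, integral_osc ha0, hf2]
      have : osc (r * (a - b)) = osc (r * a) * osc (-(r * b)) := by
        rw [← osc_add]; ring_nf
      rw [this]; field_simp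
    have h4 : |a|⁻¹ ≤ 2 * τ * (1 + τ * |a|)⁻¹ := by
      rw [← div_eq_mul_inv, le_div_iff₀ (by positivity), inv_mul_le_iff₀ hapos]
      linarith
    have hna : ‖(Complex.I * a)⁻¹‖ = |a|⁻¹ := by simp
    calc _ = |a|⁻¹ * ‖(∫ r in (0:ℝ)..s, f2 r) - ∫ r in (0:ℝ)..s, osc (r * (a - b))‖ := by
          rw [h3, norm_mul, hna]
      _ ≤ 2 * τ * (1 + τ * |a|)⁻¹ * (3 * τ * w * (1 + S) + (T + 2) * g) := by
          gcongr
          exact (norm_sub_le _ _).trans (add_le_add h1 h2)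
      _ = 2 * τ * (1 + τ * |a|)⁻¹ * (3 * w * (τ * (1 + S)) + (T + 2) * g) := by ring
      _ ≤ 2 * τ * (1 + τ * |a|)⁻¹ * (3 * w * ((T + 8) * D) + 9 * (T + 8) * g) := by
          gcongr; linarith
      _ ≤ 2 * τ * (1 + τ * |a|)⁻¹ * (9 * (T + 8) * (w * D + g)) := by
          gcongr; nlinarith [mul_nonneg (mul_nonneg hw0.le hD.le) (by linarith : 0 ≤ T + 8)]
      _ = _ := by ring

lemma intervalIntegrable_errKernel {τ : ℝ} (hτ : 0 < τ) (a b s t : ℝ) :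
    IntervalIntegrable (fun r => stepPhase τ r a * osc (-(r * b))) volume s t :=
  intervalIntegrable_of_bounded
    (((measurable_stepPhase τ).comp (measurable_id.prodMk measurable_const)).mul
      (measurable_osc.comp (measurable_id.mul_const b).neg)) (C := τ) (fun r => by
        change ‖stepPhase τ r a * osc (-(r * b))‖ ≤ τ
        rw [norm_mul, norm_osc, mul_one]; exact norm_stepPhase_le hτ r a) s t

lemma norm_errKernel_le {τ T : ℝ} (hτ : 0 < τ) (hτ1 : τ ≤ 1) {s t : ℝ} (hs : 0 ≤ s)
    (hst : s ≤ t) (htT : t ≤ T) (a b : ℝ) :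
    ‖errKernel τ s t a b‖ ≤ 36 * (T + 8) * τ * ((1 + τ * |a|)⁻¹ *
      ((1 + τ * |b|)⁻¹ * gridDecay τ (a - b) + (1 + |a - b|)⁻¹)) := by
  have h : errKernel τ s t a b = errKernel τ 0 t a b - errKernel τ 0 s a b :=
    (intervalIntegral.integral_interval_sub_left (intervalIntegrable_errKernel hτ a b _ _)
      (intervalIntegrable_errKernel hτ a b _ _)).symm
  rw [h]
  have h1 := norm_errKernel_zero_le hτ hτ1 (hs.trans hst) htT a b
  have h2 := norm_errKernel_zero_le hτ hτ1 hs (hst.trans htT) a b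
  have := norm_sub_le (errKernel τ 0 t a b) (errKernel τ 0 s a b)
  linarith

/-- The part of the kernel bound that decays off the diagonal but is not aliased. -/
noncomputable def diagDecay (τ x : ℝ) : ℝ := (1 + |x|)⁻¹ * ((1 + τ * |x|)⁻¹) ^ (1 / 2 : ℝ)

lemma diag_kernel_le {τ : ℝ} (hτ : 0 < τ) (hτ1 : τ ≤ 1) (a b : ℝ) :
    (1 + τ * |a|)⁻¹ * (1 + |a - b|)⁻¹ ≤
      16 * ((1 + τ * |a|)⁻¹ * (1 + τ * |b|)⁻¹ * gridDecay τ (a - b) +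
        ((1 + τ * |a|)⁻¹) ^ (1 / 4 : ℝ) * ((1 + τ * |b|)⁻¹) ^ (1 / 4 : ℝ) *
          diagDecay τ (a - b)) := by
  have hD := gridDecay_pos τ (a - b)
  have hba : |b| ≤ |a| + |a - b| := by
    have := abs_sub_abs_le_abs_sub b a
    rw [abs_sub_comm] at this; linarith
  set w := (1 + τ * |a|)⁻¹ with hw
  set w' := (1 + τ * |b|)⁻¹ with hw'
  set v := (1 + τ * |a - b|)⁻¹ with hv
  set g := (1 + |a - b|)⁻¹ with hg
  have hw0 : 0 < w := by positivity
  have hw0' : 0 < w' := by positivity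
  have hg0 : 0 < g := by positivity
  have hv0 : 0 < v := by positivity
  have hdd : diagDecay τ (a - b) = g * v ^ (1 / 2 : ℝ) := rfl
  rw [hdd]
  have hτb : τ * |b| ≤ τ * |a| + τ * |a - b| := by nlinarith
  rcases le_total (τ * |a - b|) (1 + τ * |a|) with h | h
  · have e1 : w ≤ 2 * v := by
      rw [hw, hv, ← div_eq_mul_inv, le_div_iff₀ (by positivity), inv_mul_le_iff₀ (by positivity)]
      linarith [mul_nonneg hτ.le (abs_nonneg a)]
    have e2 : w ≤ 2 * w' := by
      rw [hw, hw', ← div_eq_mul_inv, le_div_iff₀ (by positivity),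
        inv_mul_le_iff₀ (by positivity)]
      linarith [mul_nonneg hτ.le (abs_nonneg a)]
    have e3 : w ≤ 4 * (w ^ (1 / 4 : ℝ) * w' ^ (1 / 4 : ℝ) * v ^ (1 / 2 : ℝ)) := by
      calc w = w ^ (1 / 4 : ℝ) * w ^ (1 / 4 : ℝ) * w ^ (1 / 2 : ℝ) := by
            rw [← Real.rpow_add hw0, ← Real.rpow_add hw0]; norm_num
        _ ≤ w ^ (1 / 4 : ℝ) * (2 * w') ^ (1 / 4 : ℝ) * (2 * v) ^ (1 / 2 : ℝ) := by gcongr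
        _ = (2 ^ (1 / 4 : ℝ) * 2 ^ (1 / 2 : ℝ)) *
            (w ^ (1 / 4 : ℝ) * w' ^ (1 / 4 : ℝ) * v ^ (1 / 2 : ℝ)) := by
            rw [Real.mul_rpow (by norm_num) hw0'.le, Real.mul_rpow (by norm_num) hv0.le]; ring
        _ ≤ _ := by
            gcongr
            rw [← Real.rpow_add (by norm_num)]
            calc (2:ℝ) ^ (1 / 4 + 1 / 2 : ℝ) ≤ 2 ^ (2 : ℝ) :=
                  Real.rpow_le_rpow_of_exponent_le (by norm_num) (by norm_num)
              _ = 4 := by norm_num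
    set X := w ^ (1 / 4 : ℝ) * w' ^ (1 / 4 : ℝ)
    have hX : 0 ≤ X := by positivity
    have e4 : w * g ≤ 4 * (X * v ^ (1 / 2 : ℝ)) * g := by gcongr
    have e5 : 0 ≤ w * w' * gridDecay τ (a - b) := by positivity
    have e6 : 0 ≤ X * (g * v ^ (1 / 2 : ℝ)) := by positivity
    linarith
  · have e0 : 1 ≤ τ * |a - b| := by linarith [mul_nonneg hτ.le (abs_nonneg a)]
    have e2 : g ≤ 3 * τ * w' := by
      rw [hg, hw', ← div_eq_mul_inv, le_div_iff₀ (by positivity), inv_mul_le_iff₀ (by positivity)]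
      nlinarith [abs_nonneg (a - b)]
    have e3 : τ ≤ 5 * gridDecay τ (a - b) := by
      have hpi := Real.pi_lt_d2
      have hhalf := norm_addCircle_le_half (p := 2 * π / τ) (by positivity) (a - b)
      have : τ * ‖((a - b : ℝ) : AddCircle (2 * π / τ))‖ ≤ π := by
        calc _ ≤ τ * (2 * π / τ / 2) := by gcongr
          _ = π := by field_simp
      unfold gridDecay
      rw [← div_eq_mul_inv, le_div_iff₀ (by positivity)]
      linarith
    calc w * g ≤ w * (3 * (5 * gridDecay τ (a - b)) * w') := by
          gcongr
          exact e2.trans (by gcongr)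
      _ = 15 * (w * w' * gridDecay τ (a - b)) := by ring
      _ ≤ 16 * (w * w' * gridDecay τ (a - b)) := by gcongr; norm_num
      _ ≤ _ := by
          gcongr
          exact le_add_of_nonneg_right (by positivity)

lemma P_neg (κ : ℕ) (c : ℕ → ℝ) (y : ℝ) : P κ c (-y) = (-1) ^ κ * P κ c y := by
  unfold P
  rw [Finset.mul_sum]
  refine Finset.sum_congr rfl fun j hj => ?_
  rw [Finset.mem_range] at hj
  have h : κ = (κ - 2 * j) + 2 * j := by omega
  rw [neg_pow y]
  conv_rhs => rw [h]
  rw [pow_add, pow_mul (-1 : ℝ) 2 j]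
  simp only [Nat.add_sub_cancel]
  norm_num
  ring

lemma abs_P_le {κ : ℕ} {c : ℕ → ℝ} {D : ℝ} (hD : ∀ i ≤ κ, |c i| ≤ D) {m : ℝ}
    (hm : 1 ≤ m) {y : ℝ} (hy : |y| ≤ m) : |P κ c y| ≤ κ * D * m ^ κ := by
  have hD0 : 0 ≤ D := (abs_nonneg _).trans (hD 0 (Nat.zero_le _))
  calc |P κ c y| ≤ ∑ j ∈ Finset.range ((κ + 1) / 2), |c (κ - 2 * j) * y ^ (κ - 2 * j)| :=
        Finset.abs_sum_le_sum_abs _ _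
    _ ≤ ∑ j ∈ Finset.range ((κ + 1) / 2), D * m ^ κ := by
        refine Finset.sum_le_sum fun j _ => ?_
        rw [abs_mul, abs_pow]
        gcongr
        · exact hD _ (Nat.sub_le _ _)
        · calc |y| ^ (κ - 2 * j) ≤ m ^ (κ - 2 * j) := by gcongr
            _ ≤ m ^ κ := pow_le_pow_right₀ hm (Nat.sub_le _ _)
    _ = ((κ + 1) / 2 : ℕ) * (D * m ^ κ) := by simp
    _ ≤ κ * (D * m ^ κ) := by
        gcongr
        rcases Nat.eq_zero_or_pos κ with h | h <;> omega
    _ = _ := by ring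

lemma P_sub_ge {κ : ℕ} (hκ : 2 ≤ κ) {c : ℕ → ℝ} (hc : c κ = 1) {D : ℝ}
    (hD : ∀ i ≤ κ, |c i| ≤ D) {x y : ℝ} (hx : 0 ≤ x) (hxy : x ≤ y)
    (hy : 1 + 2 * κ ^ 2 * D ≤ y) :
    (y - x) * y ^ (κ - 1) / 2 ≤ P κ c y - P κ c x := by
  have hD0 : 0 ≤ D := (abs_nonneg _).trans (hD 0 (Nat.zero_le _))
  have hy1 : 1 ≤ y := le_trans (by nlinarith [sq_nonneg (κ : ℝ)]) hy
  have hy0 : 0 ≤ y := by linarith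
  obtain ⟨r, hr⟩ : ∃ r, (κ + 1) / 2 = r + 1 := ⟨(κ + 1) / 2 - 1, by omega⟩
  have hrκ : r ≤ κ := by omega
  have hlead : (y - x) * y ^ (κ - 1) ≤ y ^ κ - x ^ κ := by
    have : x ^ κ ≤ x * y ^ (κ - 1) := by
      calc x ^ κ = x * x ^ (κ - 1) := by rw [← pow_succ']; congr 1; omega
        _ ≤ _ := by gcongr
    have h2 : y ^ κ = y * y ^ (κ - 1) := by rw [← pow_succ']; congr 1; omega
    rw [h2]; linarith
  have hrest : |∑ j ∈ Finset.range r, (c (κ - 2 * (j + 1)) * y ^ (κ - 2 * (j + 1)) -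
      c (κ - 2 * (j + 1)) * x ^ (κ - 2 * (j + 1)))| ≤ κ ^ 2 * D * ((y - x) * y ^ (κ - 2)) := by
    calc _ ≤ ∑ j ∈ Finset.range r, |c (κ - 2 * (j + 1)) * y ^ (κ - 2 * (j + 1)) -
          c (κ - 2 * (j + 1)) * x ^ (κ - 2 * (j + 1))| := Finset.abs_sum_le_sum_abs _ _
      _ ≤ ∑ j ∈ Finset.range r, D * ((y - x) * κ * y ^ (κ - 2)) := by
        refine Finset.sum_le_sum fun j _ => ?_
        rw [← mul_sub, abs_mul]
        refine mul_le_mul (hD _ (Nat.sub_le _ _)) ?_ (abs_nonneg _) hD0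
        refine (abs_pow_sub_pow_le y x _).trans ?_
        rw [abs_of_nonneg (sub_nonneg.2 hxy), abs_of_nonneg hy0, abs_of_nonneg hx,
          max_eq_left hxy]
        have : 0 ≤ y - x := sub_nonneg.2 hxy
        have h1 : ((κ - 2 * (j + 1) : ℕ) : ℝ) ≤ κ := by exact_mod_cast Nat.sub_le _ _
        have h2 : y ^ (κ - 2 * (j + 1) - 1) ≤ y ^ (κ - 2) := pow_le_pow_right₀ hy1 (by omega)
        gcongr
      _ = r * (D * ((y - x) * κ * y ^ (κ - 2))) := by simp
      _ ≤ κ * (D * ((y - x) * κ * y ^ (κ - 2))) := by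
        have : 0 ≤ y - x := sub_nonneg.2 hxy
        gcongr
      _ = _ := by ring
  have hP : P κ c y - P κ c x = (y ^ κ - x ^ κ) +
      ∑ j ∈ Finset.range r, (c (κ - 2 * (j + 1)) * y ^ (κ - 2 * (j + 1)) -
      c (κ - 2 * (j + 1)) * x ^ (κ - 2 * (j + 1))) := by
    unfold P
    rw [← Finset.sum_sub_distrib, hr, Finset.sum_range_succ']
    simp [hc]; ring
  have hpow : y ^ (κ - 1) = y * y ^ (κ - 2) := by rw [← pow_succ']; congr 1; omega
  have h2 : κ ^ 2 * D * ((y - x) * y ^ (κ - 2)) ≤ (y - x) * y ^ (κ - 1) / 2 := by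
    rw [hpow]
    have h3 : 0 ≤ (y - x) * y ^ (κ - 2) := mul_nonneg (sub_nonneg.2 hxy) (by positivity)
    nlinarith
  have := (abs_le.1 hrest).1
  rw [hP]; linarith

lemma volume_P_half_le {κ : ℕ} (hκ : 2 ≤ κ) {D γ : ℝ} (hD1 : 0 ≤ D) (hγ : 0 ≤ γ)
    (hγκ : κ * γ ≤ κ - 1) : ∃ K : ℝ, 0 ≤ K ∧ ∀ c : ℕ → ℝ, c κ = 1 → (∀ i ≤ κ, |c i| ≤ D) →
      ∀ s : ℝ, |s| = 1 → ∀ a : ℝ,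
        volume {y : ℝ | 0 ≤ y ∧ s * P κ c y ∈ Set.Icc a (a + 1)} ≤
          ENNReal.ofReal (K * ((1 + |a|)⁻¹) ^ γ) := by
  have hκ0 : (2 : ℝ) ≤ κ := by exact_mod_cast hκ
  have hγ1 : γ ≤ 1 := by
    by_contra h
    push Not at h
    nlinarith
  set Y : ℝ := 1 + 2 * κ ^ 2 * D with hY
  have hY1 : 1 ≤ Y := by nlinarith [sq_nonneg (κ : ℝ)]
  set E : ℝ := κ * D + 2 with hE
  have hE1 : 1 ≤ E := by nlinarith
  refine ⟨2 * E + Y * (E * Y ^ κ), by positivity, fun c hc hD s hs a => ?_⟩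
  set b := ((1 + |a|)⁻¹) ^ γ with hb
  have hb0 : 0 ≤ b := by positivity
  have hval : ∀ y m : ℝ, 1 ≤ m → |y| ≤ m → s * P κ c y ∈ Set.Icc a (a + 1) →
      1 + |a| ≤ E * m ^ κ := by
    intro y m hm hy h
    have h1 := abs_P_le hD hm hy
    have h2 : |s * P κ c y| = |P κ c y| := by rw [abs_mul, hs, one_mul]
    have h3 : |a| ≤ |s * P κ c y| + 1 := by
      rw [abs_le]
      have := neg_abs_le (s * P κ c y)
      have := le_abs_self (s * P κ c y)
      constructor <;> linarith [h.1, h.2]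
    have h4 : 1 ≤ m ^ κ := one_le_pow₀ hm
    rw [hE]; nlinarith
  have hfar : volume ({y : ℝ | 0 ≤ y ∧ s * P κ c y ∈ Set.Icc a (a + 1)} ∩ {y | Y ≤ y}) ≤
      ENNReal.ofReal (2 * E * b) := by
    refine (Real.volume_le_diam _).trans (Metric.ediam_le ?_)
    have key : ∀ x y : ℝ, 0 ≤ x → x ≤ y → Y ≤ y → s * P κ c x ∈ Set.Icc a (a + 1) →
        s * P κ c y ∈ Set.Icc a (a + 1) → y - x ≤ 2 * E * b := by
      intro x y hx hxy hy hPx hPy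
      have hy0 : 0 < y := by linarith
      have h1 := P_sub_ge hκ hc hD hx hxy hy
      have h2 : P κ c y - P κ c x ≤ 1 := by
        calc _ ≤ |P κ c y - P κ c x| := le_abs_self _
          _ = |s * P κ c y - s * P κ c x| := by rw [← mul_sub, abs_mul, hs, one_mul]
          _ ≤ 1 := by
            rw [abs_le]; constructor <;> linarith [hPx.1, hPx.2, hPy.1, hPy.2]
      have h3 := hval y y (hY1.trans hy) (abs_of_pos hy0).le hPy
      have h4 : (1 + |a|) ^ γ ≤ E * y ^ (κ - 1) := by
        calc (1 + |a|) ^ γ ≤ (E * y ^ κ) ^ γ := by gcongr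
          _ = E ^ γ * (y ^ κ) ^ γ := Real.mul_rpow (by positivity) (by positivity)
          _ ≤ E * y ^ (κ - 1) := by
            gcongr
            · calc E ^ γ ≤ E ^ (1 : ℝ) := Real.rpow_le_rpow_of_exponent_le hE1 hγ1
                _ = E := Real.rpow_one E
            · rw [← Real.rpow_natCast, ← Real.rpow_mul hy0.le, ← Real.rpow_natCast y (κ - 1)]
              refine Real.rpow_le_rpow_of_exponent_le (hY1.trans hy) ?_
              rw [Nat.cast_sub (by omega)]; simpa using hγκ
      have hb1 : b * (1 + |a|) ^ γ = 1 := by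
        rw [hb, ← Real.mul_rpow (by positivity) (by positivity),
          inv_mul_cancel₀ (by positivity), Real.one_rpow]
      have h5 : 0 ≤ y - x := sub_nonneg.2 hxy
      calc y - x = (y - x) * (b * (1 + |a|) ^ γ) := by rw [hb1, mul_one]
        _ ≤ (y - x) * (b * (E * y ^ (κ - 1))) := by gcongr
        _ = 2 * E * b * ((y - x) * y ^ (κ - 1) / 2) := by ring
        _ ≤ 2 * E * b * 1 := by gcongr; linarith
        _ = _ := mul_one _
    intro x hx y hy
    rw [edist_dist, Real.dist_eq]
    refine ENNReal.ofReal_le_ofReal ?_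
    rcases le_total x y with h | h
    · rw [abs_sub_comm, abs_of_nonneg (sub_nonneg.2 h)]
      exact key x y hx.1.1 h hy.2 hx.1.2 hy.1.2
    · rw [abs_of_nonneg (sub_nonneg.2 h)]
      exact key y x hy.1.1 h hx.2 hy.1.2 hx.1.2
  have hnear : volume ({y : ℝ | 0 ≤ y ∧ s * P κ c y ∈ Set.Icc a (a + 1)} ∩ {y | Y ≤ y}ᶜ) ≤
      ENNReal.ofReal (Y * (E * Y ^ κ) * b) := by
    rcases Set.eq_empty_or_nonempty
      ({y : ℝ | 0 ≤ y ∧ s * P κ c y ∈ Set.Icc a (a + 1)} ∩ {y | Y ≤ y}ᶜ) with h | ⟨y, hy⟩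
    · rw [h]; simp
    · have hyY : y < Y := not_le.1 hy.2
      have h1 := hval y Y hY1 (by rw [abs_of_nonneg hy.1.1]; exact hyY.le) hy.1.2
      calc _ ≤ volume (Set.Icc 0 Y) := measure_mono fun z hz => ⟨hz.1.1, (not_le.1 hz.2).le⟩
        _ = ENNReal.ofReal Y := by simp
        _ ≤ _ := by
          refine ENNReal.ofReal_le_ofReal ?_
          have hb2 : (1 + |a|)⁻¹ ≤ b := by
            calc (1 + |a|)⁻¹ = ((1 + |a|)⁻¹) ^ (1 : ℝ) := (Real.rpow_one _).symm
              _ ≤ b := Real.rpow_le_rpow_of_exponent_ge (by positivity)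
                (inv_le_one_of_one_le₀ (by linarith [abs_nonneg a])) hγ1
          have h2 : 1 ≤ E * Y ^ κ * b := by
            calc 1 = (1 + |a|) * (1 + |a|)⁻¹ := (mul_inv_cancel₀ (by positivity)).symm
              _ ≤ _ := by gcongr
          nlinarith
  calc _ ≤ _ := measure_le_inter_add_sdiff _ _ {y | Y ≤ y}
    _ ≤ ENNReal.ofReal (2 * E * b) + ENNReal.ofReal (Y * (E * Y ^ κ) * b) :=
      add_le_add hfar hnear
    _ = _ := by
      rw [← ENNReal.ofReal_add (by positivity) (by positivity)]; ring_nf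

lemma volume_P_le {κ : ℕ} (hκ : 2 ≤ κ) {D γ : ℝ} (hD1 : 0 ≤ D) (hγ : 0 ≤ γ)
    (hγκ : κ * γ ≤ κ - 1) : ∃ K : ℝ, 0 ≤ K ∧ ∀ c : ℕ → ℝ, c κ = 1 → (∀ i ≤ κ, |c i| ≤ D) →
      ∀ a : ℝ, volume {y : ℝ | P κ c y ∈ Set.Icc a (a + 1)} ≤
          ENNReal.ofReal (K * ((1 + |a|)⁻¹) ^ γ) := by
  obtain ⟨K, hK, h⟩ := volume_P_half_le hκ hD1 hγ hγκ
  refine ⟨2 * K, by positivity, fun c hc hD a => ?_⟩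
  have hsub : {y : ℝ | P κ c y ∈ Set.Icc a (a + 1)} ⊆
      {y : ℝ | 0 ≤ y ∧ 1 * P κ c y ∈ Set.Icc a (a + 1)} ∪
        Neg.neg ⁻¹' {y : ℝ | 0 ≤ y ∧ (-1) ^ κ * P κ c y ∈ Set.Icc a (a + 1)} := by
    intro y hy
    rcases le_total 0 y with h0 | h0
    · left; exact ⟨h0, by simpa using hy⟩
    · right
      refine ⟨by simpa using h0, ?_⟩
      rw [← P_neg, neg_neg]; exact hy
  calc _ ≤ _ := measure_mono hsub
    _ ≤ _ := measure_union_le _ _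
    _ ≤ ENNReal.ofReal (K * ((1 + |a|)⁻¹) ^ γ) + ENNReal.ofReal (K * ((1 + |a|)⁻¹) ^ γ) := by
      refine add_le_add (h c hc hD 1 (by simp) a) ?_
      rw [Measure.measure_preimage_neg]
      exact h c hc hD ((-1) ^ κ) (by simp) a
    _ = _ := by
      rw [← ENNReal.ofReal_add (by positivity) (by positivity)]; ring_nf

/-- Sublevel estimate for the scaled dispersion relation. -/
lemma volume_scaled_P_le {κ : ℕ} (hκ : 2 ≤ κ) {d : ℕ → ℝ} (hd : d κ = 1) {γ : ℝ} (hγ : 0 ≤ γ)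
    (hγκ : κ * γ ≤ κ - 1) : ∃ K : ℝ, 0 ≤ K ∧ ∀ ε α : ℝ, 0 < ε → ε ≤ 1 → 0 ≤ α →
      ∀ a : ℝ, volume {ξ : ℝ | ε ^ α * P κ d ξ ∈ Set.Icc a (a + 1)} ≤
          ENNReal.ofReal (K * ε ^ (-(α / κ)) * ((1 + |a|)⁻¹) ^ γ) := by
  set D : ℝ := ∑ i ∈ Finset.range (κ + 1), |d i| with hDdef
  have hD0 : 0 ≤ D := Finset.sum_nonneg fun _ _ => abs_nonneg _
  obtain ⟨K, hK, h⟩ := volume_P_le hκ hD0 hγ hγκ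
  refine ⟨K, hK, fun ε α hε hε1 hα a => ?_⟩
  have hκ0 : (0 : ℝ) < κ := by exact_mod_cast (by omega : 0 < κ)
  set l := ε ^ (α / κ) with hl
  have hl0 : 0 < l := Real.rpow_pos_of_pos hε _
  have hl1 : l ≤ 1 := Real.rpow_le_one hε.le hε1 (by positivity)
  have hlκ : l ^ κ = ε ^ α := by
    rw [hl, ← Real.rpow_natCast, ← Real.rpow_mul hε.le, div_mul_cancel₀ _ hκ0.ne']
  have hlinv : ε ^ (-(α / κ)) = l⁻¹ := by rw [hl, Real.rpow_neg hε.le]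
  have hsc : ∀ ξ, ε ^ α * P κ d ξ = P κ (fun i => d i * l ^ (κ - i)) (l * ξ) := by
    intro ξ
    unfold P
    rw [Finset.mul_sum]
    refine Finset.sum_congr rfl fun j hj => ?_
    have : l ^ κ = l ^ (κ - (κ - 2 * j)) * l ^ (κ - 2 * j) := by
      rw [← pow_add]; congr 1; omega
    rw [← hlκ, mul_pow, this]
    ring
  have h1 := h (fun i => d i * l ^ (κ - i)) (by simp [hd]) (fun i hi => by
    rw [abs_mul, abs_of_pos (pow_pos hl0 _)]
    calc |d i| * l ^ (κ - i) ≤ |d i| * 1 := by gcongr; exact pow_le_one₀ hl0.le hl1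
      _ = |d i| := mul_one _
      _ ≤ D := Finset.single_le_sum (f := fun i => |d i|) (fun _ _ => abs_nonneg _)
        (Finset.mem_range.2 (by omega))) a
  have hset : {ξ : ℝ | ε ^ α * P κ d ξ ∈ Set.Icc a (a + 1)} = (l * ·) ⁻¹'
      {y : ℝ | P κ (fun i => d i * l ^ (κ - i)) y ∈ Set.Icc a (a + 1)} := by
    ext ξ; rw [Set.mem_preimage, Set.mem_ofPred_eq, Set.mem_ofPred_eq, hsc]
  rw [hset, Real.volume_preimage_mul_left hl0.ne', hlinv, abs_of_pos (inv_pos.2 hl0)]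
  calc _ ≤ ENNReal.ofReal l⁻¹ * ENNReal.ofReal (K * ((1 + |a|)⁻¹) ^ γ) := by gcongr
    _ = _ := by rw [← ENNReal.ofReal_mul (by positivity)]; ring_nf

/-- Integrals of slowly varying functions of `θ` are controlled by the level sets of `θ`. -/
lemma lintegral_comp_le_of_slowly_varying {θ : ℝ → ℝ} (hθ : Measurable θ) {F β : ℝ → ℝ≥0∞}
    (hF : Measurable F) (hβm : Measurable β) {A : ℝ≥0∞} (hA : ∀ x y, |x - y| ≤ 1 → F x ≤ A * F y)
    (hβ : ∀ a, volume {ξ | θ ξ ∈ Set.Icc a (a + 1)} ≤ β a) :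
    ∫⁻ ξ, F (θ ξ) ≤ A * ∫⁻ q, F q * β q := by
  set U : Set (ℝ × ℝ) := {z | θ z.1 ∈ Set.Icc z.2 (z.2 + 1)} with hU
  have hUm : MeasurableSet U :=
    (measurableSet_le measurable_snd (hθ.comp measurable_fst)).inter
      (measurableSet_le (hθ.comp measurable_fst) (measurable_snd.add_const 1))
  have hm : Measurable fun z : ℝ × ℝ => A * (F z.2 * U.indicator 1 z) :=
    ((hF.comp measurable_snd).mul (measurable_one.indicator hUm)).const_mul A
  calc ∫⁻ ξ, F (θ ξ) ≤ ∫⁻ ξ, ∫⁻ q, A * (F q * U.indicator 1 (ξ, q)) := by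
        refine lintegral_mono fun ξ => ?_
        calc F (θ ξ) = ∫⁻ _ in Set.Icc (θ ξ - 1) (θ ξ), F (θ ξ) := by simp
          _ = ∫⁻ q, (Set.Icc (θ ξ - 1) (θ ξ)).indicator (fun _ => F (θ ξ)) q :=
            (lintegral_indicator measurableSet_Icc _).symm
          _ ≤ _ := by
            refine lintegral_mono fun q => ?_
            by_cases hq : q ∈ Set.Icc (θ ξ - 1) (θ ξ)
            · have hmem : (ξ, q) ∈ U := ⟨hq.2, by have := hq.1; dsimp only; linarith⟩
              rw [Set.indicator_of_mem hq, Set.indicator_of_mem hmem, Pi.one_apply, mul_one]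
              refine hA _ _ ?_
              rw [abs_le]; constructor <;> linarith [hq.1, hq.2]
            · rw [Set.indicator_of_notMem hq]; exact zero_le
    _ = ∫⁻ q, ∫⁻ ξ, A * (F q * U.indicator 1 (ξ, q)) :=
        lintegral_lintegral_swap hm.aemeasurable
    _ = ∫⁻ q, A * (F q * volume {ξ | θ ξ ∈ Set.Icc q (q + 1)}) := by
        refine lintegral_congr fun q => ?_
        have h1 : Measurable fun ξ => U.indicator (1 : ℝ × ℝ → ℝ≥0∞) (ξ, q) :=
          (measurable_one.indicator hUm).comp (measurable_id.prodMk measurable_const)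
        rw [lintegral_const_mul _ (h1.const_mul _), lintegral_const_mul _ h1]
        have h2 : (fun ξ => U.indicator (1 : ℝ × ℝ → ℝ≥0∞) (ξ, q)) =
            {ξ | θ ξ ∈ Set.Icc q (q + 1)}.indicator 1 := by
          ext ξ; rfl
        rw [h2]
        exact congrArg (fun x => A * (F q * x)) (lintegral_indicator_one (hθ measurableSet_Icc))
    _ ≤ ∫⁻ q, A * (F q * β q) := by
        refine lintegral_mono fun q => ?_
        dsimp only
        gcongr
        exact hβ q
    _ = _ := lintegral_const_mul _ (hF.mul hβm)

lemma lintegral_lintegral_comp_le_of_slowly_varying {θ : ℝ → ℝ} (hθ : Measurable θ)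
    {F : ℝ → ℝ → ℝ≥0∞} {β : ℝ → ℝ≥0∞} (hF : Measurable (Function.uncurry F)) (hβm : Measurable β)
    {A : ℝ≥0∞} (hA₁ : ∀ x y q, |x - y| ≤ 1 → F x q ≤ A * F y q)
    (hA₂ : ∀ p x y, |x - y| ≤ 1 → F p x ≤ A * F p y)
    (hβ : ∀ a, volume {ξ | θ ξ ∈ Set.Icc a (a + 1)} ≤ β a) :
    ∫⁻ ξ, ∫⁻ η, F (θ ξ) (θ η) ≤ A * (A * ∫⁻ p, (∫⁻ q, F p q * β q) * β p) := by
  have hFβ : Measurable fun z : ℝ × ℝ => F z.1 z.2 * β z.2 := hF.mul (hβm.comp measurable_snd)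
  have hG : Measurable fun p => ∫⁻ q, F p q * β q := hFβ.lintegral_prod_right'
  calc _ ≤ ∫⁻ ξ, A * ∫⁻ q, F (θ ξ) q * β q := lintegral_mono fun ξ =>
        lintegral_comp_le_of_slowly_varying hθ (hF.comp (measurable_const.prodMk measurable_id))
          hβm (hA₂ _) hβ
    _ = A * ∫⁻ ξ, ∫⁻ q, F (θ ξ) q * β q := lintegral_const_mul _ (hG.comp hθ)
    _ ≤ _ := by
      gcongr
      refine lintegral_comp_le_of_slowly_varying hθ hG hβm (fun x y hxy => ?_) hβ
      have hy : Measurable fun q => F y q * β q :=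
        hFβ.comp (measurable_const.prodMk measurable_id)
      rw [← lintegral_const_mul _ hy]
      refine lintegral_mono fun q => ?_
      dsimp only
      rw [← mul_assoc]
      gcongr
      exact hA₁ _ _ _ hxy

lemma integrable_inv_one_add_abs_rpow {s : ℝ} (hs : 1 < s) :
    Integrable fun x : ℝ => ((1 + |x|)⁻¹) ^ s := by
  have h := integrable_one_add_norm (E := ℝ) (μ := volume) (r := s) (by simpa using hs)
  refine h.congr (Filter.Eventually.of_forall fun x => ?_)
  simp only [Real.norm_eq_abs]
  rw [Real.rpow_neg (by positivity), Real.inv_rpow (by positivity)]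

lemma lintegral_inv_one_add_abs_rpow {s : ℝ} (hs : 1 < s) :
    ∫⁻ x : ℝ, ENNReal.ofReal (((1 + |x|)⁻¹) ^ s) = ENNReal.ofReal (2 / (s - 1)) := by
  rw [← ofReal_integral_eq_lintegral_ofReal (integrable_inv_one_add_abs_rpow hs)
    (Filter.Eventually.of_forall fun x => by positivity)]
  congr 1
  rw [integral_comp_abs (f := fun x => ((1 + x)⁻¹) ^ s)]
  have h1 : ∫ x in Set.Ioi (0 : ℝ), ((1 + x)⁻¹) ^ s = ∫ x in Set.Ioi (1 : ℝ), x ^ (-s) := by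
    have := (measurePreserving_add_right volume (1 : ℝ)).setIntegral_preimage_emb
      (measurableEmbedding_addRight 1) (fun x : ℝ => x ^ (-s)) (Set.Ioi 1)
    rw [← this]
    have hpre : (fun x : ℝ => x + 1) ⁻¹' Set.Ioi 1 = Set.Ioi 0 := by
      ext x; simp
    rw [hpre]
    refine setIntegral_congr_fun measurableSet_Ioi fun x hx => ?_
    have hx : 0 < x := hx
    rw [Real.rpow_neg (by positivity), Real.inv_rpow (by positivity), add_comm]
  rw [h1, integral_Ioi_rpow_of_lt (by linarith) one_pos, Real.one_rpow]
  have : s - 1 ≠ 0 := by linarith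
  have : -s + 1 ≠ 0 := by linarith
  field_simp
  ring

lemma tsum_grid_le : ∃ C : ℝ, 0 ≤ C ∧ ∀ y : ℝ,
    ∑' l : ℤ, ENNReal.ofReal (((1 + |y + 2 * π * l|)⁻¹) ^ (4 / 3 : ℝ)) ≤ ENNReal.ofReal C := by
  set g : ℤ → ℝ := fun m => (2 * (1 + |(m : ℝ)|)⁻¹) ^ (4 / 3 : ℝ) with hg
  have hg0 : ∀ m, 0 ≤ g m := fun m => by positivity
  have hsum : Summable g := by
    have h1 := (Real.summable_abs_int_rpow (b := 4 / 3) (by norm_num)).mul_left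
      ((2 : ℝ) ^ (4 / 3 : ℝ))
    have h2 : Summable fun m : ℤ => if m = 0 then (2 : ℝ) ^ (4 / 3 : ℝ) else 0 :=
      summable_of_ne_finset_zero (s := {0}) fun m hm => by
        rw [if_neg (by simpa using hm)]
    refine Summable.of_nonneg_of_le hg0 (fun m => ?_) (h1.add h2)
    rw [hg]
    dsimp only
    rw [Real.mul_rpow (by norm_num) (by positivity)]
    rcases eq_or_ne m 0 with rfl | hm
    · simp
    · rw [if_neg hm, add_zero]
      have hm' : 0 < |(m : ℝ)| := by positivity
      rw [Real.rpow_neg (abs_nonneg _), ← Real.inv_rpow (abs_nonneg _)]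
      gcongr
      linarith
  refine ⟨∑' m, g m, tsum_nonneg hg0, fun y => ?_⟩
  rw [ENNReal.ofReal_tsum_of_nonneg hg0 hsum,
    ← (Equiv.addRight ⌊y / (2 * π)⌋).tsum_eq (fun m => ENNReal.ofReal (g m))]
  refine ENNReal.tsum_le_tsum fun l => ENNReal.ofReal_le_ofReal ?_
  rw [hg]
  dsimp only [Equiv.coe_addRight]
  refine Real.rpow_le_rpow (by positivity) ?_ (by norm_num)
  set n := ⌊y / (2 * π)⌋
  have hpi := Real.pi_gt_three
  have hy : y + 2 * π * l = 2 * π * ((l + n : ℤ) + Int.fract (y / (2 * π))) := by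
    have : y = 2 * π * (y / (2 * π)) := by field_simp
    conv_lhs => rw [this, ← Int.floor_add_fract (y / (2 * π))]
    push_cast; ring
  have hf0 := Int.fract_nonneg (y / (2 * π))
  have hf1 := (Int.fract_lt_one (y / (2 * π))).le
  have h3 : |((l + n : ℤ) : ℝ)| ≤ |((l + n : ℤ) : ℝ) + Int.fract (y / (2 * π))| + 1 := by
    rw [abs_le]
    have h4 := neg_abs_le (((l + n : ℤ) : ℝ) + Int.fract (y / (2 * π)))
    have h5 := le_abs_self (((l + n : ℤ) : ℝ) + Int.fract (y / (2 * π)))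
    constructor <;> linarith
  rw [hy, abs_mul, abs_of_pos (by positivity : 0 < 2 * π), ← div_eq_mul_inv,
    le_div_iff₀ (by positivity), inv_mul_le_iff₀ (by positivity)]
  nlinarith [abs_nonneg (((l + n : ℤ) : ℝ) + Int.fract (y / (2 * π)))]

lemma measurable_gridDecay (τ : ℝ) : Measurable (gridDecay τ) := by
  unfold gridDecay
  have : Continuous fun x : ℝ => ‖(x : AddCircle (2 * π / τ))‖ :=
    continuous_norm.comp (AddCircle.continuous_mk' _)
  exact (this.measurable.const_add 1).inv

lemma gridDecay_neg (τ x : ℝ) : gridDecay τ (-x) = gridDecay τ x := by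
  unfold gridDecay
  rw [AddCircle.coe_neg, norm_neg]

lemma lintegral_gridDecay_rpow_mul_le : ∃ C : ℝ, 0 ≤ C ∧ ∀ τ : ℝ, 0 < τ → ∀ s : ℝ, 1 < s →
    ∀ c : ℝ, ∫⁻ q, ENNReal.ofReal (gridDecay τ (q - c) ^ s *
      ((1 + τ * |q|)⁻¹) ^ (4 / 3 : ℝ)) ≤ ENNReal.ofReal (C / (s - 1)) := by
  obtain ⟨C, hC, hgrid⟩ := tsum_grid_le
  refine ⟨C * 2, by positivity, fun τ hτ s hs c => ?_⟩
  set p := 2 * π / τ with hp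
  have hmeas : ∀ l : ℤ, Measurable fun q : ℝ => ENNReal.ofReal (((1 + |q|)⁻¹) ^ s) *
      ENNReal.ofReal (((1 + |τ * (q + c) + 2 * π * l|)⁻¹) ^ (4 / 3 : ℝ)) := fun l => by
    fun_prop
  calc _ ≤ ∫⁻ q, ∑' l : ℤ, ENNReal.ofReal (((1 + |q - (c + l * p)|)⁻¹) ^ s) *
        ENNReal.ofReal (((1 + |τ * ((q - (c + l * p)) + c) + 2 * π * l|)⁻¹) ^ (4 / 3 : ℝ)) := by
        refine lintegral_mono fun q => ?_
        refine le_trans ?_ (ENNReal.le_tsum (round (p⁻¹ * (q - c))))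
        rw [← ENNReal.ofReal_mul (by positivity)]
        have e1 : gridDecay τ (q - c) = (1 + |q - (c + round (p⁻¹ * (q - c)) * p)|)⁻¹ := by
          unfold gridDecay
          rw [AddCircle.norm_eq, ← hp]; ring_nf
        have e2 : ∀ l : ℤ, τ * ((q - (c + l * p)) + c) + 2 * π * l = τ * q := fun l => by
          rw [hp]; field_simp; ring
        rw [e1, e2, abs_mul, abs_of_pos hτ]
    _ = ∑' l : ℤ, ∫⁻ q, ENNReal.ofReal (((1 + |q - (c + l * p)|)⁻¹) ^ s) *
        ENNReal.ofReal (((1 + |τ * ((q - (c + l * p)) + c) + 2 * π * l|)⁻¹) ^ (4 / 3 : ℝ)) :=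
        lintegral_tsum fun l => ((hmeas l).comp (measurable_id.sub_const _)).aemeasurable
    _ = ∑' l : ℤ, ∫⁻ q, ENNReal.ofReal (((1 + |q|)⁻¹) ^ s) *
        ENNReal.ofReal (((1 + |τ * (q + c) + 2 * π * l|)⁻¹) ^ (4 / 3 : ℝ)) := by
        congr 1
        ext l
        exact lintegral_sub_right_eq_self (fun q : ℝ => ENNReal.ofReal (((1 + |q|)⁻¹) ^ s) *
        ENNReal.ofReal (((1 + |τ * (q + c) + 2 * π * l|)⁻¹) ^ (4 / 3 : ℝ))) (c + l * p)
    _ = ∫⁻ q, ∑' l : ℤ, ENNReal.ofReal (((1 + |q|)⁻¹) ^ s) *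
        ENNReal.ofReal (((1 + |τ * (q + c) + 2 * π * l|)⁻¹) ^ (4 / 3 : ℝ)) :=
        (lintegral_tsum fun l => (hmeas l).aemeasurable).symm
    _ ≤ ∫⁻ q, ENNReal.ofReal (((1 + |q|)⁻¹) ^ s) * ENNReal.ofReal C := by
        refine lintegral_mono fun q => ?_
        dsimp only
        rw [ENNReal.tsum_mul_left]
        gcongr
        exact hgrid _
    _ = ENNReal.ofReal (2 / (s - 1)) * ENNReal.ofReal C := by
        rw [lintegral_mul_const' _ _ ENNReal.ofReal_ne_top, lintegral_inv_one_add_abs_rpow hs]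
    _ = _ := by
        have : 0 < s - 1 := by linarith
        rw [← ENNReal.ofReal_mul (by positivity)]; ring_nf

/-- Majorant of the oscillatory error kernel. -/
noncomputable def kernelBound (τ p q : ℝ) : ℝ :=
  (1 + τ * |p|)⁻¹ * ((1 + τ * |q|)⁻¹ * gridDecay τ (p - q) + (1 + |p - q|)⁻¹)

lemma kernelBound_nonneg {τ : ℝ} (hτ : 0 < τ) (p q : ℝ) : 0 ≤ kernelBound τ p q := by
  have := gridDecay_pos τ (p - q)
  unfold kernelBound; positivity

lemma measurable_kernelBound (τ : ℝ) : Measurable (Function.uncurry (kernelBound τ)) := by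
  have h : Measurable fun z : ℝ × ℝ => gridDecay τ (z.1 - z.2) :=
    (measurable_gridDecay τ).comp (measurable_fst.sub measurable_snd)
  change Measurable fun z : ℝ × ℝ => (1 + τ * |z.1|)⁻¹ *
    ((1 + τ * |z.2|)⁻¹ * gridDecay τ (z.1 - z.2) + (1 + |z.1 - z.2|)⁻¹)
  fun_prop

lemma inv_one_add_le_two_mul {x y : ℝ} (hx : 0 ≤ x) (hy : 0 ≤ y) (h : y ≤ x + 1) :
    (1 + x)⁻¹ ≤ 2 * (1 + y)⁻¹ := by
  rw [← div_eq_mul_inv, le_div_iff₀ (by positivity), inv_mul_le_iff₀ (by positivity)]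
  linarith

lemma abs_le_abs_add_one {x y : ℝ} (h : |x - y| ≤ 1) : |y| ≤ |x| + 1 := by
  have := abs_sub_abs_le_abs_sub y x
  rw [abs_sub_comm] at this; linarith

lemma inv_one_add_mul_abs_slowly_varying {τ : ℝ} (hτ : 0 < τ) (hτ1 : τ ≤ 1) {x y : ℝ}
    (h : |x - y| ≤ 1) : (1 + τ * |x|)⁻¹ ≤ 2 * (1 + τ * |y|)⁻¹ :=
  inv_one_add_le_two_mul (by positivity) (by positivity)
    (by nlinarith [abs_le_abs_add_one h])

lemma gridDecay_slowly_varying (τ : ℝ) {x y : ℝ} (h : |x - y| ≤ 1) :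
    gridDecay τ x ≤ 2 * gridDecay τ y := by
  refine inv_one_add_le_two_mul (norm_nonneg _) (norm_nonneg _) ?_
  have h1 := norm_addCircle_le_abs (2 * π / τ) (y - x)
  rw [AddCircle.coe_sub, abs_sub_comm] at h1
  have h2 := norm_sub_norm_le (y : AddCircle (2 * π / τ)) x
  linarith

lemma kernelBound_slowly_varying_left {τ : ℝ} (hτ : 0 < τ) (hτ1 : τ ≤ 1) {x y : ℝ} (q : ℝ)
    (h : |x - y| ≤ 1) : kernelBound τ x q ≤ 4 * kernelBound τ y q := by
  have h' : |(x - q) - (y - q)| ≤ 1 := by rwa [sub_sub_sub_cancel_right]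
  have e1 := inv_one_add_mul_abs_slowly_varying hτ hτ1 h
  have e2 := gridDecay_slowly_varying τ h'
  have e3 := inv_one_add_mul_abs_slowly_varying one_pos le_rfl h'
  rw [one_mul, one_mul] at e3
  have := gridDecay_pos τ (x - q)
  have := gridDecay_pos τ (y - q)
  unfold kernelBound
  calc _ ≤ 2 * (1 + τ * |y|)⁻¹ * ((1 + τ * |q|)⁻¹ * (2 * gridDecay τ (y - q)) +
        2 * (1 + |y - q|)⁻¹) := by gcongr
    _ = _ := by ring

lemma kernelBound_slowly_varying_right {τ : ℝ} (hτ : 0 < τ) (hτ1 : τ ≤ 1) (p : ℝ) {x y : ℝ}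
    (h : |x - y| ≤ 1) : kernelBound τ p x ≤ 4 * kernelBound τ p y := by
  have h' : |(p - x) - (p - y)| ≤ 1 := by rwa [sub_sub_sub_cancel_left, abs_sub_comm]
  have e1 := inv_one_add_mul_abs_slowly_varying hτ hτ1 h
  have e2 := gridDecay_slowly_varying τ h'
  have e3 := inv_one_add_mul_abs_slowly_varying one_pos le_rfl h'
  rw [one_mul, one_mul] at e3
  have := gridDecay_pos τ (p - x)
  have := gridDecay_pos τ (p - y)
  unfold kernelBound
  calc _ ≤ (1 + τ * |p|)⁻¹ * (2 * (1 + τ * |y|)⁻¹ * (2 * gridDecay τ (p - y)) +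
        4 * (1 + |p - y|)⁻¹) := by gcongr; exact e3.trans (by gcongr; norm_num)
    _ = _ := by ring

lemma mul_le_rpow_add_pow {x y : ℝ} (hx : 0 ≤ x) (hy : 0 ≤ y) :
    x * y ≤ x ^ (4 / 3 : ℝ) + y ^ (4 : ℝ) := by
  have h := Real.geom_mean_le_arith_mean2_weighted (w₁ := 3 / 4) (w₂ := 1 / 4) (by norm_num)
    (by norm_num) (Real.rpow_nonneg hx (4 / 3)) (Real.rpow_nonneg hy 4) (by norm_num)
  rw [← Real.rpow_mul hx, ← Real.rpow_mul hy] at h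
  norm_num at h
  have h1 := Real.rpow_nonneg hx (4 / 3)
  have h2 := Real.rpow_nonneg hy 4
  norm_num at h2 ⊢
  linarith

lemma mul_mul_le_rpow {x y z : ℝ} (hx : 0 ≤ x) (hy : 0 ≤ y) (hz : 0 ≤ z) :
    x * y * z ≤ x ^ (8 / 5 : ℝ) * z ^ (4 / 3 : ℝ) + y ^ (8 / 5 : ℝ) * z ^ (4 / 3 : ℝ) +
      x ^ (8 / 5 : ℝ) * y ^ (8 / 5 : ℝ) := by
  have p1 : 0 ≤ x ^ (8 / 5 : ℝ) * z ^ (4 / 3 : ℝ) := by positivity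
  have p2 : 0 ≤ y ^ (8 / 5 : ℝ) * z ^ (4 / 3 : ℝ) := by positivity
  have p3 : 0 ≤ x ^ (8 / 5 : ℝ) * y ^ (8 / 5 : ℝ) := by positivity
  have h := Real.geom_mean_le_arith_mean3_weighted (w₁ := 3 / 8) (w₂ := 3 / 8) (w₃ := 1 / 4)
    (by norm_num) (by norm_num) (by norm_num) p1 p2 p3 (by norm_num)
  have e : ∀ t a b c : ℝ, 0 ≤ t → 0 < a → 0 < b → a * c + b = 1 → (t ^ c) ^ a * t ^ b = t := by
    intro t a b c ht ha hb habc
    rcases ht.eq_or_lt with rfl | ht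
    · rw [Real.zero_rpow hb.ne', mul_zero]
    · rw [← Real.rpow_mul ht.le, ← Real.rpow_add ht, mul_comm c, habc, Real.rpow_one]
  have key : (x ^ (8 / 5 : ℝ) * z ^ (4 / 3 : ℝ)) ^ (3 / 8 : ℝ) *
      (y ^ (8 / 5 : ℝ) * z ^ (4 / 3 : ℝ)) ^ (3 / 8 : ℝ) *
      (x ^ (8 / 5 : ℝ) * y ^ (8 / 5 : ℝ)) ^ (1 / 4 : ℝ) = x * y * z := by
    have ex := e x (3 / 8) (2 / 5) (8 / 5) hx (by norm_num) (by norm_num) (by norm_num)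
    have ey := e y (3 / 8) (2 / 5) (8 / 5) hy (by norm_num) (by norm_num) (by norm_num)
    have ez := e z (3 / 8) (1 / 2) (4 / 3) hz (by norm_num) (by norm_num) (by norm_num)
    have hx' : (x ^ (8 / 5 : ℝ)) ^ (1 / 4 : ℝ) = x ^ (2 / 5 : ℝ) := by
      rw [← Real.rpow_mul hx]; norm_num
    have hy' : (y ^ (8 / 5 : ℝ)) ^ (1 / 4 : ℝ) = y ^ (2 / 5 : ℝ) := by
      rw [← Real.rpow_mul hy]; norm_num
    have hz' : (z ^ (4 / 3 : ℝ)) ^ (3 / 8 : ℝ) = z ^ (1 / 2 : ℝ) := by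
      rw [← Real.rpow_mul hz]; norm_num
    rw [Real.mul_rpow (by positivity) (by positivity), Real.mul_rpow (by positivity) (by positivity),
      Real.mul_rpow (by positivity) (by positivity), hx', hy']
    nth_rewrite 2 [hz']
    calc _ = ((x ^ (8 / 5 : ℝ)) ^ (3 / 8 : ℝ) * x ^ (2 / 5 : ℝ)) *
          ((y ^ (8 / 5 : ℝ)) ^ (3 / 8 : ℝ) * y ^ (2 / 5 : ℝ)) *
          ((z ^ (4 / 3 : ℝ)) ^ (3 / 8 : ℝ) * z ^ (1 / 2 : ℝ)) := by ring
      _ = _ := by rw [ex, ey, ez]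
  rw [key] at h
  linarith

lemma lintegral_kernelBound_le : ∃ C : ℝ, 0 ≤ C ∧ ∀ τ : ℝ, 0 < τ → τ ≤ 1 → ∀ c : ℝ,
    ∫⁻ p, ENNReal.ofReal (kernelBound τ p c * ((1 + |p|)⁻¹) ^ (1 / 2 : ℝ)) ≤
      ENNReal.ofReal C := by
  obtain ⟨C, hC, h⟩ := lintegral_gridDecay_rpow_mul_le
  refine ⟨2 * (3 * C + 2), by positivity, fun τ hτ hτ1 c => ?_⟩
  have hm : Measurable fun p : ℝ => ENNReal.ofReal (gridDecay τ (p - c) ^ (4 / 3 : ℝ) *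
      ((1 + τ * |p|)⁻¹) ^ (4 / 3 : ℝ)) := by
    have : Measurable fun p : ℝ => gridDecay τ (p - c) :=
      (measurable_gridDecay τ).comp (measurable_id.sub_const c)
    fun_prop
  calc _ ≤ ∫⁻ p, ENNReal.ofReal 2 * (ENNReal.ofReal (gridDecay τ (p - c) ^ (4 / 3 : ℝ) *
        ((1 + τ * |p|)⁻¹) ^ (4 / 3 : ℝ)) + ENNReal.ofReal (((1 + |p|)⁻¹) ^ (2 : ℝ))) := by
        refine lintegral_mono fun p => ?_
        have hg := gridDecay_pos τ (p - c)
        rw [← ENNReal.ofReal_add (by positivity) (by positivity),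
          ← ENNReal.ofReal_mul (by norm_num)]
        refine ENNReal.ofReal_le_ofReal ?_
        have h1 := mul_le_rpow_add_pow
          (x := gridDecay τ (p - c) * (1 + τ * |p|)⁻¹) (y := ((1 + |p|)⁻¹) ^ (1 / 2 : ℝ))
          (by positivity) (by positivity)
        rw [Real.mul_rpow hg.le (by positivity), ← Real.rpow_mul (by positivity)] at h1
        have h2 : kernelBound τ p c ≤ 2 * (gridDecay τ (p - c) * (1 + τ * |p|)⁻¹) := by
          have e1 : (1 + τ * |c|)⁻¹ ≤ 1 := inv_le_one_of_one_le₀ (by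
            have : 0 ≤ τ * |c| := by positivity
            linarith)
          unfold kernelBound
          calc _ ≤ (1 + τ * |p|)⁻¹ * (1 * gridDecay τ (p - c) + gridDecay τ (p - c)) := by
                gcongr
                exact inv_one_add_abs_le_gridDecay τ _
            _ = _ := by ring
        calc _ ≤ 2 * (gridDecay τ (p - c) * (1 + τ * |p|)⁻¹) * ((1 + |p|)⁻¹) ^ (1 / 2 : ℝ) := by
              gcongr
          _ = 2 * (gridDecay τ (p - c) * (1 + τ * |p|)⁻¹ * ((1 + |p|)⁻¹) ^ (1 / 2 : ℝ)) := by ring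
          _ ≤ _ := by
              rw [show (1 / 2 * 4 : ℝ) = 2 by norm_num] at h1
              gcongr
    _ ≤ ENNReal.ofReal 2 * (ENNReal.ofReal (C / (4 / 3 - 1)) + ENNReal.ofReal (2 / (2 - 1))) := by
        rw [lintegral_const_mul' _ _ ENNReal.ofReal_ne_top, lintegral_add_left hm]
        gcongr
        · exact h τ hτ _ (by norm_num) c
        · exact (lintegral_inv_one_add_abs_rpow (by norm_num)).le
    _ = _ := by
        rw [← ENNReal.ofReal_add (by positivity) (by norm_num), ← ENNReal.ofReal_mul (by norm_num)]
        congr 1; ring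

/-- Symmetrised Schur-type bound for double integrals. -/
lemma lintegral_lintegral_symm_le {f : ℝ → ℝ≥0∞} {h h' : ℝ → ℝ → ℝ≥0∞} (hf : Measurable f)
    (hh : Measurable (Function.uncurry h)) (hh' : Measurable (Function.uncurry h'))
    {C : ℝ≥0∞} (hC : ∀ p, ∫⁻ q, h p q ≤ C) (hC' : ∀ q, ∫⁻ p, h' p q ≤ C) :
    ∫⁻ p, ∫⁻ q, (f p * h p q + f q * h' p q) ≤ 2 * ((∫⁻ p, f p) * C) := by
  have m1 : Measurable fun z : ℝ × ℝ => f z.1 * h z.1 z.2 := (hf.comp measurable_fst).mul hh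
  have m2 : Measurable fun z : ℝ × ℝ => f z.2 * h' z.1 z.2 := (hf.comp measurable_snd).mul hh'
  have s1 : ∀ p, Measurable fun q => f p * h p q := fun p =>
    m1.comp (measurable_const.prodMk measurable_id)
  have b1 : ∫⁻ p, ∫⁻ q, f p * h p q ≤ (∫⁻ p, f p) * C := by
    rw [← lintegral_mul_const _ hf]
    refine lintegral_mono fun p => ?_
    dsimp only
    have : Measurable fun q => h p q := hh.comp (measurable_const.prodMk measurable_id)
    rw [lintegral_const_mul _ this]
    gcongr
    exact hC p
  have b2 : ∫⁻ p, ∫⁻ q, f q * h' p q ≤ (∫⁻ p, f p) * C := by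
    rw [lintegral_lintegral_swap m2.aemeasurable, ← lintegral_mul_const _ hf]
    refine lintegral_mono fun q => ?_
    dsimp only
    have : Measurable fun p => h' p q := hh'.comp (measurable_id.prodMk measurable_const)
    rw [lintegral_const_mul _ this]
    gcongr
    exact hC' q
  calc _ = ∫⁻ p, ((∫⁻ q, f p * h p q) + ∫⁻ q, f q * h' p q) :=
        lintegral_congr fun p => lintegral_add_left (s1 p) _
    _ = (∫⁻ p, ∫⁻ q, f p * h p q) + ∫⁻ p, ∫⁻ q, f q * h' p q :=
        lintegral_add_left m1.lintegral_prod_right' _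
    _ ≤ _ := by rw [two_mul]; exact add_le_add b1 b2

lemma lintegral_inv_one_add_abs_sub_rpow {s : ℝ} (hs : 1 < s) (c : ℝ) :
    ∫⁻ q : ℝ, ENNReal.ofReal (((1 + |c - q|)⁻¹) ^ s) = ENNReal.ofReal (2 / (s - 1)) := by
  rw [← lintegral_inv_one_add_abs_rpow hs]
  exact lintegral_sub_left_eq_self (fun q : ℝ => ENNReal.ofReal (((1 + |q|)⁻¹) ^ s)) c

lemma measurable_gridDecay_sub (τ : ℝ) : Measurable fun z : ℝ × ℝ => gridDecay τ (z.1 - z.2) :=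
  (measurable_gridDecay τ).comp (measurable_fst.sub measurable_snd)

/-- Decaying majorant used in the double integral of the kernel. -/
noncomputable def schurBound (τ s p q : ℝ) : ℝ :=
  gridDecay τ (p - q) ^ s * ((1 + τ * |q|)⁻¹) ^ (4 / 3 : ℝ) + ((1 + |p - q|)⁻¹) ^ s

lemma schurBound_nonneg {τ : ℝ} (hτ : 0 < τ) (s p q : ℝ) : 0 ≤ schurBound τ s p q := by
  have := gridDecay_pos τ (p - q)
  unfold schurBound; positivity

lemma measurable_schurBound (τ s : ℝ) : Measurable (Function.uncurry (schurBound τ s)) := by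
  have := measurable_gridDecay_sub τ
  change Measurable fun z : ℝ × ℝ => gridDecay τ (z.1 - z.2) ^ s *
    ((1 + τ * |z.2|)⁻¹) ^ (4 / 3 : ℝ) + ((1 + |z.1 - z.2|)⁻¹) ^ s
  fun_prop

lemma lintegral_schurBound_le : ∃ C : ℝ, 0 ≤ C ∧ ∀ τ : ℝ, 0 < τ → ∀ s : ℝ, 1 < s →
    ∀ p : ℝ, ∫⁻ q, ENNReal.ofReal (schurBound τ s p q) ≤ ENNReal.ofReal (C / (s - 1)) := by
  obtain ⟨C, hC, h⟩ := lintegral_gridDecay_rpow_mul_le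
  refine ⟨C + 2, by positivity, fun τ hτ s hs p => ?_⟩
  have hs' : 0 < s - 1 := by linarith
  have hm : Measurable fun q : ℝ => ENNReal.ofReal (((1 + |p - q|)⁻¹) ^ s) := by fun_prop
  calc _ = ∫⁻ q, (ENNReal.ofReal (gridDecay τ (q - p) ^ s * ((1 + τ * |q|)⁻¹) ^ (4 / 3 : ℝ)) +
        ENNReal.ofReal (((1 + |p - q|)⁻¹) ^ s)) := by
        refine lintegral_congr fun q => ?_
        have hg := gridDecay_pos τ (q - p)
        rw [← ENNReal.ofReal_add (by positivity) (by positivity), schurBound, ← neg_sub q p,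
          gridDecay_neg]
    _ ≤ ENNReal.ofReal (C / (s - 1)) + ENNReal.ofReal (2 / (s - 1)) := by
        rw [lintegral_add_right _ hm, lintegral_inv_one_add_abs_sub_rpow hs]
        gcongr
        exact h τ hτ s hs p
    _ = _ := by rw [← ENNReal.ofReal_add (by positivity) (by positivity)]; ring_nf

/-- Double integrals dominated by a symmetrised product with `schurBound`. -/
lemma lintegral_lintegral_le_of_schurBound : ∃ C : ℝ, 0 ≤ C ∧ ∀ τ : ℝ, 0 < τ → ∀ s r : ℝ,
    1 < s → 1 < r → ∀ A : ℝ, 0 ≤ A → ∀ K : ℝ → ℝ → ℝ,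
    (∀ p q, K p q ≤ A * (((1 + |p|)⁻¹) ^ r * (schurBound τ s p q + ((1 + |q|)⁻¹) ^ r) +
      ((1 + |q|)⁻¹) ^ r * (schurBound τ s q p + ((1 + |p|)⁻¹) ^ r))) →
    ∫⁻ p, ∫⁻ q, ENNReal.ofReal (K p q) ≤
      ENNReal.ofReal (C * A * (r - 1)⁻¹ * ((s - 1)⁻¹ + (r - 1)⁻¹)) := by
  obtain ⟨C, hC, h⟩ := lintegral_schurBound_le
  refine ⟨4 * (C + 2), by positivity, fun τ hτ s r hs hr A hA K hK => ?_⟩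
  have hs' : 0 < s - 1 := by linarith
  have hr' : 0 < r - 1 := by linarith
  obtain ⟨f, hf⟩ : ∃ f : ℝ → ℝ≥0∞, ∀ p, f p = ENNReal.ofReal (((1 + |p|)⁻¹) ^ r) :=
    ⟨_, fun _ => rfl⟩
  obtain ⟨g, hg⟩ : ∃ g : ℝ → ℝ → ℝ≥0∞, ∀ p q, g p q =
      ENNReal.ofReal (schurBound τ s p q) + f q := ⟨_, fun _ _ => rfl⟩
  have hfm : Measurable f := by
    rw [funext hf]; fun_prop
  have hgm : Measurable (Function.uncurry g) := by
    rw [funext fun p => funext (hg p)]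
    exact (measurable_schurBound τ s).ennreal_ofReal.add (hfm.comp measurable_snd)
  have hfi : ∫⁻ p, f p = ENNReal.ofReal (2 / (r - 1)) := by
    rw [← lintegral_inv_one_add_abs_rpow hr]
    exact lintegral_congr hf
  have hgm' : Measurable (Function.uncurry fun p q => g q p) := hgm.comp measurable_swap
  have hgi : ∀ p, ∫⁻ q, g p q ≤ ENNReal.ofReal (C / (s - 1) + 2 / (r - 1)) := by
    intro p
    simp only [hg]
    rw [lintegral_add_right _ hfm, hfi, ENNReal.ofReal_add (by positivity) (by positivity)]
    gcongr
    exact h τ hτ s hs p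
  have main := lintegral_lintegral_symm_le hfm hgm hgm' hgi hgi
  have hpt : ∀ p q, ENNReal.ofReal (K p q) ≤
      ENNReal.ofReal A * (f p * g p q + f q * g q p) := by
    intro p q
    have h1 := schurBound_nonneg hτ s p q
    have h2 := schurBound_nonneg hτ s q p
    simp only [hf, hg]
    rw [← ENNReal.ofReal_add h1 (by positivity), ← ENNReal.ofReal_add h2 (by positivity),
      ← ENNReal.ofReal_mul (by positivity), ← ENNReal.ofReal_mul (by positivity),
      ← ENNReal.ofReal_add (by positivity) (by positivity), ← ENNReal.ofReal_mul hA]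
    exact ENNReal.ofReal_le_ofReal (hK p q)
  calc _ ≤ ∫⁻ p, ∫⁻ q, ENNReal.ofReal A * (f p * g p q + f q * g q p) :=
        lintegral_mono fun p => lintegral_mono fun q => hpt p q
    _ = ENNReal.ofReal A * ∫⁻ p, ∫⁻ q, (f p * g p q + f q * g q p) := by
        simp_rw [lintegral_const_mul' _ _ (ENNReal.ofReal_ne_top (r := A))]
    _ ≤ ENNReal.ofReal A * (2 * ((∫⁻ p, f p) *
        ENNReal.ofReal (C / (s - 1) + 2 / (r - 1)))) := by gcongr
    _ = ENNReal.ofReal (A * (2 * (2 / (r - 1) * (C / (s - 1) + 2 / (r - 1))))) := by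
        rw [hfi, ← ENNReal.ofReal_mul (by positivity),
          ENNReal.ofReal_mul hA, ENNReal.ofReal_mul (by norm_num : (0 : ℝ) ≤ 2),
          ENNReal.ofReal_ofNat]
    _ ≤ _ := by
        refine ENNReal.ofReal_le_ofReal ?_
        have e1 := inv_pos.2 hs'
        have e2 := inv_pos.2 hr'
        calc _ = 4 * A * (r - 1)⁻¹ * (C * (s - 1)⁻¹ + 2 * (r - 1)⁻¹) := by ring
          _ ≤ 4 * A * (r - 1)⁻¹ * ((C + 2) * (s - 1)⁻¹ + (C + 2) * (r - 1)⁻¹) := by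
            gcongr <;> linarith
          _ = _ := by ring

lemma inv_one_add_le_one {x : ℝ} (hx : 0 ≤ x) : (1 + x)⁻¹ ≤ 1 :=
  inv_le_one_of_one_le₀ (by linarith)

lemma lintegral_lintegral_kernelBound_le : ∃ C : ℝ, 0 ≤ C ∧ ∀ τ : ℝ, 0 < τ →
    ∫⁻ p, ∫⁻ q, ENNReal.ofReal (kernelBound τ p q * ((1 + |q|)⁻¹) ^ (2 / 3 : ℝ) *
      ((1 + |p|)⁻¹) ^ (2 / 3 : ℝ)) ≤ ENNReal.ofReal C := by
  obtain ⟨C, hC, h⟩ := lintegral_lintegral_le_of_schurBound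
  refine ⟨C * 2 * (16 / 15 - 1)⁻¹ * ((4 / 3 - 1)⁻¹ + (16 / 15 - 1)⁻¹), by positivity,
    fun τ hτ => ?_⟩
  refine h τ hτ (4 / 3) (16 / 15) (by norm_num) (by norm_num) 2 (by norm_num) _ fun p q => ?_
  set b := (1 + |p|)⁻¹
  set b' := (1 + |q|)⁻¹
  set g := (1 + |p - q|)⁻¹ with hg
  have hb : 0 < b := by positivity
  have hb' : 0 < b' := by positivity
  have hg0 : 0 < g := by positivity
  have hH := gridDecay_pos τ (p - q)
  set H := gridDecay τ (p - q) with hHd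
  set w := (1 + τ * |p|)⁻¹ with hw
  set w' := (1 + τ * |q|)⁻¹ with hw'
  have hw0 : 0 < w := by positivity
  have hw0' : 0 < w' := by positivity
  have hw1 : w ≤ 1 := inv_one_add_le_one (by positivity)
  have hw1' : w' ≤ 1 := inv_one_add_le_one (by positivity)
  have hk : kernelBound τ p q ≤ w * w' * H + g := by
    unfold kernelBound
    rw [← hw, ← hw', ← hHd, ← hg]
    nlinarith
  have e : ∀ t : ℝ, 0 < t → (t ^ (2 / 3 : ℝ)) ^ (8 / 5 : ℝ) = t ^ (16 / 15 : ℝ) := fun t ht => by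
    rw [← Real.rpow_mul ht.le]; norm_num
  have y1 := mul_mul_le_rpow (x := b ^ (2 / 3 : ℝ)) (y := b' ^ (2 / 3 : ℝ)) (z := w * w' * H)
    (by positivity) (by positivity) (by positivity)
  have y2 := mul_mul_le_rpow (x := b ^ (2 / 3 : ℝ)) (y := b' ^ (2 / 3 : ℝ)) (z := g)
    (by positivity) (by positivity) (by positivity)
  rw [e b hb, e b' hb'] at y1 y2
  have z1 : (w * w' * H) ^ (4 / 3 : ℝ) ≤ H ^ (4 / 3 : ℝ) * w' ^ (4 / 3 : ℝ) := by
    rw [← Real.mul_rpow hH.le hw0'.le]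
    refine Real.rpow_le_rpow (by positivity) ?_ (by norm_num)
    calc w * w' * H ≤ 1 * w' * H := by gcongr
      _ = _ := by ring
  have z2 : (w * w' * H) ^ (4 / 3 : ℝ) ≤ H ^ (4 / 3 : ℝ) * w ^ (4 / 3 : ℝ) := by
    rw [← Real.mul_rpow hH.le hw0.le]
    refine Real.rpow_le_rpow (by positivity) ?_ (by norm_num)
    calc w * w' * H ≤ w * 1 * H := by gcongr
      _ = _ := by ring
  have s1 : schurBound τ (4 / 3) p q = H ^ (4 / 3 : ℝ) * w' ^ (4 / 3 : ℝ) + g ^ (4 / 3 : ℝ) := rfl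
  have s2 : schurBound τ (4 / 3) q p = H ^ (4 / 3 : ℝ) * w ^ (4 / 3 : ℝ) + g ^ (4 / 3 : ℝ) := by
    rw [schurBound, ← neg_sub p q, gridDecay_neg, abs_neg]
  rw [s1, s2]
  set B := b ^ (16 / 15 : ℝ)
  set B' := b' ^ (16 / 15 : ℝ)
  have hB : 0 ≤ B := by positivity
  have hB' : 0 ≤ B' := by positivity
  set X := H ^ (4 / 3 : ℝ) * w' ^ (4 / 3 : ℝ)
  set X' := H ^ (4 / 3 : ℝ) * w ^ (4 / 3 : ℝ)
  set G := g ^ (4 / 3 : ℝ)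
  have hX : 0 ≤ X := by positivity
  have hX' : 0 ≤ X' := by positivity
  have hG : 0 ≤ G := by positivity
  calc _ ≤ (w * w' * H + g) * b' ^ (2 / 3 : ℝ) * b ^ (2 / 3 : ℝ) := by gcongr
    _ = b ^ (2 / 3 : ℝ) * b' ^ (2 / 3 : ℝ) * (w * w' * H) +
        b ^ (2 / 3 : ℝ) * b' ^ (2 / 3 : ℝ) * g := by ring
    _ ≤ (B * X + B' * X' + B * B') + (B * G + B' * G + B * B') := by
        refine add_le_add (y1.trans ?_) y2
        gcongr
    _ ≤ _ := by
        nlinarith [mul_nonneg hB hX, mul_nonneg hB' hX', mul_nonneg hB hG, mul_nonneg hB' hG,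
          mul_nonneg hB hB']

lemma inv_mul_rpow_le {τ X Y η : ℝ} (hτ : 0 < τ) (hX : 0 < X) (hY : 0 < Y)
    (h : τ * X ≤ Y) (hη : 0 ≤ η) (hητ : η * log (1 / τ) ≤ 1) :
    X⁻¹ * (Y⁻¹) ^ η ≤ 3 * (X⁻¹) ^ (1 + η) := by
  have h1 : (Y⁻¹) ^ η ≤ (τ⁻¹ * X⁻¹) ^ η := by
    rw [← mul_inv]; gcongr
  have h2 : (τ⁻¹) ^ η ≤ 3 := by
    rw [Real.rpow_def_of_pos (inv_pos.2 hτ), mul_comm, ← one_div]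
    exact (Real.exp_le_exp.2 hητ).trans (Real.exp_one_lt_three).le
  rw [Real.mul_rpow (by positivity) (by positivity)] at h1
  rw [Real.rpow_add (inv_pos.2 hX), Real.rpow_one]
  calc _ ≤ X⁻¹ * (3 * (X⁻¹) ^ η) := by
        gcongr
        exact h1.trans (by gcongr)
    _ = _ := by ring

lemma lintegral_lintegral_kernelBound_le_log : ∃ C : ℝ, 0 ≤ C ∧ ∀ τ : ℝ, 0 < τ → τ ≤ 1 →
    ∫⁻ p, ∫⁻ q, ENNReal.ofReal (kernelBound τ p q * ((1 + |q|)⁻¹) ^ (1 / 2 : ℝ) *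
      ((1 + |p|)⁻¹) ^ (1 / 2 : ℝ)) ≤ ENNReal.ofReal (C * (2 + log (1 / τ)) ^ 2) := by
  obtain ⟨C, hC, h⟩ := lintegral_lintegral_le_of_schurBound
  refine ⟨C * 765 * 2, by positivity, fun τ hτ hτ1 => ?_⟩
  have hlog : 0 ≤ log (1 / τ) := Real.log_nonneg (by rw [le_div_iff₀ hτ]; linarith)
  set Λ := 2 + log (1 / τ) with hΛ
  have hΛ0 : 0 < Λ := by positivity
  set η := Λ⁻¹ with hη
  have hη0 : 0 < η := inv_pos.2 hΛ0
  have hη2 : η ≤ 1 / 2 := by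
    rw [hη, one_div]; gcongr; linarith
  have hητ : η * log (1 / τ) ≤ 1 := by
    rw [hη, inv_mul_le_iff₀ hΛ0]; linarith
  have key := h τ hτ (1 + η) (1 + η) (by linarith) (by linarith) 765 (by norm_num)
    (fun p q => kernelBound τ p q * ((1 + |q|)⁻¹) ^ (1 / 2 : ℝ) * ((1 + |p|)⁻¹) ^ (1 / 2 : ℝ)) ?_
  · refine key.trans (ENNReal.ofReal_le_ofReal ?_)
    rw [add_sub_cancel_left, hη, inv_inv]
    apply le_of_eq; ring
  intro p q
  have hdk := diag_kernel_le hτ hτ1 p q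
  have hdec : ∀ x : ℝ, (1 + |x|)⁻¹ * ((1 + τ * |x|)⁻¹) ^ (1 / 2 : ℝ) ≤
      3 * ((1 + |x|)⁻¹) ^ (1 + η) := by
    intro x
    refine le_trans ?_ (inv_mul_rpow_le hτ (X := 1 + |x|) (Y := 1 + τ * |x|) (by positivity)
      (by positivity) (by linarith) hη0.le hητ)
    gcongr (1 + |x|)⁻¹ * ?_
    exact Real.rpow_le_rpow_of_exponent_ge (by positivity)
      (inv_one_add_le_one (by positivity)) hη2
  have hH : gridDecay τ (p - q) ≤ 15 * gridDecay τ (p - q) ^ (1 + η) := by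
    have hpi := Real.pi_lt_d2
    have hhalf := norm_addCircle_le_half (p := 2 * π / τ) (by positivity) (p - q)
    have h5 : τ * (1 + ‖((p - q : ℝ) : AddCircle (2 * π / τ))‖) ≤ 5 := by
      have : τ * ‖((p - q : ℝ) : AddCircle (2 * π / τ))‖ ≤ π := by
        calc _ ≤ τ * (2 * π / τ / 2) := by gcongr
          _ = π := by field_simp
      linarith
    have h6 := inv_mul_rpow_le hτ (X := 1 + ‖((p - q : ℝ) : AddCircle (2 * π / τ))‖) (Y := 5)
      (by positivity) (by norm_num) h5 hη0.le hητ
    have h7 : (5 : ℝ)⁻¹ ≤ (5⁻¹ : ℝ) ^ η := by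
      calc (5 : ℝ)⁻¹ = (5⁻¹ : ℝ) ^ (1 : ℝ) := (Real.rpow_one _).symm
        _ ≤ _ := Real.rpow_le_rpow_of_exponent_ge (by norm_num) (by norm_num) (by linarith)
    change gridDecay τ (p - q) * (5⁻¹ : ℝ) ^ η ≤ 3 * gridDecay τ (p - q) ^ (1 + η) at h6
    have := mul_le_mul_of_nonneg_left h7 (gridDecay_pos τ (p - q)).le
    linarith
  have hdp := hdec p
  have hdq := hdec q
  have hdd : diagDecay τ (p - q) ≤ 3 * ((1 + |p - q|)⁻¹) ^ (1 + η) := hdec (p - q)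
  have s2 : schurBound τ (1 + η) q p = gridDecay τ (p - q) ^ (1 + η) *
      ((1 + τ * |p|)⁻¹) ^ (4 / 3 : ℝ) + ((1 + |p - q|)⁻¹) ^ (1 + η) := by
    rw [schurBound, ← neg_sub p q, gridDecay_neg, abs_neg]
  rw [s2]
  unfold schurBound kernelBound
  have hH0 := gridDecay_pos τ (p - q)
  set H := gridDecay τ (p - q) with hHd
  set b := (1 + |p|)⁻¹
  set b' := (1 + |q|)⁻¹
  set g := (1 + |p - q|)⁻¹ with hg
  set w := (1 + τ * |p|)⁻¹ with hw
  set w' := (1 + τ * |q|)⁻¹ with hw'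
  have hb : 0 < b := by positivity
  have hb' : 0 < b' := by positivity
  have hg0 : 0 < g := by positivity
  have hw0 : 0 < w := by positivity
  have hw0' : 0 < w' := by positivity
  have hw1 : w ≤ 1 := inv_one_add_le_one (by positivity)
  have hw1' : w' ≤ 1 := inv_one_add_le_one (by positivity)
  have hD0 : 0 ≤ diagDecay τ (p - q) := by unfold diagDecay; positivity
  set G := diagDecay τ (p - q)
  have amgm : ∀ x y : ℝ, x * y ≤ x ^ 2 + y ^ 2 := fun x y => by
    nlinarith [sq_nonneg (x - y), sq_nonneg (x + y)]
  have sq_rpow : ∀ t a c : ℝ, 0 < t → a * 2 = c → (t ^ a) ^ 2 = t ^ c := fun t a c ht hac => by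
    rw [← Real.rpow_natCast, ← Real.rpow_mul ht.le]; norm_num [hac]
  have mul_rpow' : ∀ t a c : ℝ, 0 < t → a + c = 1 → t ^ a * t ^ c = t := fun t a c ht hac => by
    rw [← Real.rpow_add ht, hac, Real.rpow_one]
  have le_half : ∀ t : ℝ, 0 < t → t ≤ 1 → t ^ (2 / 3 : ℝ) ≤ t ^ (1 / 2 : ℝ) := fun t ht ht1 =>
    Real.rpow_le_rpow_of_exponent_ge ht ht1 (by norm_num)
  have t1 : b ^ (1 / 2 : ℝ) * b' ^ (1 / 2 : ℝ) * (w * w') ≤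
      b * w ^ (1 / 2 : ℝ) * w' ^ (4 / 3 : ℝ) + b' * w' ^ (1 / 2 : ℝ) * w ^ (4 / 3 : ℝ) := by
    have := amgm (b ^ (1 / 2 : ℝ) * w ^ (1 / 3 : ℝ) * w' ^ (2 / 3 : ℝ))
      (b' ^ (1 / 2 : ℝ) * w' ^ (1 / 3 : ℝ) * w ^ (2 / 3 : ℝ))
    simp only [mul_pow] at this
    rw [sq_rpow b (1 / 2) 1 hb (by norm_num), sq_rpow b' (1 / 2) 1 hb' (by norm_num),
      sq_rpow w (1 / 3) (2 / 3) hw0 (by norm_num), sq_rpow w (2 / 3) (4 / 3) hw0 (by norm_num),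
      sq_rpow w' (1 / 3) (2 / 3) hw0' (by norm_num), sq_rpow w' (2 / 3) (4 / 3) hw0' (by norm_num),
      Real.rpow_one, Real.rpow_one] at this
    calc _ = b ^ (1 / 2 : ℝ) * b' ^ (1 / 2 : ℝ) * ((w ^ (1 / 3 : ℝ) * w ^ (2 / 3 : ℝ)) *
          (w' ^ (1 / 3 : ℝ) * w' ^ (2 / 3 : ℝ))) := by
          rw [mul_rpow' w (1 / 3) (2 / 3) hw0 (by norm_num), mul_rpow' w' (1 / 3) (2 / 3) hw0' (by norm_num)]
      _ = _ := by ring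
      _ ≤ _ := this
      _ ≤ _ := by
          have := le_half w hw0 hw1
          have := le_half w' hw0' hw1'
          gcongr
  have t2 : b ^ (1 / 2 : ℝ) * b' ^ (1 / 2 : ℝ) * (w ^ (1 / 4 : ℝ) * w' ^ (1 / 4 : ℝ)) ≤
      b * w ^ (1 / 2 : ℝ) + b' * w' ^ (1 / 2 : ℝ) := by
    have := amgm (b ^ (1 / 2 : ℝ) * w ^ (1 / 4 : ℝ)) (b' ^ (1 / 2 : ℝ) * w' ^ (1 / 4 : ℝ))
    simp only [mul_pow] at this
    rw [sq_rpow b (1 / 2) 1 hb (by norm_num), sq_rpow b' (1 / 2) 1 hb' (by norm_num),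
      sq_rpow w (1 / 4) (1 / 2) hw0 (by norm_num), sq_rpow w' (1 / 4) (1 / 2) hw0' (by norm_num),
      Real.rpow_one, Real.rpow_one] at this
    linarith
  set β := b ^ (1 / 2 : ℝ) * b' ^ (1 / 2 : ℝ)
  have hβ : 0 ≤ β := by positivity
  set F := b ^ (1 + η)
  set F' := b' ^ (1 + η)
  set S := g ^ (1 + η)
  set R := H ^ (1 + η)
  have hF : 0 ≤ F := by positivity
  have hF' : 0 ≤ F' := by positivity
  have hS : 0 ≤ S := by positivity
  have hR : 0 ≤ R := by positivity
  set V := w ^ (4 / 3 : ℝ)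
  set V' := w' ^ (4 / 3 : ℝ)
  have hV : 0 ≤ V := by positivity
  have hV' : 0 ≤ V' := by positivity
  have u1 : β * (w * w') * H ≤ (3 * F * V' + 3 * F' * V) * (15 * R) := by
    refine mul_le_mul (t1.trans ?_) hH hH0.le (by positivity)
    gcongr
  have u2 : β * (w ^ (1 / 4 : ℝ) * w' ^ (1 / 4 : ℝ)) * G ≤ (3 * F + 3 * F') * (3 * S) := by
    refine mul_le_mul (t2.trans ?_) hdd hD0 (by positivity)
    gcongr
  calc _ = β * (w * w' * H + w * g) := by ring
    _ ≤ β * (w * w' * H + 16 * (w * w' * H + w ^ (1 / 4 : ℝ) * w' ^ (1 / 4 : ℝ) * G)) := by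
        gcongr
    _ = 17 * (β * (w * w') * H) + 16 * (β * (w ^ (1 / 4 : ℝ) * w' ^ (1 / 4 : ℝ)) * G) := by ring
    _ ≤ 17 * ((3 * F * V' + 3 * F' * V) * (15 * R)) + 16 * ((3 * F + 3 * F') * (3 * S)) := by
        gcongr
    _ = 765 * (F * (R * V') + F' * (R * V)) + 144 * (F * S + F' * S) := by ring
    _ ≤ 765 * (F * (R * V') + F' * (R * V)) + 765 * (F * S + F' * S) + 765 * (2 * (F * F')) := by
        have : 0 ≤ F * S + F' * S := by positivity
        have : 0 ≤ F * F' := by positivity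
        linarith
    _ = _ := by ring

lemma enorm_errKernel_le {τ T : ℝ} (hτ : 0 < τ) (hτ1 : τ ≤ 1) {s t : ℝ} (hs : 0 ≤ s)
    (hst : s ≤ t) (htT : t ≤ T) (a b : ℝ) :
    ‖errKernel τ s t a b‖ₑ ≤
      ENNReal.ofReal (36 * (T + 8) * τ) * ENNReal.ofReal (kernelBound τ a b) := by
  have hT : 0 ≤ T := hs.trans (hst.trans htT)
  rw [← ofReal_norm, ← ENNReal.ofReal_mul (by positivity)]
  exact ENNReal.ofReal_le_ofReal (norm_errKernel_le hτ hτ1 hs hst htT a b)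

lemma ofReal_kernelBound_slowly_varying_left {τ : ℝ} (hτ : 0 < τ) (hτ1 : τ ≤ 1) (x y q : ℝ)
    (h : |x - y| ≤ 1) :
    ENNReal.ofReal (kernelBound τ x q) ≤ 4 * ENNReal.ofReal (kernelBound τ y q) := by
  rw [← ENNReal.ofReal_ofNat, ← ENNReal.ofReal_mul (by norm_num)]
  exact ENNReal.ofReal_le_ofReal (kernelBound_slowly_varying_left hτ hτ1 q h)

lemma ofReal_kernelBound_slowly_varying_right {τ : ℝ} (hτ : 0 < τ) (hτ1 : τ ≤ 1) (p x y : ℝ)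
    (h : |x - y| ≤ 1) :
    ENNReal.ofReal (kernelBound τ p x) ≤ 4 * ENNReal.ofReal (kernelBound τ p y) := by
  rw [← ENNReal.ofReal_ofNat, ← ENNReal.ofReal_mul (by norm_num)]
  exact ENNReal.ofReal_le_ofReal (kernelBound_slowly_varying_right hτ hτ1 p h)

lemma lintegral_kernelBound_comp_le_of_sublevel {θ : ℝ → ℝ} (hθ : Measurable θ) {B J γ τ : ℝ}
    (hB : 0 ≤ B) (hvol : ∀ a, volume {ξ | θ ξ ∈ Set.Icc a (a + 1)} ≤
      ENNReal.ofReal (B * ((1 + |a|)⁻¹) ^ γ)) (hτ : 0 < τ) (hτ1 : τ ≤ 1)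
    (b : ℝ)
    (hJ : ∫⁻ p, ENNReal.ofReal (kernelBound τ p b * ((1 + |p|)⁻¹) ^ γ) ≤ ENNReal.ofReal J) :
    ∫⁻ ξ, ENNReal.ofReal (kernelBound τ (θ ξ) b) ≤ ENNReal.ofReal (4 * (B * J)) := by
  have hF : Measurable fun p => ENNReal.ofReal (kernelBound τ p b) :=
    ((measurable_kernelBound τ).comp (measurable_id.prodMk measurable_const)).ennreal_ofReal
  have hβ : Measurable fun a : ℝ => ENNReal.ofReal (B * ((1 + |a|)⁻¹) ^ γ) := by fun_prop
  calc _ ≤ (4 * ∫⁻ p, ENNReal.ofReal (kernelBound τ p b) *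
        ENNReal.ofReal (B * ((1 + |p|)⁻¹) ^ γ)) := by
        exact lintegral_comp_le_of_slowly_varying hθ hF hβ
          (fun x y h => ofReal_kernelBound_slowly_varying_left hτ hτ1 x y b h) hvol
    _ = (4 * (ENNReal.ofReal B *
        ∫⁻ p, ENNReal.ofReal (kernelBound τ p b * ((1 + |p|)⁻¹) ^ γ))) := by
        rw [← lintegral_const_mul' _ _ ENNReal.ofReal_ne_top]
        congr 1
        refine lintegral_congr fun p => ?_
        rw [ENNReal.ofReal_mul hB, ENNReal.ofReal_mul (kernelBound_nonneg hτ _ _)]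
        ring
    _ ≤ (4 * (ENNReal.ofReal B * ENNReal.ofReal J)) := by
        gcongr
    _ = _ := by
        rw [← ENNReal.ofReal_mul hB, ← ENNReal.ofReal_ofNat, ← ENNReal.ofReal_mul (by norm_num)]

lemma lintegral_lintegral_kernelBound_comp_le_of_sublevel {θ : ℝ → ℝ} (hθ : Measurable θ)
    {B J γ τ : ℝ} (hB : 0 ≤ B) (hvol : ∀ a, volume {ξ | θ ξ ∈ Set.Icc a (a + 1)} ≤
      ENNReal.ofReal (B * ((1 + |a|)⁻¹) ^ γ)) (hτ : 0 < τ) (hτ1 : τ ≤ 1)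
    (hJ : ∫⁻ p, ∫⁻ q, ENNReal.ofReal (kernelBound τ p q * ((1 + |q|)⁻¹) ^ γ *
      ((1 + |p|)⁻¹) ^ γ) ≤ ENNReal.ofReal J) :
    ∫⁻ ξ, ∫⁻ η, ENNReal.ofReal (kernelBound τ (θ ξ) (θ η)) ≤
      ENNReal.ofReal (16 * (B * (B * J))) := by
  have hF : Measurable (Function.uncurry fun p q => ENNReal.ofReal (kernelBound τ p q)) :=
    (measurable_kernelBound τ).ennreal_ofReal
  have hβ : Measurable fun a : ℝ => ENNReal.ofReal (B * ((1 + |a|)⁻¹) ^ γ) := by fun_prop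
  calc _ ≤ (4 * (4 * ∫⁻ p, (∫⁻ q,
        ENNReal.ofReal (kernelBound τ p q) * ENNReal.ofReal (B * ((1 + |q|)⁻¹) ^ γ)) *
        ENNReal.ofReal (B * ((1 + |p|)⁻¹) ^ γ))) := by
        exact lintegral_lintegral_comp_le_of_slowly_varying hθ hF hβ
          (fun x y q h => ofReal_kernelBound_slowly_varying_left hτ hτ1 x y q h)
          (fun p x y h => ofReal_kernelBound_slowly_varying_right hτ hτ1 p x y h) hvol
    _ = (4 * (4 * (ENNReal.ofReal B * (ENNReal.ofReal B *
        ∫⁻ p, ∫⁻ q, ENNReal.ofReal (kernelBound τ p q * ((1 + |q|)⁻¹) ^ γ *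
          ((1 + |p|)⁻¹) ^ γ))))) := by
        congr 2
        simp_rw [← lintegral_const_mul' _ _ (ENNReal.ofReal_ne_top (r := B)),
          ← lintegral_mul_const' _ _ ENNReal.ofReal_ne_top]
        refine lintegral_congr fun p => lintegral_congr fun q => ?_
        have := kernelBound_nonneg hτ p q
        simp only [← ENNReal.ofReal_mul hB]
        rw [← ENNReal.ofReal_mul (by positivity), ← ENNReal.ofReal_mul (by positivity)]
        ring_nf
    _ ≤ (4 * (4 * (ENNReal.ofReal B * (ENNReal.ofReal B *
        ENNReal.ofReal J)))) := by gcongr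
    _ = _ := by
        rw [← ENNReal.ofReal_mul hB, ← ENNReal.ofReal_mul hB, ← ENNReal.ofReal_ofNat,
          ← ENNReal.ofReal_mul (by norm_num), ← ENNReal.ofReal_mul (by norm_num)]
        ring_nf

lemma measurable_P (κ : ℕ) (d : ℕ → ℝ) : Measurable (P κ d) := by
  unfold P; fun_prop

/-- The size of the double kernel integral relative to `τ ε^{-2α/κ}`. -/
noncomputable def resonanceLog (κ : ℕ) (τ : ℝ) : ℝ :=
  if κ = 2 then (2 + log (1 / τ)) ^ 2 else 1

lemma resonanceLog_nonneg (κ : ℕ) (τ : ℝ) : 0 ≤ resonanceLog κ τ := by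
  unfold resonanceLog; split_ifs <;> positivity

lemma lintegral_lintegral_kernelBound_le_resonanceLog {κ : ℕ} (hκ : 2 ≤ κ) :
    ∃ C γ : ℝ, 0 ≤ C ∧ 0 ≤ γ ∧ κ * γ ≤ κ - 1 ∧ ∀ τ : ℝ, 0 < τ → τ ≤ 1 →
      ∫⁻ p, ∫⁻ q, ENNReal.ofReal (kernelBound τ p q * ((1 + |q|)⁻¹) ^ γ *
        ((1 + |p|)⁻¹) ^ γ) ≤ ENNReal.ofReal (C * resonanceLog κ τ) := by
  rcases eq_or_ne κ 2 with rfl | h2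
  · obtain ⟨C, hC, h⟩ := lintegral_lintegral_kernelBound_le_log
    exact ⟨C, 1 / 2, hC, by norm_num, by norm_num, fun τ hτ hτ1 => by
      simpa [resonanceLog] using h τ hτ hτ1⟩
  · obtain ⟨C, hC, h⟩ := lintegral_lintegral_kernelBound_le
    have h3 : (3 : ℝ) ≤ κ := by exact_mod_cast (by omega : 3 ≤ κ)
    exact ⟨C, 2 / 3, hC, by norm_num, by linarith, fun τ hτ _ => by
      simpa [resonanceLog, h2] using h τ hτ⟩

lemma lintegral_kernelBound_P_le {κ : ℕ} (hκ : 2 ≤ κ) {d : ℕ → ℝ} (hd : d κ = 1) :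
    ∃ C : ℝ, 0 ≤ C ∧ ∀ τ ε α : ℝ, 0 < τ → τ ≤ 1 → 0 < ε → ε ≤ 1 → 0 ≤ α →
      (∀ b, ∫⁻ ξ, ENNReal.ofReal (kernelBound τ (ε ^ α * P κ d ξ) b) ≤
        ENNReal.ofReal (C * ε ^ (-(α / κ)))) ∧
      ∫⁻ ξ, ∫⁻ η, ENNReal.ofReal (kernelBound τ (ε ^ α * P κ d ξ) (ε ^ α * P κ d η)) ≤
        ENNReal.ofReal (C * ((ε ^ (-(α / κ))) ^ 2 * resonanceLog κ τ)) := by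
  have h2 : (2 : ℝ) ≤ κ := by exact_mod_cast hκ
  obtain ⟨C₁, hC₁, h₁⟩ := lintegral_kernelBound_le
  obtain ⟨C₂, γ, hC₂, hγ, hκγ, h₂⟩ := lintegral_lintegral_kernelBound_le_resonanceLog hκ
  obtain ⟨K₁, hK₁, hv₁⟩ := volume_scaled_P_le hκ hd (γ := 1 / 2) (by norm_num) (by linarith)
  obtain ⟨K₂, hK₂, hv₂⟩ := volume_scaled_P_le hκ hd hγ hκγ
  refine ⟨4 * (K₁ * C₁) + 16 * (K₂ * (K₂ * C₂)), by positivity,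
    fun τ ε α hτ hτ1 hε hε1 hα => ?_⟩
  have hθ : Measurable fun ξ => ε ^ α * P κ d ξ := (measurable_P κ d).const_mul _
  have hR := resonanceLog_nonneg κ τ
  constructor
  · intro b
    refine (lintegral_kernelBound_comp_le_of_sublevel hθ (by positivity) (hv₁ ε α hε hε1 hα) hτ hτ1
      b (h₁ τ hτ hτ1 b)).trans (ENNReal.ofReal_le_ofReal ?_)
    have : 0 ≤ 16 * (K₂ * (K₂ * C₂)) * ε ^ (-(α / κ)) := by positivity
    linarith
  · refine (lintegral_lintegral_kernelBound_comp_le_of_sublevel hθ (by positivity)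
      (hv₂ ε α hε hε1 hα) hτ hτ1 (h₂ τ hτ hτ1)).trans (ENNReal.ofReal_le_ofReal ?_)
    have : 0 ≤ 4 * (K₁ * C₁) * ((ε ^ (-(α / κ))) ^ 2 * resonanceLog κ τ) := by positivity
    linarith

/-- Fubini's theorem on the triangle `a ≤ r ≤ s ≤ b`. -/
lemma integral_mul_integral_triangle {o g : ℝ → ℂ} {a b : ℝ} (hab : a ≤ b)
    (ho : IntervalIntegrable o volume a b) (hg : IntervalIntegrable g volume a b) :
    ∫ s in a..b, o s * ∫ r in a..s, g r = ∫ r in a..b, (∫ s in r..b, o s) * g r := by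
  rw [intervalIntegrable_iff_integrableOn_Ioc_of_le hab] at ho hg
  set S : Set (ℝ × ℝ) := {p | p.2 ≤ p.1} with hS
  have hSm : MeasurableSet S := measurableSet_le measurable_snd measurable_fst
  have hprod_int : Integrable (Function.uncurry fun s r => S.indicator (fun p => o p.1 * g p.2) (s, r))
      ((volume.restrict (Set.Ioc a b)).prod (volume.restrict (Set.Ioc a b))) :=
    (ho.mul_prod hg).indicator hSm
  rw [intervalIntegral.integral_of_le hab, intervalIntegral.integral_of_le hab]
  calc _ = ∫ s in Set.Ioc a b, ∫ r in Set.Ioc a b, S.indicator (fun p => o p.1 * g p.2) (s, r) := by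
        refine setIntegral_congr_fun measurableSet_Ioc fun s hs => ?_
        rw [intervalIntegral.integral_of_le hs.1.le, ← integral_const_mul,
          ← integral_indicator measurableSet_Ioc, ← integral_indicator measurableSet_Ioc]
        congr 1
        ext r
        by_cases h1 : r ∈ Set.Ioc a s
        · rw [Set.indicator_of_mem h1, Set.indicator_of_mem (show r ∈ Set.Ioc a b from ⟨h1.1, h1.2.trans hs.2⟩),
            Set.indicator_of_mem (show (s, r) ∈ S from h1.2)]
        · rw [Set.indicator_of_notMem h1]
          by_cases h2 : r ∈ Set.Ioc a b
          · rw [Set.indicator_of_mem h2, Set.indicator_of_notMem]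
            exact fun h => h1 ⟨h2.1, h⟩
          · rw [Set.indicator_of_notMem h2]
    _ = ∫ r in Set.Ioc a b, ∫ s in Set.Ioc a b, S.indicator (fun p => o p.1 * g p.2) (s, r) :=
        integral_integral_swap hprod_int
    _ = _ := by
        refine setIntegral_congr_fun measurableSet_Ioc fun r hr => ?_
        rw [intervalIntegral.integral_of_le hr.2, ← integral_mul_const, 
          ← integral_Icc_eq_integral_Ioc (f := fun s => o s * g r),
          ← integral_indicator measurableSet_Ioc, ← integral_indicator measurableSet_Icc]
        congr 1
        ext s
        by_cases h1 : s ∈ Set.Icc r b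
        · rw [Set.indicator_of_mem h1,
            Set.indicator_of_mem (show s ∈ Set.Ioc a b from ⟨hr.1.trans_le h1.1, h1.2⟩),
            Set.indicator_of_mem (show (s, r) ∈ S from h1.1)]
        · rw [Set.indicator_of_notMem h1]
          by_cases h2 : s ∈ Set.Ioc a b
          · rw [Set.indicator_of_mem h2, Set.indicator_of_notMem]
            exact fun h => h1 ⟨h, h2.2⟩
          · rw [Set.indicator_of_notMem h2]

lemma IntervalIntegrable.osc_mul {g : ℝ → ℂ} {a b : ℝ} (hg : IntervalIntegrable g volume a b)
    (c : ℝ) : IntervalIntegrable (fun r => osc (r * c) * g r) volume a b :=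
  hg.continuousOn_mul (continuous_osc.comp (continuous_id.mul continuous_const)).continuousOn

lemma integral_I_mul_osc (c s t : ℝ) :
    ∫ r in s..t, Complex.I * c * osc (r * c) = osc (t * c) - osc (s * c) :=
  intervalIntegral.integral_eq_sub_of_hasDerivAt (fun x _ => hasDerivAt_osc_mul c x)
    ((intervalIntegrable_osc c s t).const_mul _)

/-- Integration by parts for a primitive times a phase. -/
lemma osc_mul_primitive {g : ℝ → ℂ} {s : ℝ} (hs : 0 ≤ s) (hg : IntervalIntegrable g volume 0 s)
    (c : ℝ) (A : ℂ) :
    osc (s * c) * (A + ∫ r in (0:ℝ)..s, g r) = A + ∫ r in (0:ℝ)..s,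
      (Complex.I * c * (osc (r * c) * (A + ∫ q in (0:ℝ)..r, g q)) + osc (r * c) * g r) := by
  have ho : IntervalIntegrable (fun r => Complex.I * c * osc (r * c)) volume 0 s :=
    (intervalIntegrable_osc c 0 s).const_mul _
  have hprim : ContinuousOn (fun r => ∫ q in (0:ℝ)..r, g q) (Set.uIcc 0 s) :=
    intervalIntegral.continuousOn_primitive_interval (by
      rwa [← intervalIntegrable_iff'])
  have h1 := integral_mul_integral_triangle hs ho hg
  simp_rw [integral_I_mul_osc, sub_mul] at h1
  rw [intervalIntegral.integral_sub (hg.const_mul _) (hg.osc_mul c),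
    intervalIntegral.integral_const_mul] at h1
  have h2 : ∫ r in (0:ℝ)..s, Complex.I * c * osc (r * c) * A = (osc (s * c) - 1) * A := by
    rw [intervalIntegral.integral_mul_const, integral_I_mul_osc, zero_mul, osc_zero]
  have h3 : ∫ r in (0:ℝ)..s,
      (Complex.I * c * (osc (r * c) * (A + ∫ q in (0:ℝ)..r, g q)) + osc (r * c) * g r) =
      (∫ r in (0:ℝ)..s, Complex.I * c * osc (r * c) * A) +
      (∫ r in (0:ℝ)..s, Complex.I * c * osc (r * c) * ∫ q in (0:ℝ)..r, g q) +
      ∫ r in (0:ℝ)..s, osc (r * c) * g r := by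
    rw [← intervalIntegral.integral_add (ho.mul_const A) (ho.mul_continuousOn hprim),
      ← intervalIntegral.integral_add ((ho.mul_const A).add (ho.mul_continuousOn hprim))
        (hg.osc_mul c)]
    congr 1
    ext r
    ring
  rw [h3, h1, h2]
  ring

lemma measurable_primitive {g : ℝ → ℝ → ℂ} (hg : Measurable (Function.uncurry g)) (a : ℝ) :
    Measurable fun p : ℝ × ℝ => ∫ q in a..p.1, g q p.2 := by
  have key : ∀ S : Set ((ℝ × ℝ) × ℝ), MeasurableSet S →
      Measurable fun p : ℝ × ℝ => ∫ q, S.indicator (fun z => g z.2 z.1.2) (p, q) := by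
    intro S hS
    have : Measurable (S.indicator fun z : (ℝ × ℝ) × ℝ => g z.2 z.1.2) :=
      (hg.comp (measurable_snd.prodMk (measurable_snd.comp measurable_fst))).indicator hS
    exact (this.stronglyMeasurable.integral_prod_right').measurable
  have h1 := key {z | a < z.2 ∧ z.2 ≤ z.1.1}
    ((measurableSet_lt measurable_const measurable_snd).inter
      (measurableSet_le measurable_snd (measurable_fst.comp measurable_fst)))
  have h2 := key {z | z.1.1 < z.2 ∧ z.2 ≤ a}
    ((measurableSet_lt (measurable_fst.comp measurable_fst) measurable_snd).inter
      (measurableSet_le measurable_snd measurable_const))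
  convert h1.sub h2 using 2 with p
  rw [intervalIntegral, ← integral_indicator measurableSet_Ioc,
    ← integral_indicator measurableSet_Ioc]
  rfl

/-- Convolution with a bounded integrable kernel. -/
noncomputable def kconv (k g : ℝ → ℂ) (ξ : ℝ) : ℂ := ∫ η, k (ξ - η) * g η

lemma enorm_kconv_le {k : ℝ → ℂ} {N : ℝ} (hN : ∀ x, ‖k x‖ ≤ N) (g : ℝ → ℂ) (ξ : ℝ) :
    ‖kconv k g ξ‖ₑ ≤ ENNReal.ofReal N * ∫⁻ η, ‖g η‖ₑ := by
  rw [← lintegral_const_mul' _ _ ENNReal.ofReal_ne_top]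
  refine (enorm_integral_le_lintegral_enorm _).trans (lintegral_mono fun η => ?_)
  rw [enorm_mul]
  gcongr
  rw [← ofReal_norm]
  exact ENNReal.ofReal_le_ofReal (hN _)

lemma measurable_kconv {k : ℝ → ℂ} (hk : Measurable k) {v : ℝ → ℝ → ℂ}
    (hv : Measurable (Function.uncurry v)) :
    Measurable (Function.uncurry fun s ξ => kconv k (v s) ξ) := by
  have : Measurable fun z : (ℝ × ℝ) × ℝ => k (z.1.2 - z.2) * v z.1.1 z.2 :=
    (hk.comp ((measurable_snd.comp measurable_fst).sub measurable_snd)).mul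
      (hv.comp ((measurable_fst.comp measurable_fst).prodMk measurable_snd))
  exact (this.stronglyMeasurable.integral_prod_right').measurable

lemma measurable_kconv_right {k g : ℝ → ℂ} (hk : Measurable k) (hg : Measurable g) :
    Measurable (kconv k g) :=
  (measurable_kconv hk (v := fun _ => g) (hg.comp measurable_snd)).comp
    (measurable_prodMk_left (x := (0 : ℝ)))

lemma lintegral_enorm_kconv_le {k g : ℝ → ℂ} (hk : Measurable k) (hg : Measurable g) :
    ∫⁻ ξ, ‖kconv k g ξ‖ₑ ≤ (∫⁻ x, ‖k x‖ₑ) * ∫⁻ η, ‖g η‖ₑ := by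
  have hm : Measurable fun z : ℝ × ℝ => ‖k (z.1 - z.2)‖ₑ * ‖g z.2‖ₑ :=
    (hk.comp (measurable_fst.sub measurable_snd)).enorm.mul (hg.comp measurable_snd).enorm
  calc _ ≤ ∫⁻ ξ, ∫⁻ η, ‖k (ξ - η)‖ₑ * ‖g η‖ₑ := by
        refine lintegral_mono fun ξ => (enorm_integral_le_lintegral_enorm _).trans_eq ?_
        simp_rw [enorm_mul]
    _ = ∫⁻ η, ∫⁻ ξ, ‖k (ξ - η)‖ₑ * ‖g η‖ₑ := lintegral_lintegral_swap hm.aemeasurable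
    _ = ∫⁻ η, (∫⁻ x, ‖k x‖ₑ) * ‖g η‖ₑ := by
        refine lintegral_congr fun η => ?_
        rw [lintegral_mul_const _ (by fun_prop), lintegral_sub_right_eq_self (fun x => ‖k x‖ₑ)]
    _ = _ := lintegral_const_mul _ hg.enorm

lemma integrable_kconv_integrand {k g : ℝ → ℂ} (hk : Measurable k) {N : ℝ}
    (hN : ∀ x, ‖k x‖ ≤ N) (hg : Integrable g) (ξ : ℝ) :
    Integrable fun η => k (ξ - η) * g η :=
  hg.bdd_mul (hk.comp (measurable_const.sub measurable_id)).aestronglyMeasurable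
    (Filter.Eventually.of_forall fun _ => hN _)

lemma kconv_sub {k g h : ℝ → ℂ} (hk : Measurable k) {N : ℝ} (hN : ∀ x, ‖k x‖ ≤ N)
    (hg : Integrable g) (hh : Integrable h) (ξ : ℝ) :
    kconv k (fun η => g η - h η) ξ = kconv k g ξ - kconv k h ξ := by
  unfold kconv
  rw [← integral_sub (integrable_kconv_integrand hk hN hg ξ)
    (integrable_kconv_integrand hk hN hh ξ)]
  simp_rw [mul_sub]

/-- A flow `v` with phase speed `θ` and coupling kernel `k`, in the Duhamel sense on `[0, T]`. -/
structure IsTwistedFlow (θ : ℝ → ℝ) (k : ℝ → ℂ) (N R T : ℝ) (M : ℝ≥0∞) (μ₀ : ℝ → ℂ)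
    (v : ℝ → ℝ → ℂ) : Prop where
  measurable_phase : Measurable θ
  measurable_kernel : Measurable k
  measurable_data : Measurable μ₀
  measurable_flow : Measurable (Function.uncurry v)
  norm_kernel_le : ∀ x, ‖k x‖ ≤ N
  mass_nonneg : 0 ≤ R
  lintegral_kernel_le : ∫⁻ x, ‖k x‖ₑ ≤ ENNReal.ofReal R
  bound_ne_top : M ≠ ⊤
  lintegral_flow_le : ∀ s, ∫⁻ η, ‖v s η‖ₑ ≤ M
  lintegral_phase_mul_flow_le : ∀ s, ∫⁻ η, ‖(θ η : ℂ) * v s η‖ₑ ≤ M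
  duhamel : ∀ s ∈ Set.Icc 0 T, ∀ᵐ η, osc (s * θ η) * v s η =
    μ₀ η + ∫ r in (0:ℝ)..s, osc (r * θ η) * kconv k (v r) η

/-- The right-hand side `-iθg + k * g` of the evolution equation. -/
noncomputable def velocity (θ : ℝ → ℝ) (k g : ℝ → ℂ) (η : ℝ) : ℂ :=
  -(Complex.I * θ η) * g η + kconv k g η

lemma enorm_velocity_le (θ : ℝ → ℝ) (k g : ℝ → ℂ) (η : ℝ) :
    ‖velocity θ k g η‖ₑ ≤ ‖(θ η : ℂ) * g η‖ₑ + ‖kconv k g η‖ₑ := by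
  have h : ‖-(Complex.I * θ η) * g η‖ₑ = ‖(θ η : ℂ) * g η‖ₑ := by
    rw [← ofReal_norm, ← ofReal_norm]
    simp
  rw [← h]
  exact enorm_add_le _ _

lemma ae_ae_eq_of_forall_ae_eq {X Y : ℝ → ℝ → ℂ} {T : ℝ} (hX : Measurable (Function.uncurry X))
    (hY : Measurable (Function.uncurry Y)) (h : ∀ r ∈ Set.Icc 0 T, ∀ᵐ η, X r η = Y r η) :
    ∀ᵐ η : ℝ, ∀ᵐ r : ℝ, r ∈ Set.Icc 0 T → X r η = Y r η := by
  have hm : MeasurableSet {z : ℝ × ℝ | z.1 ∈ Set.Icc 0 T → X z.1 z.2 = Y z.1 z.2} := by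
    have h1 : MeasurableSet {z : ℝ × ℝ | z.1 ∈ Set.Icc 0 T} := measurable_fst measurableSet_Icc
    exact h1.imp (measurableSet_eq_fun hX hY)
  rw [← Measure.ae_ae_comm hm]
  refine Filter.Eventually.of_forall fun r => ?_
  by_cases hr : r ∈ Set.Icc 0 T
  · filter_upwards [h r hr] with η hη _ using hη
  · exact Filter.Eventually.of_forall fun η h' => absurd h' hr

lemma measurable_velocity {θ : ℝ → ℝ} {k : ℝ → ℂ} (hθ : Measurable θ) (hk : Measurable k)
    {v : ℝ → ℝ → ℂ} (hv : Measurable (Function.uncurry v)) :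
    Measurable (Function.uncurry fun s η => velocity θ k (v s) η) := by
  have h : Measurable fun z : ℝ × ℝ => -(Complex.I * (θ z.2 : ℂ)) :=
    ((Complex.measurable_ofReal.comp (hθ.comp measurable_snd)).const_mul _).neg
  exact (h.mul hv).add (measurable_kconv hk hv)

lemma measurable_velocity_right {θ : ℝ → ℝ} {k g : ℝ → ℂ} (hθ : Measurable θ) (hk : Measurable k)
    (hg : Measurable g) : Measurable (velocity θ k g) :=
  (((Complex.measurable_ofReal.comp hθ).const_mul _).neg.mul hg).add (measurable_kconv_right hk hg)

lemma measurable_osc_phase {θ : ℝ → ℝ} (hθ : Measurable θ) :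
    Measurable fun z : ℝ × ℝ => osc (z.1 * θ z.2) :=
  measurable_osc.comp (measurable_fst.mul (hθ.comp measurable_snd))

lemma norm_kconv_le {k : ℝ → ℂ} {N : ℝ} (hN : ∀ x, ‖k x‖ ≤ N) {g : ℝ → ℂ} {B : ℝ≥0∞}
    (hB : B ≠ ⊤) (hg : ∫⁻ η, ‖g η‖ₑ ≤ B) (ξ : ℝ) : ‖kconv k g ξ‖ ≤ N * B.toReal := by
  have hN0 : 0 ≤ N := (norm_nonneg _).trans (hN 0)
  rw [← ENNReal.ofReal_le_ofReal_iff (by positivity), ofReal_norm, ENNReal.ofReal_mul hN0,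
    ENNReal.ofReal_toReal hB]
  exact (enorm_kconv_le hN g ξ).trans (by gcongr)

namespace IsTwistedFlow

variable {θ : ℝ → ℝ} {k : ℝ → ℂ} {N R T : ℝ} {M : ℝ≥0∞} {μ₀ : ℝ → ℂ} {v : ℝ → ℝ → ℂ}

lemma measurable_flow_at (h : IsTwistedFlow θ k N R T M μ₀ v) (s : ℝ) : Measurable (v s) :=
  h.measurable_flow.comp measurable_prodMk_left

lemma measurable_velocity_uncurry (h : IsTwistedFlow θ k N R T M μ₀ v) :
    Measurable (Function.uncurry fun s η => velocity θ k (v s) η) :=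
  measurable_velocity h.measurable_phase h.measurable_kernel h.measurable_flow

lemma measurable_velocity_at (h : IsTwistedFlow θ k N R T M μ₀ v) (s : ℝ) :
    Measurable (velocity θ k (v s)) :=
  measurable_velocity_right h.measurable_phase h.measurable_kernel (h.measurable_flow_at s)

lemma measurable_force (h : IsTwistedFlow θ k N R T M μ₀ v) :
    Measurable (Function.uncurry fun s η => kconv k (v s) η) :=
  measurable_kconv h.measurable_kernel h.measurable_flow

lemma measurable_accel (h : IsTwistedFlow θ k N R T M μ₀ v) :
    Measurable (Function.uncurry fun s η => kconv k (velocity θ k (v s)) η) :=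
  measurable_kconv h.measurable_kernel h.measurable_velocity_uncurry

lemma integrable_flow (h : IsTwistedFlow θ k N R T M μ₀ v) (s : ℝ) : Integrable (v s) :=
  ⟨(h.measurable_flow_at s).aestronglyMeasurable,
    (h.lintegral_flow_le s).trans_lt h.bound_ne_top.lt_top⟩

lemma lintegral_kconv_le_mul (h : IsTwistedFlow θ k N R T M μ₀ v) {g : ℝ → ℂ} (hg : Measurable g) :
    ∫⁻ ξ, ‖kconv k g ξ‖ₑ ≤ ENNReal.ofReal R * ∫⁻ η, ‖g η‖ₑ :=
  (lintegral_enorm_kconv_le h.measurable_kernel hg).trans (by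
    gcongr; exact h.lintegral_kernel_le)

lemma velocity_bound_ne_top (h : IsTwistedFlow θ k N R T M μ₀ v) :
    M + ENNReal.ofReal R * M ≠ ⊤ :=
  ENNReal.add_ne_top.2 ⟨h.bound_ne_top, ENNReal.mul_ne_top ENNReal.ofReal_ne_top h.bound_ne_top⟩

lemma lintegral_velocity_le (h : IsTwistedFlow θ k N R T M μ₀ v) (s : ℝ) :
    ∫⁻ η, ‖velocity θ k (v s) η‖ₑ ≤ M + ENNReal.ofReal R * M := by
  have hm : Measurable (kconv k (v s)) :=
    measurable_kconv_right h.measurable_kernel (h.measurable_flow_at s)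
  have h1 : ∫⁻ η, ‖velocity θ k (v s) η‖ₑ ≤ ∫⁻ η, (‖(θ η : ℂ) * v s η‖ₑ + ‖kconv k (v s) η‖ₑ) :=
    lintegral_mono (enorm_velocity_le θ k (v s))
  rw [lintegral_add_right _ hm.enorm] at h1
  have h2 : ∫⁻ η, ‖kconv k (v s) η‖ₑ ≤ ENNReal.ofReal R * M :=
    (h.lintegral_kconv_le_mul (h.measurable_flow_at s)).trans
      (mul_le_mul_right (h.lintegral_flow_le s) _)
  exact h1.trans (add_le_add (h.lintegral_phase_mul_flow_le s) h2)

lemma intervalIntegrable_force (h : IsTwistedFlow θ k N R T M μ₀ v) (η a b : ℝ) :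
    IntervalIntegrable (fun r => kconv k (v r) η) volume a b :=
  intervalIntegrable_of_bounded (h.measurable_force.comp (measurable_prodMk_right (y := η)))
    (fun r => norm_kconv_le h.norm_kernel_le h.bound_ne_top (h.lintegral_flow_le r) η) a b

lemma intervalIntegrable_accel (h : IsTwistedFlow θ k N R T M μ₀ v) (η a b : ℝ) :
    IntervalIntegrable (fun r => kconv k (velocity θ k (v r)) η) volume a b :=
  intervalIntegrable_of_bounded (h.measurable_accel.comp (measurable_prodMk_right (y := η)))
    (fun r => norm_kconv_le h.norm_kernel_le h.velocity_bound_ne_top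
      (h.lintegral_velocity_le r) η) a b

lemma ae_ae_duhamel (h : IsTwistedFlow θ k N R T M μ₀ v) :
    ∀ᵐ η : ℝ, ∀ᵐ r : ℝ, r ∈ Set.Icc 0 T → osc (r * θ η) * v r η =
      μ₀ η + ∫ q in (0:ℝ)..r, osc (q * θ η) * kconv k (v q) η :=
  ae_ae_eq_of_forall_ae_eq ((measurable_osc_phase h.measurable_phase).mul h.measurable_flow)
    ((h.measurable_data.comp measurable_snd).add (measurable_primitive
      (g := fun q η => osc (q * θ η) * kconv k (v q) η)
      ((measurable_osc_phase h.measurable_phase).mul h.measurable_force) 0)) h.duhamel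

lemma flow_eq_add_integral (h : IsTwistedFlow θ k N R T M μ₀ v) {s : ℝ} (hs : s ∈ Set.Icc 0 T) :
    ∀ᵐ η : ℝ, v s η = μ₀ η + ∫ r in (0:ℝ)..s, velocity θ k (v r) η := by
  have hosc : ∀ r η (z : ℂ), osc (r * -θ η) * (osc (r * θ η) * z) = z := fun r η z => by
    rw [← mul_assoc, mul_neg, osc_neg_mul_self, one_mul]
  filter_upwards [h.duhamel s hs, h.ae_ae_duhamel] with η h1 h2
  have h3 := osc_mul_primitive hs.1
    ((h.intervalIntegrable_force η 0 s).osc_mul (θ η)) (-θ η) (μ₀ η)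
  rw [← h1, hosc] at h3
  rw [h3]
  congr 1
  refine intervalIntegral.integral_congr_ae ?_
  filter_upwards [h2] with r hr hrs
  rw [Set.uIoc_of_le hs.1] at hrs
  rw [← hr ⟨hrs.1.le, hrs.2.trans hs.2⟩, hosc, hosc, velocity]
  push_cast
  ring

lemma integrable_data (h : IsTwistedFlow θ k N R T M μ₀ v) (hT : 0 ≤ T) : Integrable μ₀ := by
  refine (h.integrable_flow 0).congr ?_
  filter_upwards [h.duhamel 0 ⟨le_rfl, hT⟩] with η hη
  simpa [osc_zero] using hη

lemma integrable_prod_velocity (h : IsTwistedFlow θ k N R T M μ₀ v) (s : ℝ) :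
    Integrable (Function.uncurry fun r η => velocity θ k (v r) η)
      ((volume.restrict (Set.Ioc 0 s)).prod volume) := by
  refine ⟨h.measurable_velocity_uncurry.aestronglyMeasurable, ?_⟩
  rw [HasFiniteIntegral, lintegral_prod _ h.measurable_velocity_uncurry.enorm.aemeasurable]
  calc _ ≤ ∫⁻ _ in Set.Ioc 0 s, (M + ENNReal.ofReal R * M) :=
        lintegral_mono fun r => h.lintegral_velocity_le r
    _ < ⊤ := by
        rw [setLIntegral_const]
        exact ENNReal.mul_lt_top h.velocity_bound_ne_top.lt_top (by simp)

lemma force_eq_add_integral (h : IsTwistedFlow θ k N R T M μ₀ v) {s : ℝ} (hs : s ∈ Set.Icc 0 T)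
    (ξ : ℝ) : kconv k (v s) ξ = kconv k μ₀ ξ +
      ∫ r in (0:ℝ)..s, kconv k (velocity θ k (v r)) ξ := by
  have hμ := h.integrable_data (hs.1.trans hs.2)
  have hkm : Measurable fun z : ℝ × ℝ => k (ξ - z.2) :=
    h.measurable_kernel.comp (measurable_const.sub measurable_snd)
  have hprod_int : Integrable (Function.uncurry fun r η => k (ξ - η) * velocity θ k (v r) η)
      ((volume.restrict (Set.Ioc 0 s)).prod volume) :=
    (h.integrable_prod_velocity s).bdd_mul hkm.aestronglyMeasurable
      (Filter.Eventually.of_forall fun z => h.norm_kernel_le _)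
  have hprod_int' : Integrable fun η => k (ξ - η) * ∫ r in (0:ℝ)..s, velocity θ k (v r) η := by
    have := hprod_int.swap.integral_prod_left
    refine this.congr (Filter.Eventually.of_forall fun η => ?_)
    simp only [Function.comp, Function.uncurry, Prod.swap, integral_const_mul,
      intervalIntegral.integral_of_le hs.1]
  calc kconv k (v s) ξ
      = ∫ η, (k (ξ - η) * μ₀ η + k (ξ - η) * ∫ r in (0:ℝ)..s, velocity θ k (v r) η) := by
        refine integral_congr_ae ?_
        filter_upwards [h.flow_eq_add_integral hs] with η hη
        rw [hη, mul_add]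
    _ = kconv k μ₀ ξ + ∫ η, k (ξ - η) * ∫ r in (0:ℝ)..s, velocity θ k (v r) η :=
        integral_add (integrable_kconv_integrand h.measurable_kernel h.norm_kernel_le hμ ξ) hprod_int'
    _ = _ := by
        congr 1
        simp_rw [intervalIntegral.integral_of_le hs.1, kconv, ← integral_const_mul]
        exact (integral_integral_swap hprod_int).symm

lemma osc_mul_velocity_eq (h : IsTwistedFlow θ k N R T M μ₀ v) {s : ℝ} (hs : s ∈ Set.Icc 0 T) :
    ∀ᵐ η : ℝ, osc (s * θ η) * velocity θ k (v s) η = velocity θ k μ₀ η +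
      ∫ r in (0:ℝ)..s, osc (r * θ η) * kconv k (velocity θ k (v r)) η := by
  filter_upwards [h.duhamel s hs] with η h1
  have hF := h.intervalIntegrable_accel η 0 s
  have hf := h.intervalIntegrable_force η 0 s
  have h2 := osc_mul_primitive hs.1 hF (θ η) (kconv k μ₀ η)
  rw [← h.force_eq_add_integral hs] at h2
  have h3 : ∫ r in (0:ℝ)..s, (Complex.I * θ η * (osc (r * θ η) * (kconv k μ₀ η +
      ∫ q in (0:ℝ)..r, kconv k (velocity θ k (v q)) η)) +
        osc (r * θ η) * kconv k (velocity θ k (v r)) η) =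
      Complex.I * θ η * (∫ r in (0:ℝ)..s, osc (r * θ η) * kconv k (v r) η) +
      ∫ r in (0:ℝ)..s, osc (r * θ η) * kconv k (velocity θ k (v r)) η := by
    rw [← intervalIntegral.integral_const_mul,
      ← intervalIntegral.integral_add ((hf.osc_mul _).const_mul _) (hF.osc_mul _)]
    refine intervalIntegral.integral_congr fun r hr => ?_
    rw [Set.uIcc_of_le hs.1] at hr
    rw [← h.force_eq_add_integral ⟨hr.1, hr.2.trans hs.2⟩]
  rw [h3] at h2
  unfold velocity at h2 ⊢
  rw [mul_add, mul_left_comm, h1, h2]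
  ring

end IsTwistedFlow

lemma lintegral_exp_Ioc {R K s : ℝ} (hR : 0 ≤ R) (hK : 0 ≤ K) (hs : 0 ≤ s) :
    ENNReal.ofReal R * ∫⁻ r in Set.Ioc 0 s, ENNReal.ofReal (Real.exp (2 * R * r) * (2 * K)) =
      ENNReal.ofReal ((Real.exp (2 * R * s) - 1) * K) := by
  have hc : Continuous fun r : ℝ => Real.exp (2 * R * r) * (2 * (R * K)) := by fun_prop
  rw [← lintegral_const_mul' _ _ ENNReal.ofReal_ne_top]
  calc _ = ∫⁻ r in Set.Ioc 0 s, ENNReal.ofReal (Real.exp (2 * R * r) * (2 * (R * K))) := by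
        refine lintegral_congr fun r => ?_
        rw [← ENNReal.ofReal_mul hR]
        ring_nf
    _ = ENNReal.ofReal (∫ r in (0:ℝ)..s, Real.exp (2 * R * r) * (2 * (R * K))) := by
        rw [intervalIntegral.integral_of_le hs, ofReal_integral_eq_lintegral_ofReal
          ((intervalIntegrable_iff_integrableOn_Ioc_of_le hs).1 (hc.intervalIntegrable 0 s))
          (Filter.Eventually.of_forall fun r => by positivity)]
    _ = _ := by
        have hd : ∀ r ∈ Set.uIcc 0 s, HasDerivAt (fun r => Real.exp (2 * R * r) * K)
            (Real.exp (2 * R * r) * (2 * (R * K))) r := fun r _ =>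
          (((hasDerivAt_id' r).const_mul (2 * R)).exp.mul_const K).congr_deriv (by ring)
        rw [intervalIntegral.integral_eq_sub_of_hasDerivAt hd (hc.intervalIntegrable 0 s)]
        simp only [mul_zero, Real.exp_zero]
        ring_nf

/-- Gronwall's inequality for a bounded function, without continuity. -/
lemma le_exp_of_le_lintegral {φ : ℝ → ℝ≥0∞} {R c m T : ℝ} (hR : 0 ≤ R) (hc : 0 ≤ c) (hm : 0 ≤ m)
    (hφ : ∀ s, φ s ≤ ENNReal.ofReal m)
    (h : ∀ s ∈ Set.Icc 0 T, φ s ≤ ENNReal.ofReal c + ENNReal.ofReal R * ∫⁻ r in Set.Ioc 0 s, φ r)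
    {s : ℝ} (hs : s ∈ Set.Icc 0 T) : φ s ≤ ENNReal.ofReal (Real.exp (2 * R * s) * (2 * c)) := by
  have key : ∀ n : ℕ, ∀ s ∈ Set.Icc 0 T,
      φ s ≤ ENNReal.ofReal (Real.exp (2 * R * s) * (2 * (c + m * (1 / 2) ^ n))) := by
    intro n
    induction n with
    | zero =>
      intro s hs
      have h1 : 1 ≤ Real.exp (2 * R * s) := Real.one_le_exp (by have := hs.1; positivity)
      refine (hφ s).trans (ENNReal.ofReal_le_ofReal ?_)
      rw [pow_zero]
      nlinarith
    | succ n ih =>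
      intro s hs
      have h1 : 1 ≤ Real.exp (2 * R * s) := Real.one_le_exp (by have := hs.1; positivity)
      have hK : 0 ≤ c + m * (1 / 2) ^ n := by positivity
      calc φ s ≤ ENNReal.ofReal c + ENNReal.ofReal R * ∫⁻ r in Set.Ioc 0 s,
            ENNReal.ofReal (Real.exp (2 * R * r) * (2 * (c + m * (1 / 2) ^ n))) := by
            refine (h s hs).trans ?_
            refine add_le_add_right (mul_le_mul_right ?_ _) _
            exact setLIntegral_mono' measurableSet_Ioc
              fun r hr => ih r ⟨hr.1.le, hr.2.trans hs.2⟩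
        _ ≤ _ := by
            rw [lintegral_exp_Ioc hR hK hs.1, ← ENNReal.ofReal_add hc
              (mul_nonneg (by linarith) hK)]
            refine ENNReal.ofReal_le_ofReal ?_
            have : 0 ≤ m * (1 / 2 : ℝ) ^ n := by positivity
            rw [pow_succ]
            nlinarith
  have hlim : Filter.Tendsto (fun n : ℕ => ENNReal.ofReal
      (Real.exp (2 * R * s) * (2 * (c + m * (1 / 2) ^ n)))) Filter.atTop
      (nhds (ENNReal.ofReal (Real.exp (2 * R * s) * (2 * (c + m * 0))))) :=
    ENNReal.tendsto_ofReal ((((tendsto_pow_atTop_nhds_zero_of_lt_one (by norm_num)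
      (by norm_num)).const_mul m).const_add c).const_mul 2 |>.const_mul _)
  rw [mul_zero, add_zero] at hlim
  exact ge_of_tendsto' hlim fun n => key n s hs

/-- Discrete Gronwall inequality. -/
lemma le_mul_pow_of_le_sum {a : ℕ → ℝ≥0∞} {S x : ℝ≥0∞} {m : ℕ}
    (h : ∀ n ≤ m, a n ≤ S + x * ∑ j ∈ Finset.range n, a j) {n : ℕ} (hn : n ≤ m) :
    a n ≤ S * (1 + x) ^ n := by
  have hsum : ∀ n ≤ m, S + x * ∑ j ∈ Finset.range n, a j ≤ S * (1 + x) ^ n := by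
    intro n
    induction n with
    | zero => simp
    | succ n ih =>
      intro hn
      have hn' : n ≤ m := by omega
      calc _ = (S + x * ∑ j ∈ Finset.range n, a j) + x * a n := by
            rw [Finset.sum_range_succ]; ring
        _ ≤ S * (1 + x) ^ n + x * (S * (1 + x) ^ n) := by
            gcongr
            exacts [ih hn', (h n hn').trans (ih hn')]
        _ = _ := by ring
  exact (h n hn).trans (hsum n hn)

namespace IsTwistedFlow

variable {θ : ℝ → ℝ} {k : ℝ → ℂ} {N R T : ℝ} {M : ℝ≥0∞} {μ₀ : ℝ → ℂ} {v : ℝ → ℝ → ℂ}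

lemma ae_ae_osc_mul_velocity_eq (h : IsTwistedFlow θ k N R T M μ₀ v) :
    ∀ᵐ η : ℝ, ∀ᵐ r : ℝ, r ∈ Set.Icc 0 T → osc (r * θ η) * velocity θ k (v r) η =
      velocity θ k μ₀ η + ∫ q in (0:ℝ)..r, osc (q * θ η) * kconv k (velocity θ k (v q)) η :=
  ae_ae_eq_of_forall_ae_eq
    ((measurable_osc_phase h.measurable_phase).mul h.measurable_velocity_uncurry)
    (((measurable_velocity_right h.measurable_phase h.measurable_kernel
      h.measurable_data).comp measurable_snd).add (measurable_primitive
      (g := fun q η => osc (q * θ η) * kconv k (velocity θ k (v q)) η)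
      ((measurable_osc_phase h.measurable_phase).mul h.measurable_accel) 0))
    fun _ => h.osc_mul_velocity_eq

lemma lintegral_velocity_le_exp (h : IsTwistedFlow θ k N R T M μ₀ v) {c : ℝ} (hc : 0 ≤ c)
    (h0 : ∫⁻ η, ‖velocity θ k μ₀ η‖ₑ ≤ ENNReal.ofReal c) {s : ℝ} (hs : s ∈ Set.Icc 0 T) :
    ∫⁻ η, ‖velocity θ k (v s) η‖ₑ ≤ ENNReal.ofReal (Real.exp (2 * R * s) * (2 * c)) := by
  have hB := h.velocity_bound_ne_top
  refine le_exp_of_le_lintegral (φ := fun s => ∫⁻ η, ‖velocity θ k (v s) η‖ₑ)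
    h.mass_nonneg hc ENNReal.toReal_nonneg
    (fun s => (h.lintegral_velocity_le s).trans (ENNReal.ofReal_toReal hB).ge) ?_ hs
  intro s hs
  have hm := measurable_velocity_right h.measurable_phase h.measurable_kernel h.measurable_data
  calc ∫⁻ η, ‖velocity θ k (v s) η‖ₑ
      ≤ ∫⁻ η, (‖velocity θ k μ₀ η‖ₑ +
          ∫⁻ r in Set.Ioc 0 s, ‖kconv k (velocity θ k (v r)) η‖ₑ) := by
        refine lintegral_mono_ae ?_
        filter_upwards [h.osc_mul_velocity_eq hs] with η hη
        calc ‖velocity θ k (v s) η‖ₑ = ‖osc (s * θ η) * velocity θ k (v s) η‖ₑ := by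
              rw [enorm_mul, enorm_osc, one_mul]
          _ ≤ _ := by
              rw [hη, intervalIntegral.integral_of_le hs.1]
              refine (enorm_add_le _ _).trans ?_
              gcongr
              refine (enorm_integral_le_lintegral_enorm _).trans_eq ?_
              simp_rw [enorm_mul, enorm_osc, one_mul]
    _ = (∫⁻ η, ‖velocity θ k μ₀ η‖ₑ) +
          ∫⁻ r in Set.Ioc 0 s, ∫⁻ η, ‖kconv k (velocity θ k (v r)) η‖ₑ := by
        rw [lintegral_add_left hm.enorm, lintegral_lintegral_swap]
        exact (h.measurable_accel.comp measurable_swap).enorm.aemeasurable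
    _ ≤ _ := by
        rw [← lintegral_const_mul' _ _ ENNReal.ofReal_ne_top]
        gcongr with r
        exact h.lintegral_kconv_le_mul (h.measurable_velocity_at r)

end IsTwistedFlow

/-- The accumulated local errors of the exponential integrator up to time `t`. -/
noncomputable def accumulatedDefect (θ : ℝ → ℝ) (k : ℝ → ℂ) (v : ℝ → ℝ → ℂ) (τ t ξ : ℝ) : ℂ :=
  ∫ r in (0:ℝ)..t, stepPhase τ r (θ ξ) * kconv k (velocity θ k (v r)) ξ

namespace IsTwistedFlow

variable {θ : ℝ → ℝ} {k : ℝ → ℂ} {N R T : ℝ} {M : ℝ≥0∞} {μ₀ : ℝ → ℂ} {v : ℝ → ℝ → ℂ}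

lemma norm_bound_nonneg (h : IsTwistedFlow θ k N R T M μ₀ v) : 0 ≤ N :=
  (norm_nonneg _).trans (h.norm_kernel_le 0)

lemma integral_stepPhase_mul_velocity (h : IsTwistedFlow θ k N R T M μ₀ v) {τ : ℝ} (hτ : 0 < τ)
    {t : ℝ} (ht : t ∈ Set.Icc 0 T) : ∀ᵐ η : ℝ, ∀ a : ℝ,
      ∫ r in (0:ℝ)..t, stepPhase τ r a * velocity θ k (v r) η =
        velocity θ k μ₀ η * errKernel τ 0 t a (θ η) + ∫ q in (0:ℝ)..t,
          errKernel τ q t a (θ η) * (osc (q * θ η) * kconv k (velocity θ k (v q)) η) := by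
  filter_upwards [h.ae_ae_osc_mul_velocity_eq] with η hη a
  have ho := intervalIntegrable_errKernel hτ a (θ η) 0 t
  have hg := (h.intervalIntegrable_accel η 0 t).osc_mul (θ η)
  have hprim : ContinuousOn (fun r => ∫ q in (0:ℝ)..r,
      osc (q * θ η) * kconv k (velocity θ k (v q)) η) (Set.uIcc 0 t) :=
    intervalIntegral.continuousOn_primitive_interval (by rwa [← intervalIntegrable_iff'])
  unfold errKernel
  rw [← integral_mul_integral_triangle ht.1 ho hg, ← intervalIntegral.integral_const_mul,
    ← intervalIntegral.integral_add (ho.const_mul _) (ho.mul_continuousOn hprim)]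
  refine intervalIntegral.integral_congr_ae ?_
  filter_upwards [hη] with r hr hrt
  rw [Set.uIoc_of_le ht.1] at hrt
  have h1 := hr ⟨hrt.1.le, hrt.2.trans ht.2⟩
  have h2 : velocity θ k (v r) η = osc (-(r * θ η)) * (osc (r * θ η) * velocity θ k (v r) η) := by
    rw [← mul_assoc, osc_neg_mul_self, one_mul]
  rw [h2, h1]
  ring

lemma enorm_integral_stepPhase_mul_velocity_le (h : IsTwistedFlow θ k N R T M μ₀ v) {τ : ℝ}
    (hτ : 0 < τ) (hτ1 : τ ≤ 1) {U : ℝ} (hU : 0 ≤ U)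
    (hvel : ∀ s ∈ Set.Icc 0 T, ∫⁻ η, ‖velocity θ k (v s) η‖ₑ ≤ ENNReal.ofReal U)
    {t : ℝ} (ht : t ∈ Set.Icc 0 T) : ∀ᵐ η : ℝ, ∀ a : ℝ,
      ‖∫ r in (0:ℝ)..t, stepPhase τ r a * velocity θ k (v r) η‖ₑ ≤
        ENNReal.ofReal (36 * (T + 8) * τ) * (ENNReal.ofReal (kernelBound τ a (θ η)) *
          (‖velocity θ k μ₀ η‖ₑ + ENNReal.ofReal (T * (N * U)))) := by
  filter_upwards [h.integral_stepPhase_mul_velocity hτ ht] with η hη a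
  set G := ENNReal.ofReal (36 * (T + 8) * τ) * ENNReal.ofReal (kernelBound τ a (θ η)) with hG
  have h1 : ‖∫ q in (0:ℝ)..t, errKernel τ q t a (θ η) *
      (osc (q * θ η) * kconv k (velocity θ k (v q)) η)‖ₑ ≤
      ∫⁻ _ in Set.Ioc 0 t, G * ENNReal.ofReal (N * U) := by
    rw [intervalIntegral.integral_of_le ht.1]
    refine (enorm_integral_le_lintegral_enorm _).trans
      (setLIntegral_mono' measurableSet_Ioc fun q hq => ?_)
    rw [enorm_mul, enorm_mul, enorm_osc, one_mul, ENNReal.ofReal_mul h.norm_bound_nonneg]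
    gcongr
    · exact enorm_errKernel_le hτ hτ1 hq.1.le hq.2 ht.2 _ _
    · exact (enorm_kconv_le h.norm_kernel_le _ η).trans
        (mul_le_mul_right (hvel q ⟨hq.1.le, hq.2.trans ht.2⟩) _)
  rw [hη a]
  calc _ ≤ ‖velocity θ k μ₀ η‖ₑ * G + G * ENNReal.ofReal (T * (N * U)) := by
        refine (enorm_add_le _ _).trans ?_
        rw [enorm_mul]
        gcongr
        · exact enorm_errKernel_le hτ hτ1 le_rfl ht.1 ht.2 _ _
        · refine h1.trans ?_
          rw [setLIntegral_const, Real.volume_Ioc, sub_zero, mul_assoc,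
            ← ENNReal.ofReal_mul (mul_nonneg h.norm_bound_nonneg hU), mul_comm (N * U)]
          gcongr
          · exact mul_nonneg h.norm_bound_nonneg hU
          · exact ht.2
    _ = _ := by rw [hG]; ring

lemma accumulatedDefect_eq (h : IsTwistedFlow θ k N R T M μ₀ v) {τ : ℝ} (hτ : 0 < τ)
    {t : ℝ} (ht : 0 ≤ t) (ξ : ℝ) : accumulatedDefect θ k v τ t ξ =
      kconv k (fun η => ∫ r in (0:ℝ)..t, stepPhase τ r (θ ξ) * velocity θ k (v r) η) ξ := by
  have hm : Measurable fun z : ℝ × ℝ => stepPhase τ z.1 (θ ξ) * k (ξ - z.2) :=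
    ((measurable_stepPhase τ).comp (measurable_fst.prodMk measurable_const)).mul
      (h.measurable_kernel.comp (measurable_const.sub measurable_snd))
  have hprod_int : Integrable (Function.uncurry fun r η =>
      stepPhase τ r (θ ξ) * k (ξ - η) * velocity θ k (v r) η)
      ((volume.restrict (Set.Ioc 0 t)).prod volume) :=
    (h.integrable_prod_velocity t).bdd_mul (c := τ * N) hm.aestronglyMeasurable
      (Filter.Eventually.of_forall fun z => by
        rw [norm_mul]
        exact mul_le_mul (norm_stepPhase_le hτ _ _) (h.norm_kernel_le _) (norm_nonneg _) hτ.le)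
  unfold accumulatedDefect kconv
  simp_rw [intervalIntegral.integral_of_le ht, ← integral_const_mul]
  refine Eq.trans ?_ ((integral_integral_swap hprod_int).trans ?_)
  · simp_rw [mul_assoc]
  · refine integral_congr_ae (Filter.Eventually.of_forall fun η => ?_)
    refine integral_congr_ae (Filter.Eventually.of_forall fun r => ?_)
    dsimp only
    ring

lemma enorm_accumulatedDefect_le (h : IsTwistedFlow θ k N R T M μ₀ v) {τ : ℝ}
    (hτ : 0 < τ) (hτ1 : τ ≤ 1) {U : ℝ} (hU : 0 ≤ U)
    (hvel : ∀ s ∈ Set.Icc 0 T, ∫⁻ η, ‖velocity θ k (v s) η‖ₑ ≤ ENNReal.ofReal U)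
    {t : ℝ} (ht : t ∈ Set.Icc 0 T) (ξ : ℝ) :
    ‖accumulatedDefect θ k v τ t ξ‖ₑ ≤ ENNReal.ofReal N * (ENNReal.ofReal (36 * (T + 8) * τ) *
      ∫⁻ η, ENNReal.ofReal (kernelBound τ (θ ξ) (θ η)) *
        (‖velocity θ k μ₀ η‖ₑ + ENNReal.ofReal (T * (N * U)))) := by
  rw [h.accumulatedDefect_eq hτ ht.1]
  refine (enorm_kconv_le h.norm_kernel_le _ ξ).trans ?_
  gcongr
  rw [← lintegral_const_mul' _ _ ENNReal.ofReal_ne_top]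
  refine lintegral_mono_ae ?_
  filter_upwards [h.enorm_integral_stepPhase_mul_velocity_le hτ hτ1 hU hvel ht] with η hη
  exact hη (θ ξ)

/-- The accumulated local errors are controlled by the diagonal and off-diagonal masses of the
kernel bound. -/
lemma lintegral_accumulatedDefect_le (h : IsTwistedFlow θ k N R T M μ₀ v) {τ : ℝ}
    (hτ : 0 < τ) (hτ1 : τ ≤ 1) {U A D : ℝ} (hU : 0 ≤ U)
    (hvel : ∀ s ∈ Set.Icc 0 T, ∫⁻ η, ‖velocity θ k (v s) η‖ₑ ≤ ENNReal.ofReal U)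
    (hA : ∀ b, ∫⁻ ξ, ENNReal.ofReal (kernelBound τ (θ ξ) b) ≤ ENNReal.ofReal A)
    (hD : ∫⁻ ξ, ∫⁻ η, ENNReal.ofReal (kernelBound τ (θ ξ) (θ η)) ≤ ENNReal.ofReal D)
    {t : ℝ} (ht : t ∈ Set.Icc 0 T) :
    ∫⁻ ξ, ‖accumulatedDefect θ k v τ t ξ‖ₑ ≤
      ENNReal.ofReal N * (ENNReal.ofReal (36 * (T + 8) * τ) *
        (ENNReal.ofReal A * (∫⁻ η, ‖(θ η : ℂ) * μ₀ η‖ₑ) + ENNReal.ofReal D *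
          (ENNReal.ofReal N * (∫⁻ η, ‖μ₀ η‖ₑ) + ENNReal.ofReal (T * (N * U))))) := by
  set V := ENNReal.ofReal N * (∫⁻ η, ‖μ₀ η‖ₑ) + ENNReal.ofReal (T * (N * U)) with hV
  have hK : Measurable fun z : ℝ × ℝ => ENNReal.ofReal (kernelBound τ (θ z.1) (θ z.2)) :=
    ((measurable_kernelBound τ).comp ((h.measurable_phase.comp measurable_fst).prodMk
      (h.measurable_phase.comp measurable_snd))).ennreal_ofReal
  have hθμ : Measurable fun η => ‖(θ η : ℂ) * μ₀ η‖ₑ :=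
    ((Complex.measurable_ofReal.comp h.measurable_phase).mul h.measurable_data).enorm
  have hf : Measurable fun z : ℝ × ℝ =>
      ENNReal.ofReal (kernelBound τ (θ z.1) (θ z.2)) * ‖(θ z.2 : ℂ) * μ₀ z.2‖ₑ :=
    hK.mul (hθμ.comp measurable_snd)
  calc _ ≤ ∫⁻ ξ, ENNReal.ofReal N * (ENNReal.ofReal (36 * (T + 8) * τ) *
        ((∫⁻ η, ENNReal.ofReal (kernelBound τ (θ ξ) (θ η)) * ‖(θ η : ℂ) * μ₀ η‖ₑ) +
          (∫⁻ η, ENNReal.ofReal (kernelBound τ (θ ξ) (θ η))) * V)) := by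
        refine lintegral_mono fun ξ =>
          (h.enorm_accumulatedDefect_le hτ hτ1 hU hvel ht ξ).trans ?_
        have hKξ : Measurable fun η => ENNReal.ofReal (kernelBound τ (θ ξ) (θ η)) :=
          hK.comp measurable_prodMk_left
        gcongr
        rw [← lintegral_mul_const _ hKξ, ← lintegral_add_right _ (hKξ.mul_const _)]
        refine lintegral_mono fun η => ?_
        rw [← mul_add, hV, ← add_assoc]
        gcongr
        exact (enorm_velocity_le θ k μ₀ η).trans
          (add_le_add_right (enorm_kconv_le h.norm_kernel_le μ₀ η) _)
    _ = ENNReal.ofReal N * (ENNReal.ofReal (36 * (T + 8) * τ) *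
        ((∫⁻ η, (∫⁻ ξ, ENNReal.ofReal (kernelBound τ (θ ξ) (θ η))) * ‖(θ η : ℂ) * μ₀ η‖ₑ) +
          (∫⁻ ξ, ∫⁻ η, ENNReal.ofReal (kernelBound τ (θ ξ) (θ η))) * V)) := by
        rw [lintegral_const_mul' _ _ ENNReal.ofReal_ne_top,
          lintegral_const_mul' _ _ ENNReal.ofReal_ne_top,
          lintegral_add_left hf.lintegral_prod_right',
          lintegral_mul_const _ hK.lintegral_prod_right',
          lintegral_lintegral_swap hf.aemeasurable]
        congr! 4
        funext η
        have hKη : Measurable fun ξ => ENNReal.ofReal (kernelBound τ (θ ξ) (θ η)) :=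
          hK.comp measurable_prodMk_right
        dsimp only
        rw [lintegral_mul_const _ hKη]
    _ ≤ _ := by
        gcongr
        rw [← lintegral_const_mul _ hθμ]
        gcongr with η
        exact hA (θ η)

end IsTwistedFlow

/-- The first-order exponential integrator for the flow with phase speed `θ` and kernel `k`. -/
noncomputable def expIter (θ : ℝ → ℝ) (k μ₀ : ℝ → ℂ) (τ : ℝ) : ℕ → ℝ → ℂ
  | 0 => μ₀
  | n + 1 => fun ξ => expIter θ k μ₀ τ n ξ +
      (∫ s in ((n : ℝ) * τ)..(((n : ℝ) + 1) * τ), osc (s * θ ξ)) *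
        kconv k (fun η => osc (-(n * τ * θ η)) * expIter θ k μ₀ τ n η) ξ

lemma measurable_integral_osc {θ : ℝ → ℝ} (hθ : Measurable θ) (a b : ℝ) :
    Measurable fun ξ => ∫ s in a..b, osc (s * θ ξ) :=
  (measurable_primitive (g := fun s ξ => osc (s * θ ξ)) (measurable_osc_phase hθ) a).comp
    measurable_prodMk_left

lemma measurable_osc_neg_mul {θ : ℝ → ℝ} (hθ : Measurable θ) (t : ℝ) :
    Measurable fun ξ => osc (-(t * θ ξ)) :=
  measurable_osc.comp (hθ.const_mul t).neg

lemma enorm_integral_osc_le {τ : ℝ} (hτ : 0 < τ) (n : ℕ) (c : ℝ) :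
    ‖∫ s in ((n : ℝ) * τ)..(((n : ℝ) + 1) * τ), osc (s * c)‖ₑ ≤ ENNReal.ofReal τ := by
  rw [← ofReal_norm]
  refine ENNReal.ofReal_le_ofReal ((norm_integral_osc_le c _ _).trans_eq ?_)
  rw [show (n + 1) * τ - n * τ = τ by ring, abs_of_pos hτ]

lemma measurable_step {θ : ℝ → ℝ} {k g : ℝ → ℂ} (hθ : Measurable θ) (hk : Measurable k)
    (hg : Measurable g) (τ : ℝ) (n : ℕ) :
    Measurable fun ξ => (∫ s in ((n : ℝ) * τ)..(((n : ℝ) + 1) * τ), osc (s * θ ξ)) *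
      kconv k (fun η => osc (-(n * τ * θ η)) * g η) ξ :=
  (measurable_integral_osc hθ _ _).mul
    (measurable_kconv_right hk ((measurable_osc_neg_mul hθ _).mul hg))

/-- One exponential integrator step, applied to `g`, changes the `L¹` norm by at most `τR`. -/
lemma lintegral_step_le {θ : ℝ → ℝ} {k g : ℝ → ℂ} {R : ℝ} (hk : Measurable k)
    (hkR : ∫⁻ x, ‖k x‖ₑ ≤ ENNReal.ofReal R) (hθ : Measurable θ) (hg : Measurable g) {τ : ℝ} (hτ : 0 < τ) (n : ℕ) :
    ∫⁻ ξ, ‖(∫ s in ((n : ℝ) * τ)..(((n : ℝ) + 1) * τ), osc (s * θ ξ)) *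
        kconv k (fun η => osc (-(n * τ * θ η)) * g η) ξ‖ₑ ≤
      ENNReal.ofReal (τ * R) * ∫⁻ η, ‖g η‖ₑ := by
  have hm : Measurable fun η => osc (-(n * τ * θ η)) * g η :=
    (measurable_osc_neg_mul hθ (n * τ)).mul hg
  calc _ ≤ ∫⁻ ξ, ENNReal.ofReal τ * ‖kconv k (fun η => osc (-(n * τ * θ η)) * g η) ξ‖ₑ := by
        refine lintegral_mono fun ξ => ?_
        rw [enorm_mul]
        gcongr
        exact enorm_integral_osc_le hτ n _
    _ ≤ ENNReal.ofReal τ * (ENNReal.ofReal R * ∫⁻ η, ‖g η‖ₑ) := by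
        rw [lintegral_const_mul' _ _ ENNReal.ofReal_ne_top]
        gcongr
        refine (lintegral_enorm_kconv_le hk hm).trans ?_
        simp_rw [enorm_mul, enorm_osc, one_mul]
        gcongr
    _ = _ := by rw [ENNReal.ofReal_mul hτ.le, mul_assoc]

lemma measurable_expIter {θ : ℝ → ℝ} {k μ₀ : ℝ → ℂ} (hθ : Measurable θ) (hk : Measurable k)
    (hμ : Measurable μ₀) (τ : ℝ) (n : ℕ) : Measurable (expIter θ k μ₀ τ n) := by
  induction n with
  | zero => exact hμ
  | succ n ih => exact ih.add (measurable_step hθ hk ih τ n)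

namespace IsTwistedFlow

variable {θ : ℝ → ℝ} {k : ℝ → ℂ} {N R T : ℝ} {M : ℝ≥0∞} {μ₀ : ℝ → ℂ} {v : ℝ → ℝ → ℂ}

lemma measurable_expIter (h : IsTwistedFlow θ k N R T M μ₀ v) (τ : ℝ) (n : ℕ) :
    Measurable (expIter θ k μ₀ τ n) :=
  _root_.measurable_expIter h.measurable_phase h.measurable_kernel h.measurable_data τ n

lemma integrable_expIter (h : IsTwistedFlow θ k N R T M μ₀ v) (hT : 0 ≤ T) {τ : ℝ} (hτ : 0 < τ)
    (n : ℕ) : Integrable (expIter θ k μ₀ τ n) := by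
  induction n with
  | zero => exact h.integrable_data hT
  | succ n ih =>
    have hm := measurable_step h.measurable_phase h.measurable_kernel (h.measurable_expIter τ n) τ n
    refine ih.add ⟨hm.aestronglyMeasurable, ?_⟩
    exact (lintegral_step_le h.measurable_kernel h.lintegral_kernel_le
      h.measurable_phase (h.measurable_expIter τ n) hτ n).trans_lt
      (ENNReal.mul_lt_top ENNReal.ofReal_lt_top ih.2)

lemma measurable_accumulatedDefect (h : IsTwistedFlow θ k N R T M μ₀ v) (τ t : ℝ) :
    Measurable (accumulatedDefect θ k v τ t) := by
  have hm : Measurable (Function.uncurry fun r ξ =>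
      stepPhase τ r (θ ξ) * kconv k (velocity θ k (v r)) ξ) :=
    ((measurable_stepPhase τ).comp (measurable_fst.prodMk
      (h.measurable_phase.comp measurable_snd))).mul h.measurable_accel
  have := (measurable_primitive hm 0).comp (measurable_prodMk_left (x := t))
  exact this

lemma intervalIntegrable_stepPhase_mul_accel (h : IsTwistedFlow θ k N R T M μ₀ v) {τ : ℝ}
    (hτ : 0 < τ) (ξ a b : ℝ) : IntervalIntegrable
      (fun r => stepPhase τ r (θ ξ) * kconv k (velocity θ k (v r)) ξ) volume a b :=
  have hm : Measurable fun r => stepPhase τ r (θ ξ) :=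
    (measurable_stepPhase τ).comp (measurable_id.prodMk measurable_const)
  have hb := fun r => norm_stepPhase_le hτ r (θ ξ)
  ⟨(h.intervalIntegrable_accel ξ a b).1.bdd_mul hm.aestronglyMeasurable (.of_forall hb),
    (h.intervalIntegrable_accel ξ a b).2.bdd_mul hm.aestronglyMeasurable (.of_forall hb)⟩

/-- The increment of the accumulated defect over one step is the local error of that step. -/
lemma accumulatedDefect_succ (h : IsTwistedFlow θ k N R T M μ₀ v) {τ : ℝ} (hτ : 0 < τ) {n : ℕ}
    (hn : (n + 1) * τ ≤ T) (ξ : ℝ) :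
    accumulatedDefect θ k v τ ((n + 1) * τ) ξ = accumulatedDefect θ k v τ (n * τ) ξ +
      ∫ s in (n * τ)..((n + 1) * τ), osc (s * θ ξ) * (kconv k (v s) ξ - kconv k (v (n * τ)) ξ) := by
  have h0 : 0 ≤ n * τ := by positivity
  have h1 : n * τ ≤ (n + 1) * τ := by nlinarith
  have hF := h.intervalIntegrable_accel ξ
  unfold accumulatedDefect
  rw [← intervalIntegral.integral_add_adjacent_intervals
    (h.intervalIntegrable_stepPhase_mul_accel hτ ξ 0 (n * τ))
    (h.intervalIntegrable_stepPhase_mul_accel hτ ξ (n * τ) ((n + 1) * τ))]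
  congr 1
  calc _ = ∫ r in (n * τ)..((n + 1) * τ),
        (∫ s in r..((n + 1) * τ), osc (s * θ ξ)) * kconv k (velocity θ k (v r)) ξ := by
        refine intervalIntegral.integral_congr_ae ?_
        filter_upwards [compl_mem_ae_iff.2 (measure_singleton ((n + 1) * τ))] with r hr hrn
        rw [Set.uIoc_of_le h1] at hrn
        rw [stepPhase, nextGrid_of_mem hτ n hrn.1.le (lt_of_le_of_ne hrn.2 hr)]
    _ = ∫ s in (n * τ)..((n + 1) * τ), osc (s * θ ξ) *
        ∫ r in (n * τ)..s, kconv k (velocity θ k (v r)) ξ :=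
        (integral_mul_integral_triangle h1 (intervalIntegrable_osc _ _ _) (hF _ _)).symm
    _ = _ := by
        refine intervalIntegral.integral_congr fun s hs => ?_
        rw [Set.uIcc_of_le h1] at hs
        rw [h.force_eq_add_integral ⟨h0.trans hs.1, hs.2.trans hn⟩,
          h.force_eq_add_integral ⟨h0, h1.trans hn⟩, add_sub_add_left_eq_sub,
          intervalIntegral.integral_interval_sub_left (hF _ _) (hF _ _)]

/-- The error of the integrator, net of the accumulated defect, evolves by the integrator itself. -/
lemma error_sub_defect_succ (h : IsTwistedFlow θ k N R T M μ₀ v) {τ : ℝ} (hτ : 0 < τ) {n : ℕ}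
    (hn : (n + 1) * τ ≤ T) : ∀ᵐ ξ : ℝ,
    osc ((n + 1) * τ * θ ξ) * v ((n + 1) * τ) ξ - expIter θ k μ₀ τ (n + 1) ξ -
        accumulatedDefect θ k v τ ((n + 1) * τ) ξ =
      (osc (n * τ * θ ξ) * v (n * τ) ξ - expIter θ k μ₀ τ n ξ -
        accumulatedDefect θ k v τ (n * τ) ξ) +
      (∫ s in ((n : ℝ) * τ)..(((n : ℝ) + 1) * τ), osc (s * θ ξ)) *
        kconv k (fun η => osc (-(n * τ * θ η)) *
          (osc (n * τ * θ η) * v (n * τ) η - expIter θ k μ₀ τ n η)) ξ := by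
  have h0 : 0 ≤ n * τ := by positivity
  have h1 : n * τ ≤ (n + 1) * τ := by nlinarith
  have hprod_int : Integrable fun η => osc (-(n * τ * θ η)) * expIter θ k μ₀ τ n η :=
    (h.integrable_expIter (h0.trans (h1.trans hn)) hτ n).bdd_mul (c := 1)
      (measurable_osc_neg_mul h.measurable_phase _).aestronglyMeasurable
      (Filter.Eventually.of_forall fun _ => (norm_osc _).le)
  filter_upwards [h.duhamel _ ⟨h0.trans h1, hn⟩, h.duhamel _ ⟨h0, h1.trans hn⟩] with ξ h2 h3
  have hf := fun a b => (h.intervalIntegrable_force ξ a b).osc_mul (θ ξ)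
  have hk : kconv k (fun η => osc (-(n * τ * θ η)) *
      (osc (n * τ * θ η) * v (n * τ) η - expIter θ k μ₀ τ n η)) ξ = kconv k (v (n * τ)) ξ -
      kconv k (fun η => osc (-(n * τ * θ η)) * expIter θ k μ₀ τ n η) ξ := by
    rw [← kconv_sub h.measurable_kernel h.norm_kernel_le (h.integrable_flow _) hprod_int]
    congr 1
    ext η
    rw [mul_sub, ← mul_assoc, osc_neg_mul_self, one_mul]
  rw [hk, h.accumulatedDefect_succ hτ hn, h2, h3, expIter,
    ← intervalIntegral.integral_add_adjacent_intervals (hf 0 (n * τ)) (hf (n * τ) ((n + 1) * τ))]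
  simp_rw [mul_sub]
  rw [intervalIntegral.integral_sub (hf _ _) ((intervalIntegrable_osc _ _ _).mul_const _),
    intervalIntegral.integral_mul_const]
  ring

/-- Stability: the global error is controlled by the accumulated defects. -/
lemma lintegral_error_le (h : IsTwistedFlow θ k N R T M μ₀ v) {τ : ℝ} (hτ : 0 < τ) {S : ℝ≥0∞}
    (hS : ∀ t ∈ Set.Icc 0 T, ∫⁻ ξ, ‖accumulatedDefect θ k v τ t ξ‖ₑ ≤ S) {n : ℕ}
    (hn : n * τ ≤ T) :
    ∫⁻ ξ, ‖osc (n * τ * θ ξ) * v (n * τ) ξ - expIter θ k μ₀ τ n ξ‖ₑ ≤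
      S * ENNReal.ofReal (Real.exp (R * T)) := by
  set e : ℕ → ℝ → ℂ := fun n ξ => osc (n * τ * θ ξ) * v (n * τ) ξ - expIter θ k μ₀ τ n ξ with he
  set W : ℕ → ℝ → ℂ := fun n => accumulatedDefect θ k v τ (n * τ) with hW
  have hx : 0 ≤ τ * R := mul_nonneg hτ.le h.mass_nonneg
  have hle : ∀ j ≤ n, j * τ ≤ T := fun j hj => le_trans (by gcongr) hn
  have hem : ∀ j, Measurable (e j) := fun j =>
    ((measurable_osc.comp (h.measurable_phase.const_mul _)).mul (h.measurable_flow_at _)).sub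
      (h.measurable_expIter τ j)
  have hnet : ∀ j ≤ n, ∫⁻ ξ, ‖e j ξ - W j ξ‖ₑ ≤
      ENNReal.ofReal (τ * R) * ∑ i ∈ Finset.range j, ∫⁻ ξ, ‖e i ξ‖ₑ := by
    intro j
    induction j with
    | zero =>
      intro hj
      have h0 : (0:ℝ) ∈ Set.Icc 0 T := ⟨le_rfl, by simpa using hle 0 hj⟩
      rw [Finset.sum_range_zero, mul_zero, nonpos_iff_eq_zero]
      refine (lintegral_congr_ae ?_).trans lintegral_zero
      filter_upwards [h.duhamel 0 h0] with ξ hξ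
      simpa [e, W, accumulatedDefect, expIter, osc_zero, sub_eq_zero] using hξ
    | succ j ih =>
      intro hj
      have hj' := hle (j + 1) hj
      push_cast at hj'
      have hm := measurable_step h.measurable_phase h.measurable_kernel (hem j) τ j
      calc _ ≤ ∫⁻ ξ, (‖e j ξ - W j ξ‖ₑ + ‖(∫ s in ((j : ℝ) * τ)..(((j : ℝ) + 1) * τ),
            osc (s * θ ξ)) * kconv k (fun η => osc (-(j * τ * θ η)) * e j η) ξ‖ₑ) := by
            refine lintegral_mono_ae ?_
            filter_upwards [h.error_sub_defect_succ hτ hj'] with ξ hξ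
            simp only [he, hW, Nat.cast_succ]
            rw [hξ]
            exact enorm_add_le _ _
        _ ≤ _ := by
            rw [lintegral_add_right _ hm.enorm, Finset.sum_range_succ, mul_add]
            exact add_le_add (ih (by omega)) (lintegral_step_le h.measurable_kernel
              h.lintegral_kernel_le h.measurable_phase (hem j) hτ j)
  have hrec : ∀ j ≤ n, ∫⁻ ξ, ‖e j ξ‖ₑ ≤
      S + ENNReal.ofReal (τ * R) * ∑ i ∈ Finset.range j, ∫⁻ ξ, ‖e i ξ‖ₑ := fun j hj => by
    calc _ ≤ ∫⁻ ξ, (‖W j ξ‖ₑ + ‖e j ξ - W j ξ‖ₑ) := lintegral_mono fun ξ => by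
          simpa using enorm_add_le (W j ξ) (e j ξ - W j ξ)
      _ ≤ _ := by
          rw [lintegral_add_left (h.measurable_accumulatedDefect τ (j * τ)).enorm]
          exact add_le_add (hS _ ⟨by positivity, hle j hj⟩) (hnet j hj)
  refine (le_mul_pow_of_le_sum hrec le_rfl).trans ?_
  gcongr
  rw [← ENNReal.ofReal_one, ← ENNReal.ofReal_add zero_le_one hx,
    ← ENNReal.ofReal_pow (by positivity)]
  refine ENNReal.ofReal_le_ofReal ?_
  calc (1 + τ * R) ^ n ≤ Real.exp (τ * R) ^ n := by
        gcongr
        linarith [Real.add_one_le_exp (τ * R)]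
    _ = Real.exp (R * (n * τ)) := by rw [← Real.exp_nat_mul]; ring_nf
    _ ≤ _ := by
        have := h.mass_nonneg
        gcongr

end IsTwistedFlow

lemma exists_abs_P_le (κ : ℕ) (d : ℕ → ℝ) :
    ∃ C : ℝ, 0 ≤ C ∧ ∀ y, |P κ d y| ≤ C * (1 + |y| ^ κ) := by
  set D := ∑ i ∈ Finset.range (κ + 1), |d i|
  have hD0 : 0 ≤ D := Finset.sum_nonneg fun i _ => abs_nonneg _
  have hD : ∀ i ≤ κ, |d i| ≤ D := fun i hi =>
    Finset.single_le_sum (f := fun i => |d i|) (fun i _ => abs_nonneg _)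
      (Finset.mem_range.2 (by omega))
  refine ⟨κ * D, by positivity, fun y => ?_⟩
  refine (abs_P_le hD (le_max_left 1 |y|) (le_max_right 1 |y|)).trans ?_
  gcongr
  rcases max_cases 1 |y| with ⟨h, -⟩ | ⟨h, -⟩ <;> rw [h]
  · rw [one_pow]; linarith [pow_nonneg (abs_nonneg y) κ]
  · linarith

/-- The potential at scale `ε`, truncated where it exceeds its essential supremum. -/
noncomputable def scaledKernel (ρ : ℝ → ℂ) (ε x : ℝ) : ℂ :=
  ε * {y | ‖ρ y‖ ≤ (eLpNorm ρ ⊤ volume).toReal}.indicator ρ (ε * x)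

section scaledKernel

variable {ρ : ℝ → ℂ} {ε : ℝ}

lemma indicator_essSup_ae_eq (hρ : eLpNorm ρ ⊤ volume ≠ ⊤) :
    {y | ‖ρ y‖ ≤ (eLpNorm ρ ⊤ volume).toReal}.indicator ρ =ᵐ[volume] ρ := by
  filter_upwards [ae_le_eLpNormEssSup (f := ρ) (μ := volume)] with x hx
  refine Set.indicator_of_mem ?_ ρ
  rw [← eLpNorm_exponent_top] at hx
  simpa using ENNReal.toReal_mono hρ hx

lemma measurable_scaledKernel (hρ : Measurable ρ) (ε : ℝ) : Measurable (scaledKernel ρ ε) := by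
  have hm : Measurable ({y | ‖ρ y‖ ≤ (eLpNorm ρ ⊤ volume).toReal}.indicator ρ) :=
    hρ.indicator (measurableSet_le hρ.norm measurable_const)
  exact (hm.comp (measurable_id.const_mul ε)).const_mul _

lemma norm_scaledKernel_le (hε : 0 ≤ ε) (x : ℝ) :
    ‖scaledKernel ρ ε x‖ ≤ ε * (eLpNorm ρ ⊤ volume).toReal := by
  rw [scaledKernel, norm_mul, Complex.norm_real, Real.norm_of_nonneg hε]
  gcongr
  by_cases hx : ‖ρ (ε * x)‖ ≤ (eLpNorm ρ ⊤ volume).toReal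
  · rwa [Set.indicator_of_mem (by exact hx)]
  · rw [Set.indicator_of_notMem (by exact hx), norm_zero]
    exact ENNReal.toReal_nonneg

lemma lintegral_scaledKernel (hρ1 : Integrable ρ) (hρ : eLpNorm ρ ⊤ volume ≠ ⊤) (hε : 0 < ε) :
    ∫⁻ x, ‖scaledKernel ρ ε x‖ₑ = ENNReal.ofReal (∫ x, ‖ρ x‖) := by
  have hae := indicator_essSup_ae_eq hρ
  have hprod_int : Integrable (scaledKernel ρ ε) :=
    (((integrable_congr hae).2 hρ1).comp_mul_left' hε.ne').const_mul _
  rw [← ofReal_integral_norm_eq_lintegral_enorm hprod_int]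
  congr 1
  unfold scaledKernel
  simp_rw [norm_mul, Complex.norm_real, Real.norm_of_nonneg hε.le]
  rw [integral_const_mul, Measure.integral_comp_mul_left
    (fun y => ‖{y | ‖ρ y‖ ≤ (eLpNorm ρ ⊤ volume).toReal}.indicator ρ y‖), smul_eq_mul,
    abs_of_pos (inv_pos.2 hε), mul_inv_cancel_left₀ hε.ne']
  refine integral_congr_ae ?_
  filter_upwards [hae] with x hx
  rw [hx]

lemma integral_mul_comp_eq_kconv (hρ : eLpNorm ρ ⊤ volume ≠ ⊤) (hε : 0 < ε) (g : ℝ → ℂ) (ξ : ℝ) :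
    ∫ x, ρ x * g (ξ - x / ε) = kconv (scaledKernel ρ ε) g ξ := by
  set ρ' := {y | ‖ρ y‖ ≤ (eLpNorm ρ ⊤ volume).toReal}.indicator ρ with hρ'
  have h1 : ∫ x, ρ x * g (ξ - x / ε) = ∫ x, ρ' x * g (ξ - x / ε) := by
    refine integral_congr_ae ?_
    filter_upwards [indicator_essSup_ae_eq hρ] with x hx
    rw [hρ', hx]
  have h2 := Measure.integral_comp_mul_left (fun x => ρ' x * g (ξ - x / ε)) ε
  have h3 := integral_sub_left_eq_self (fun x => scaledKernel ρ ε x * g (ξ - x)) volume ξ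
  simp_rw [sub_sub_cancel] at h3
  rw [h1, kconv, h3]
  simp_rw [mul_div_cancel_left₀ _ hε.ne'] at h2
  simp_rw [scaledKernel, ← hρ', mul_assoc]
  rw [integral_const_mul, h2, abs_of_pos (inv_pos.2 hε), Complex.real_smul, ← mul_assoc,
    ← Complex.ofReal_mul, mul_inv_cancel₀ hε.ne', Complex.ofReal_one, one_mul]

end scaledKernel

lemma psiIter_eq_expIter {ρ : ℝ → ℂ} {ε : ℝ} (hρ : eLpNorm ρ ⊤ volume ≠ ⊤) (hε : 0 < ε) (κ : ℕ)
    (d : ℕ → ℝ) (μ₀ : ℝ → ℂ) (α τ : ℝ) (n : ℕ) :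
    psiIter κ d ρ μ₀ ε α τ n =
      expIter (fun ξ => ε ^ α * P κ d ξ) (scaledKernel ρ ε) μ₀ τ n := by
  induction n with
  | zero => rfl
  | succ n ih =>
    ext ξ
    rw [psiIter, expIter, ih]
    dsimp only
    rw [← integral_mul_comp_eq_kconv hρ hε]
    congr 2
    · refine intervalIntegral.integral_congr fun s _ => ?_
      simp only [osc, mul_assoc]
    · refine integral_congr_ae (Filter.Eventually.of_forall fun x => ?_)
      simp only [osc, mul_assoc, neg_mul, Complex.ofReal_neg, mul_neg]

open Classical in
/-- The untwisted flow of a solution of the Duhamel equation, extended by zero. -/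
noncomputable def untwist (κ : ℕ) (d : ℕ → ℝ) (ε α T : ℝ) (ψ : ℝ → ℝ → ℂ) (s η : ℝ) : ℂ :=
  if s ∈ Set.Icc 0 T then osc (-(s * (ε ^ α * P κ d η))) * ψ s η else 0

lemma osc_mul_untwist {κ : ℕ} {d : ℕ → ℝ} {ε α T : ℝ} {ψ : ℝ → ℝ → ℂ} {s : ℝ}
    (hs : s ∈ Set.Icc 0 T) (η : ℝ) :
    osc (s * (ε ^ α * P κ d η)) * untwist κ d ε α T ψ s η = ψ s η := by
  rw [untwist, if_pos hs, ← mul_assoc, mul_comm (osc _), osc_neg_mul_self, one_mul]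

lemma enorm_untwist_le {κ : ℕ} {d : ℕ → ℝ} {ε α T : ℝ} {ψ : ℝ → ℝ → ℂ} {s : ℝ}
    (hs : s ∈ Set.Icc 0 T) (η : ℝ) : ‖untwist κ d ε α T ψ s η‖ₑ = ‖ψ s η‖ₑ := by
  rw [untwist, if_pos hs, enorm_mul, enorm_osc, one_mul]

lemma measurable_phase (κ : ℕ) (d : ℕ → ℝ) (ε α : ℝ) :
    Measurable fun ξ => ε ^ α * P κ d ξ := (measurable_P κ d).const_mul _

lemma measurable_untwist {κ : ℕ} {d : ℕ → ℝ} {ε α T : ℝ} {ψ : ℝ → ℝ → ℂ}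
    (hψ : Measurable (Function.uncurry ψ)) :
    Measurable (Function.uncurry (untwist κ d ε α T ψ)) := by
  have h : Measurable fun z : ℝ × ℝ => osc (-(z.1 * (ε ^ α * P κ d z.2))) * ψ z.1 z.2 :=
    (measurable_osc.comp
      (measurable_fst.mul ((measurable_phase κ d ε α).comp measurable_snd)).neg).mul hψ
  have hs : MeasurableSet {z : ℝ × ℝ | z.1 ∈ Set.Icc 0 T} := measurable_fst measurableSet_Icc
  exact h.ite hs measurable_const

lemma IsDuhamelSolution.isTwistedFlow {κ : ℕ} {d : ℕ → ℝ} {ε α T : ℝ} {ρ μ₀ : ℝ → ℂ}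
    {ψ : ℝ → ℝ → ℂ} (hψ : IsDuhamelSolution κ d ε α T ρ μ₀ ψ) (hε : 0 < ε) (hρm : Measurable ρ)
    (hρ1 : Integrable ρ) (hρ : eLpNorm ρ ⊤ volume ≠ ⊤) (hμm : Measurable μ₀) :
    ∃ M, IsTwistedFlow (fun ξ => ε ^ α * P κ d ξ) (scaledKernel ρ ε)
      (ε * (eLpNorm ρ ⊤ volume).toReal) (∫ x, ‖ρ x‖) T M μ₀ (untwist κ d ε α T ψ) := by
  obtain ⟨hm, ⟨B, hB⟩, hduh⟩ := hψ
  obtain ⟨C, hC0, hC⟩ := exists_abs_P_le κ d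
  have hεα : 0 ≤ ε ^ α := Real.rpow_nonneg hε.le α
  have hK : 0 ≤ 1 + ε ^ α * C := by positivity
  have hbound : ∀ (f : ℝ → ℝ → ℝ≥0∞), (∀ s ∉ Set.Icc 0 T, ∀ η, f s η = 0) →
      (∀ s ∈ Set.Icc 0 T, ∀ η, f s η ≤
        ENNReal.ofReal ((1 + ε ^ α * C) * ((1 + |η| ^ κ) * ‖ψ s η‖))) →
      ∀ s, ∫⁻ η, f s η ≤ ENNReal.ofReal (1 + ε ^ α * C) * ENNReal.ofReal B := by
    intro f h0 h1 s
    by_cases hs : s ∈ Set.Icc 0 T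
    · calc _ ≤ ∫⁻ η, ENNReal.ofReal (1 + ε ^ α * C) *
            ENNReal.ofReal ((1 + |η| ^ κ) * ‖ψ s η‖) := by
            refine lintegral_mono fun η => ?_
            rw [← ENNReal.ofReal_mul hK]
            exact h1 s hs η
        _ ≤ _ := by
            rw [lintegral_const_mul' _ _ ENNReal.ofReal_ne_top]
            gcongr
            exact hB s hs
    · simp [h0 s hs]
  refine ⟨ENNReal.ofReal (1 + ε ^ α * C) * ENNReal.ofReal B, measurable_phase κ d ε α,
    measurable_scaledKernel hρm ε, hμm, measurable_untwist hm, norm_scaledKernel_le hε.le,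
    integral_nonneg fun _ => norm_nonneg _, (lintegral_scaledKernel hρ1 hρ hε).le,
    ENNReal.mul_ne_top ENNReal.ofReal_ne_top ENNReal.ofReal_ne_top, ?_, ?_, ?_⟩
  · refine hbound (fun s η => ‖untwist κ d ε α T ψ s η‖ₑ) (fun s hs η => ?_) fun s hs η => ?_
    · rw [untwist, if_neg hs, enorm_zero]
    · rw [enorm_untwist_le hs, ← ofReal_norm]
      refine ENNReal.ofReal_le_ofReal ?_
      have h1 : 0 ≤ |η| ^ κ * ‖ψ s η‖ := by positivity
      have h2 : 0 ≤ ε ^ α * C * ((1 + |η| ^ κ) * ‖ψ s η‖) := by positivity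
      linarith
  · refine hbound (fun s η => ‖((ε ^ α * P κ d η : ℝ) : ℂ) * untwist κ d ε α T ψ s η‖ₑ)
      (fun s hs η => ?_) fun s hs η => ?_
    · rw [untwist, if_neg hs, mul_zero, enorm_zero]
    · rw [enorm_mul, enorm_untwist_le hs, ← enorm_mul, ← ofReal_norm, norm_mul,
        Complex.norm_real, norm_mul, Real.norm_of_nonneg hεα, Real.norm_eq_abs]
      refine ENNReal.ofReal_le_ofReal ?_
      have h1 : ε ^ α * |P κ d η| * ‖ψ s η‖ ≤ ε ^ α * (C * (1 + |η| ^ κ)) * ‖ψ s η‖ := by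
        gcongr
        exact hC η
      have h2 : 0 ≤ (1 + |η| ^ κ) * ‖ψ s η‖ := by positivity
      linarith
  · intro s hs
    filter_upwards [hduh s hs] with η hη
    rw [osc_mul_untwist hs, hη]
    congr 1
    refine intervalIntegral.integral_congr fun r hr => ?_
    rw [Set.uIcc_of_le hs.1] at hr
    rw [← integral_mul_comp_eq_kconv hρ hε, ← integral_const_mul]
    refine integral_congr_ae (Filter.Eventually.of_forall fun x => ?_)
    dsimp only
    rw [untwist, if_pos ⟨hr.1, hr.2.trans hs.2⟩]
    have : Complex.exp (Complex.I * Complex.ofReal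
        (r * ε ^ α * (P κ d η - P κ d (η - x / ε)))) =
        osc (r * (ε ^ α * P κ d η)) * osc (-(r * (ε ^ α * P κ d (η - x / ε)))) := by
      rw [← osc_add, osc]
      ring_nf
    rw [this]
    ring

lemma one_le_log_one_div {x : ℝ} (hx : 0 < x) (hx1 : x < Real.exp (-1)) :
    1 ≤ Real.log (1 / x) := by
  rw [one_div, Real.log_inv]
  have := Real.log_lt_log hx hx1
  rw [Real.log_exp] at this
  linarith

lemma resonanceLog_le {κ : ℕ} {τ ε : ℝ} (hτ : 1 ≤ Real.log (1 / τ))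
    (hε : 1 ≤ Real.log (1 / ε)) : resonanceLog κ τ ≤ 9 * (Real.log (1 / ε) *
      if κ = 2 then (Real.log (1 / ε) + Real.log (1 / τ)) ^ 2 else 1) := by
  unfold resonanceLog
  split_ifs
  · calc (2 + Real.log (1 / τ)) ^ 2
        ≤ (3 * (Real.log (1 / ε) + Real.log (1 / τ))) ^ 2 := by gcongr; linarith
      _ = 9 * (1 * (Real.log (1 / ε) + Real.log (1 / τ)) ^ 2) := by ring
      _ ≤ _ := by gcongr
  · linarith

lemma rpow_mul_rpow_neg_mul_self {κ : ℕ} (hκ : κ ≠ 0) {ε : ℝ} (hε : 0 < ε) (α : ℝ) :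
    ε * ε ^ (-(α / κ)) * ε ^ α = ε ^ (1 + ((κ : ℝ) - 1) * α / κ) := by
  nth_rewrite 1 [← Real.rpow_one ε]
  rw [← Real.rpow_add hε, ← Real.rpow_add hε]
  congr 1
  have : (κ : ℝ) ≠ 0 := by exact_mod_cast hκ
  field_simp
  ring

lemma sq_mul_rpow_neg {κ : ℕ} {ε : ℝ} (hε : 0 < ε) (α : ℝ) :
    ε ^ 2 * (ε ^ (-(α / κ))) ^ 2 = ε ^ (2 - 2 * α / κ) := by
  rw [← Real.rpow_natCast ε 2, ← Real.rpow_mul_natCast hε.le, ← Real.rpow_add hε]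
  congr 1
  push_cast
  ring

lemma lintegral_enorm_le_of_weight {κ : ℕ} {μ₀ : ℝ → ℂ}
    (hμ : Integrable (fun ξ : ℝ => (1 + |ξ| ^ κ) * ‖μ₀ ξ‖)) :
    ∫⁻ ξ, ‖μ₀ ξ‖ₑ ≤ ENNReal.ofReal (∫ ξ, (1 + |ξ| ^ κ) * ‖μ₀ ξ‖) := by
  rw [ofReal_integral_eq_lintegral_ofReal hμ (Filter.Eventually.of_forall fun ξ => by positivity)]
  refine lintegral_mono fun ξ => ?_
  rw [← ofReal_norm]
  refine ENNReal.ofReal_le_ofReal ?_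
  have : 0 ≤ |ξ| ^ κ * ‖μ₀ ξ‖ := by positivity
  linarith

lemma lintegral_enorm_phase_mul_le {κ : ℕ} {d : ℕ → ℝ} {C : ℝ} (hC0 : 0 ≤ C)
    (hC : ∀ y, |P κ d y| ≤ C * (1 + |y| ^ κ)) {μ₀ : ℝ → ℂ}
    (hμ : Integrable (fun ξ : ℝ => (1 + |ξ| ^ κ) * ‖μ₀ ξ‖)) {c : ℝ} (hc : 0 ≤ c) :
    ∫⁻ ξ, ‖((c * P κ d ξ : ℝ) : ℂ) * μ₀ ξ‖ₑ ≤
      ENNReal.ofReal (c * (C * ∫ ξ, (1 + |ξ| ^ κ) * ‖μ₀ ξ‖)) := by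
  rw [← mul_assoc, ENNReal.ofReal_mul (mul_nonneg hc hC0), ofReal_integral_eq_lintegral_ofReal hμ
    (Filter.Eventually.of_forall fun ξ => by positivity),
    ← lintegral_const_mul' _ _ ENNReal.ofReal_ne_top]
  refine lintegral_mono fun ξ => ?_
  rw [← ofReal_norm, ← ENNReal.ofReal_mul (mul_nonneg hc hC0), norm_mul, Complex.norm_real,
    norm_mul, Real.norm_of_nonneg hc, Real.norm_eq_abs]
  refine ENNReal.ofReal_le_ofReal ?_
  calc c * |P κ d ξ| * ‖μ₀ ξ‖ ≤ c * (C * (1 + |ξ| ^ κ)) * ‖μ₀ ξ‖ := by gcongr; exact hC ξ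
    _ = _ := by ring

/-- The error bound for the abstract flow, with all constants explicit. -/
lemma IsTwistedFlow.lintegral_error_le_explicit {θ : ℝ → ℝ} {k : ℝ → ℂ} {N R T : ℝ} {M : ℝ≥0∞}
    {μ₀ : ℝ → ℂ} {v : ℝ → ℝ → ℂ} (h : IsTwistedFlow θ k N R T M μ₀ v) {τ : ℝ}
    (hτ : 0 < τ) (hτ1 : τ ≤ 1) {A D m a c : ℝ} (hA0 : 0 ≤ A) (hD0 : 0 ≤ D) (hm0 : 0 ≤ m)
    (ha0 : 0 ≤ a) (hc : a + R * m ≤ c)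
    (hA : ∀ b, ∫⁻ ξ, ENNReal.ofReal (kernelBound τ (θ ξ) b) ≤ ENNReal.ofReal A)
    (hD : ∫⁻ ξ, ∫⁻ η, ENNReal.ofReal (kernelBound τ (θ ξ) (θ η)) ≤ ENNReal.ofReal D)
    (hm : ∫⁻ η, ‖μ₀ η‖ₑ ≤ ENNReal.ofReal m) (ha : ∫⁻ η, ‖(θ η : ℂ) * μ₀ η‖ₑ ≤ ENNReal.ofReal a)
    {n : ℕ} (hn : n * τ ≤ T) :
    ∫⁻ ξ, ‖osc (n * τ * θ ξ) * v (n * τ) ξ - expIter θ k μ₀ τ n ξ‖ₑ ≤ ENNReal.ofReal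
      (N * (36 * (T + 8) * τ * (A * a + D * (N * m + T * (N * (Real.exp (2 * R * T) * (2 * c)))))) *
        Real.exp (R * T)) := by
  have hN := h.norm_bound_nonneg
  have hR := h.mass_nonneg
  have hT : 0 ≤ T := le_trans (by positivity) hn
  have hc0 : 0 ≤ c := le_trans (by positivity) hc
  have h0 : ∫⁻ η, ‖velocity θ k μ₀ η‖ₑ ≤ ENNReal.ofReal c := by
    calc _ ≤ ∫⁻ η, (‖(θ η : ℂ) * μ₀ η‖ₑ + ‖kconv k μ₀ η‖ₑ) :=
          lintegral_mono (enorm_velocity_le θ k μ₀)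
      _ ≤ ENNReal.ofReal a + ENNReal.ofReal R * ENNReal.ofReal m := by
          rw [lintegral_add_right _
            (measurable_kconv_right h.measurable_kernel h.measurable_data).enorm]
          gcongr
          exact (h.lintegral_kconv_le_mul h.measurable_data).trans (by gcongr)
      _ ≤ _ := by
          rw [← ENNReal.ofReal_mul hR, ← ENNReal.ofReal_add ha0 (by positivity)]
          exact ENNReal.ofReal_le_ofReal hc
  have hvel : ∀ s ∈ Set.Icc 0 T, ∫⁻ η, ‖velocity θ k (v s) η‖ₑ ≤
      ENNReal.ofReal (Real.exp (2 * R * T) * (2 * c)) := fun s hs =>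
    (h.lintegral_velocity_le_exp hc0 h0 hs).trans (ENNReal.ofReal_le_ofReal (by
      gcongr
      exact hs.2))
  refine (h.lintegral_error_le hτ (fun t ht => h.lintegral_accumulatedDefect_le hτ hτ1
    (by positivity) hvel hA hD ht) hn).trans ?_
  have hw : 0 ≤ 36 * (T + 8) * τ := by positivity
  have hU : 0 ≤ T * (N * (Real.exp (2 * R * T) * (2 * c))) := by positivity
  generalize 36 * (T + 8) * τ = w at hw ⊢
  generalize T * (N * (Real.exp (2 * R * T) * (2 * c))) = U at hU ⊢
  rw [ENNReal.ofReal_mul (q := Real.exp (R * T)) (by positivity), ENNReal.ofReal_mul hN,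
    ENNReal.ofReal_mul hw, ENNReal.ofReal_add (by positivity) (by positivity),
    ENNReal.ofReal_mul hA0, ENNReal.ofReal_mul hD0,
    ENNReal.ofReal_add (by positivity) hU, ENNReal.ofReal_mul hN]
  gcongr

/-- Optimal error estimate for the exponential integrator (Theorem 1.2 of the
paper): `‖μ(nτ) − μⁿ‖ ≤ C τ ε^{1+(κ−1)α/κ}(1 + τ^{1−1/κ} log(1/ε))
+ C τ ε^{2−2α/κ} log(1/ε) ⋅ B_κ(ε,τ)`, with `B_κ = 1` for `κ ≥ 3` and
`B₂ = (log(1/ε)+log(1/τ))²`, with no coupling between `τ` and `ε`. -/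
theorem exponential_integrator_error (κ : ℕ) (hκ : 2 ≤ κ)
    (d : ℕ → ℝ) (hd : d κ = 1)
    (α : ℝ) (hα : α ∈ Set.Icc (0:ℝ) (κ : ℝ)) (T : ℝ) (hT : 0 < T)
    (ρ : ℝ → ℂ) (hρm : Measurable ρ) (hρ1 : Integrable ρ)
    (hρinf : eLpNorm ρ ⊤ volume ≠ ⊤)
    (hρsymm : ∀ᵐ ξ : ℝ, ρ (-ξ) = starRingEnd ℂ (ρ ξ))
    (μ₀ : ℝ → ℂ) (hμm : Measurable μ₀)
    (hμ1 : Integrable (fun ξ : ℝ => (1 + |ξ| ^ κ) * ‖μ₀ ξ‖))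
    (σ L₀ : ℝ) (hσ : 0 < σ) (hL₀ : 1 ≤ L₀)
    (hρdecay : ∀ L : ℝ, L₀ ≤ L → (∫ ξ in {x : ℝ | L ≤ |x|}, ‖ρ ξ‖) ≤ L ^ (-σ))
    (hμdecay : ∀ L : ℝ, L₀ ≤ L →
      (∫ ξ in {x : ℝ | L ≤ |x|}, |ξ| ^ κ * ‖μ₀ ξ‖) ≤ L ^ (-σ))
    (hμinf : ∃ M : ℝ, ∀ᵐ ξ : ℝ, |ξ| ^ κ * ‖μ₀ ξ‖ ≤ M)
    (hμmom : α < 2 * κ / ((κ : ℝ) + 2) →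
      Integrable (fun ξ : ℝ => |ξ| ^ (2 * κ - 1) * ‖μ₀ ξ‖)) :
    ∃ τ₀ : ℝ, 0 < τ₀ ∧ ∃ ε₀ : ℝ, ε₀ ∈ Set.Ioo (0:ℝ) 1 ∧ ∃ C : ℝ, 0 < C ∧
      ∀ τ : ℝ, 0 < τ → τ < τ₀ → ∀ ε : ℝ, 0 < ε → ε < ε₀ →
        ∀ ψ : ℝ → ℝ → ℂ, IsDuhamelSolution κ d ε α T ρ μ₀ ψ →
          ∀ n : ℕ, (n : ℝ) * τ ≤ T →
            (∫⁻ ξ : ℝ, (‖ψ ((n : ℝ) * τ) ξ - psiIter κ d ρ μ₀ ε α τ n ξ‖₊ : ℝ≥0∞)) ≤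
              ENNReal.ofReal
                (C * τ * ε ^ (1 + ((κ : ℝ) - 1) * α / κ) *
                    (1 + τ ^ (1 - 1 / (κ : ℝ)) * Real.log (1 / ε)) +
                  C * τ * ε ^ (2 - 2 * α / κ) * Real.log (1 / ε) *
                    (if κ = 2 then (Real.log (1 / ε) + Real.log (1 / τ)) ^ 2
                      else 1)) := by
  obtain ⟨K, hK0, hK⟩ := lintegral_kernelBound_P_le hκ hd
  obtain ⟨c₀, hc0, hc⟩ := exists_abs_P_le κ d
  have hκ0 : κ ≠ 0 := by omega
  set m := ∫ ξ, (1 + |ξ| ^ κ) * ‖μ₀ ξ‖ with hm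
  have hm0 : 0 ≤ m := integral_nonneg fun ξ => by positivity
  set R := ∫ x, ‖ρ x‖ with hR
  have hR0 : 0 ≤ R := integral_nonneg fun _ => norm_nonneg _
  set S := (eLpNorm ρ ⊤ volume).toReal with hS
  have hS0 : 0 ≤ S := ENNReal.toReal_nonneg
  set c := c₀ * m + R * m with hcdef
  set K₁ := S * (36 * (T + 8)) * (K * (c₀ * m)) * Real.exp (R * T) with hK₁
  set K₂ := S * (36 * (T + 8)) * (K * (S * m + T * (S * (Real.exp (2 * R * T) * (2 * c))))) *
    Real.exp (R * T) with hK₂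
  have hK₁0 : 0 ≤ K₁ := by positivity
  have hK₂0 : 0 ≤ K₂ := by positivity
  refine ⟨Real.exp (-1), Real.exp_pos _, Real.exp (-1), ⟨Real.exp_pos _, by simp⟩,
    K₁ + 9 * K₂ + 1, by positivity, ?_⟩
  intro τ hτ hττ ε hε hεε ψ hψ n hn
  have he1 : Real.exp (-1) ≤ 1 := by simp
  have hτ1 : τ ≤ 1 := hττ.le.trans he1
  have hε1 : ε ≤ 1 := hεε.le.trans he1
  have hlτ := one_le_log_one_div hτ hττ
  have hlε := one_le_log_one_div hε hεε
  obtain ⟨M, hflow⟩ := hψ.isTwistedFlow hε hρm hρ1 hρinf hμm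
  obtain ⟨hA, hD⟩ := hK τ ε α hτ hτ1 hε hε1 hα.1
  have hL := resonanceLog_nonneg κ τ
  have hεα : ε ^ α ≤ 1 := Real.rpow_le_one hε.le hε1 hα.1
  have hca : ε ^ α * (c₀ * m) + R * m ≤ c := by
    have : ε ^ α * (c₀ * m) ≤ 1 * (c₀ * m) := by gcongr
    linarith
  have key := hflow.lintegral_error_le_explicit hτ hτ1 (by positivity) (by positivity) hm0
    (by positivity) hca hA hD (lintegral_enorm_le_of_weight hμ1)
    (lintegral_enorm_phase_mul_le hc0 hc hμ1 (Real.rpow_nonneg hε.le α)) hn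
  have hset : (n : ℝ) * τ ∈ Set.Icc 0 T := ⟨by positivity, hn⟩
  rw [← psiIter_eq_expIter hρinf hε] at key
  simp_rw [osc_mul_untwist hset] at key
  refine key.trans (ENNReal.ofReal_le_ofReal ?_)
  set B := Real.log (1 / ε) *
    if κ = 2 then (Real.log (1 / ε) + Real.log (1 / τ)) ^ 2 else 1 with hB
  have hB0 : 0 ≤ B := by
    have := resonanceLog_le (κ := κ) hlτ hlε
    linarith
  set E₁ := ε ^ (1 + ((κ : ℝ) - 1) * α / κ) with hE₁
  set E₂ := ε ^ (2 - 2 * α / κ) with hE₂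
  have hE₁0 : 0 ≤ E₁ := Real.rpow_nonneg hε.le _
  have hE₂0 : 0 ≤ E₂ := Real.rpow_nonneg hε.le _
  calc _ = K₁ * τ * E₁ + K₂ * τ * E₂ * resonanceLog κ τ := by
        rw [hE₁, hE₂, ← rpow_mul_rpow_neg_mul_self hκ0 hε, ← sq_mul_rpow_neg hε, hK₁, hK₂]
        ring
    _ ≤ (K₁ + 9 * K₂ + 1) * τ * E₁ *
          (1 + τ ^ (1 - 1 / (κ : ℝ)) * Real.log (1 / ε)) + (K₁ + 9 * K₂ + 1) * τ * E₂ * B := by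
        refine add_le_add ?_ ?_
        · have h1 : 1 ≤ 1 + τ ^ (1 - 1 / (κ : ℝ)) * Real.log (1 / ε) := by
            have : 0 ≤ τ ^ (1 - 1 / (κ : ℝ)) * Real.log (1 / ε) := by positivity
            linarith
          calc K₁ * τ * E₁ = K₁ * τ * E₁ * 1 := (mul_one _).symm
            _ ≤ _ := by
                gcongr
                linarith
        · calc K₂ * τ * E₂ * resonanceLog κ τ ≤ K₂ * τ * E₂ * (9 * B) := by
                gcongr
                exact resonanceLog_le hlτ hlε
            _ = 9 * K₂ * τ * E₂ * B := by ring
            _ ≤ _ := by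
                gcongr
                linarith
    _ = _ := by rw [hB]; ring
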